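/- There is an absolute constant C such that for every prime p and every X ≥ 1, the number of GL₂(ℤ)-equivalence classes of irreducible integral binary cubic forms f with |Disc(f)| < X that lie in 𝒵_p is at most C·X/p², where f ∈ 𝒵_p means: either p divides all four coefficients of f, or some γ ∈ GL₂(ℤ) makes the coefficients a′, b′ of x³ and x²y in γ·f satisfy p² ∣ a′ and p ∣ b′, or the reduction of f modulo p has a triple root in ℙ¹(𝔽_p). -/

import Mathlib

open Filter Asymptotics Real

/-- An integral binary cubic form `ax³ + bx²y + cxy² + dy³`, recorded as `(a,b,c,d)`. -/
abbrev BinaryCubic := ℤ × ℤ × ℤ × ℤ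

/-- The homogeneous polynomial associated to a binary cubic form over a commutative ring. -/
noncomputable def toPoly {A : Type*} [CommRing A] (f : A × A × A × A) :
    MvPolynomial (Fin 2) A :=
  MvPolynomial.C f.1 * MvPolynomial.X 0 ^ 3 +
    MvPolynomial.C f.2.1 * MvPolynomial.X 0 ^ 2 * MvPolynomial.X 1 +
    MvPolynomial.C f.2.2.1 * MvPolynomial.X 0 * MvPolynomial.X 1 ^ 2 +
    MvPolynomial.C f.2.2.2 * MvPolynomial.X 1 ^ 3

/-- `ActsTo γ f g` means `g = γ · f` under the twisted action
`(γ · f)(x,y) = (det γ)⁻¹ · f((x,y)·γ)`, expressed without inverses as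
`(det γ) · (γ·f)(x,y) = f((x,y)·γ)`. -/
def ActsTo {A : Type*} [CommRing A] (γ : Matrix (Fin 2) (Fin 2) A)
    (f g : A × A × A × A) : Prop :=
  MvPolynomial.C γ.det * toPoly g =
    MvPolynomial.bind₁
      (fun j : Fin 2 =>
        MvPolynomial.C (γ 0 j) * MvPolynomial.X 0 + MvPolynomial.C (γ 1 j) * MvPolynomial.X 1)
      (toPoly f)

/-- `GL₂(ℤ)`-equivalence of integral binary cubic forms (twisted action). -/
def FormEquiv (f g : BinaryCubic) : Prop :=
  ∃ γ : Matrix (Fin 2) (Fin 2) ℤ, IsUnit γ.det ∧ ActsTo γ f g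

/-- The discriminant of a binary cubic form `(a,b,c,d)`:
`b²c² − 4ac³ − 4b³d − 27a²d² + 18abcd`. -/
def discF (f : BinaryCubic) : ℤ :=
  f.2.1 ^ 2 * f.2.2.1 ^ 2 - 4 * f.1 * f.2.2.1 ^ 3 - 4 * f.2.1 ^ 3 * f.2.2.2 -
    27 * f.1 ^ 2 * f.2.2.2 ^ 2 + 18 * f.1 * f.2.1 * f.2.2.1 * f.2.2.2

/-- Irreducibility of a binary cubic form, as a polynomial over `ℚ`. -/
def IrredForm (f : BinaryCubic) : Prop :=
  Irreducible (MvPolynomial.map (Int.castRingHom ℚ) (toPoly f))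

/-- The number of `GL₂(ℤ)`-equivalence classes of integral binary cubic forms
satisfying a property `P` (assumed `GL₂(ℤ)`-invariant). -/
noncomputable def countClasses (P : BinaryCubic → Prop) : ℕ :=
  Nat.card (Quot fun f g : { f : BinaryCubic // P f } => FormEquiv f.1 g.1)

/-- `f` mod `p` has a triple root in `ℙ¹(𝔽_p)`: it is a unit multiple of the cube
of a nonzero linear form. -/
def HasTripleRoot (p : ℕ) (f : BinaryCubic) : Prop :=
  ∃ u r s : ZMod p, IsUnit u ∧ (r, s) ≠ (0, 0) ∧
    toPoly ((f.1 : ZMod p), (f.2.1 : ZMod p), (f.2.2.1 : ZMod p), (f.2.2.2 : ZMod p)) =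
      MvPolynomial.C u * (MvPolynomial.C r * MvPolynomial.X 0 +
        MvPolynomial.C s * MvPolynomial.X 1) ^ 3

/-- The set `𝒵_p`: forms corresponding to cubic rings non-maximal at `p`, or maximal but
totally ramified at `p`. -/
def InZp (p : ℕ) (f : BinaryCubic) : Prop :=
  ((p : ℤ) ∣ f.1 ∧ (p : ℤ) ∣ f.2.1 ∧ (p : ℤ) ∣ f.2.2.1 ∧ (p : ℤ) ∣ f.2.2.2) ∨
    (∃ (γ : Matrix (Fin 2) (Fin 2) ℤ) (g : BinaryCubic),
        IsUnit γ.det ∧ ActsTo γ f g ∧ (p : ℤ) ^ 2 ∣ g.1 ∧ (p : ℤ) ∣ g.2.1) ∨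
    HasTripleRoot p f

namespace BinaryCubic

/-- The form `f(px + qy, rx + sy)`. -/
def subst (f : BinaryCubic) (p q r s : ℤ) : BinaryCubic :=
  (f.1 * p ^ 3 + f.2.1 * p ^ 2 * r + f.2.2.1 * p * r ^ 2 + f.2.2.2 * r ^ 3,
   3 * f.1 * p ^ 2 * q + f.2.1 * (p ^ 2 * s + 2 * p * q * r) +
     f.2.2.1 * (2 * p * r * s + q * r ^ 2) + 3 * f.2.2.2 * r ^ 2 * s,
   3 * f.1 * p * q ^ 2 + f.2.1 * (2 * p * q * s + q ^ 2 * r) +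
     f.2.2.1 * (p * s ^ 2 + 2 * q * r * s) + 3 * f.2.2.2 * r * s ^ 2,
   f.1 * q ^ 3 + f.2.1 * q ^ 2 * s + f.2.2.1 * q * s ^ 2 + f.2.2.2 * s ^ 3)

/-- Equivalence under unimodular substitutions, without the determinant twist. -/
def Eqv (f g : BinaryCubic) : Prop :=
  ∃ p q r s : ℤ, (p * s - q * r = 1 ∨ p * s - q * r = -1) ∧ g = subst f p q r s

lemma subst_subst (f : BinaryCubic) (p q r s p' q' r' s' : ℤ) :
    subst (subst f p q r s) p' q' r' s' =
      subst f (p * p' + q * r') (p * q' + q * s') (r * p' + s * r') (r * q' + s * s') := by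
  obtain ⟨a, b, c, d⟩ := f
  simp only [subst, Prod.mk.injEq]
  refine ⟨?_, ?_, ?_, ?_⟩ <;> ring

@[simp] lemma subst_one (f : BinaryCubic) : subst f 1 0 0 1 = f := by
  obtain ⟨a, b, c, d⟩ := f
  simp [subst]

lemma discF_subst (f : BinaryCubic) (p q r s : ℤ) :
    discF (subst f p q r s) = (p * s - q * r) ^ 6 * discF f := by
  obtain ⟨a, b, c, d⟩ := f
  simp only [subst, discF]
  ring

lemma Eqv.refl (f : BinaryCubic) : Eqv f f := ⟨1, 0, 0, 1, by norm_num, by simp⟩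

lemma Eqv.symm {f g : BinaryCubic} (h : Eqv f g) : Eqv g f := by
  obtain ⟨p, q, r, s, h, rfl⟩ := h
  rcases h with h | h
  · refine ⟨s, -q, -r, p, Or.inl (by linarith), ?_⟩
    rw [subst_subst, show p * s + q * -r = 1 by linarith, show p * -q + q * p = 0 by ring,
      show r * s + s * -r = 0 by ring, show r * -q + s * p = 1 by linarith, subst_one]
  · refine ⟨-s, q, r, -p, Or.inr (by linarith), ?_⟩
    rw [subst_subst, show p * -s + q * r = 1 by linarith, show p * q + q * -p = 0 by ring,
      show r * -s + s * r = 0 by ring, show r * q + s * -p = 1 by linarith, subst_one]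

lemma Eqv.trans {f g h : BinaryCubic} (h₁ : Eqv f g) (h₂ : Eqv g h) : Eqv f h := by
  obtain ⟨p, q, r, s, h₁, rfl⟩ := h₁
  obtain ⟨p', q', r', s', h₂, rfl⟩ := h₂
  refine ⟨_, _, _, _, ?_, subst_subst ..⟩
  have : (p * p' + q * r') * (r * q' + s * s') - (p * q' + q * s') * (r * p' + s * r') =
    (p * s - q * r) * (p' * s' - q' * r') := by ring
  rw [this]
  rcases h₁ with h₁ | h₁ <;> rcases h₂ with h₂ | h₂ <;> simp [h₁, h₂]

lemma Eqv.discF_eq {f g : BinaryCubic} (h : Eqv f g) : discF g = discF f := by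
  obtain ⟨p, q, r, s, h, rfl⟩ := h
  rw [discF_subst]
  rcases h with h | h <;> simp [h, Even.neg_pow (by decide : Even 6)]

/-- Equivalence of binary cubic forms as a setoid. -/
def eqvSetoid : Setoid BinaryCubic := ⟨Eqv, Eqv.refl, Eqv.symm, Eqv.trans⟩

lemma eval_toPoly {A : Type*} [CommRing A] (f : A × A × A × A) (x : Fin 2 → A) :
    MvPolynomial.eval x (toPoly f) =
      f.1 * x 0 ^ 3 + f.2.1 * x 0 ^ 2 * x 1 + f.2.2.1 * x 0 * x 1 ^ 2 + f.2.2.2 * x 1 ^ 3 := by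
  simp [toPoly]

lemma Eqv.formEquiv {f g : BinaryCubic} (h : Eqv f g) : FormEquiv f g := by
  obtain ⟨p, q, r, s, h, rfl⟩ := h
  have key : ∀ ε p q r s : ℤ, ε = 1 ∨ ε = -1 → p * s - q * r = ε →
      FormEquiv f (subst f (ε * p) (ε * q) (ε * r) (ε * s)) := by
    intro ε p q r s hε h
    refine ⟨!![p, r; q, s], ?_, ?_⟩
    · rw [Matrix.det_fin_two_of, Int.isUnit_iff]
      rcases hε with rfl | rfl
      · left; linarith
      · right; linarith
    · unfold ActsTo
      rw [Matrix.det_fin_two_of]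
      obtain ⟨a, b, c, d⟩ := f
      have h' : p * s - r * q = ε := by linarith
      rw [h']
      simp only [toPoly, subst, map_add, map_mul, map_pow, MvPolynomial.bind₁_X_right,
        MvPolynomial.algHom_C, MvPolynomial.algebraMap_eq, Matrix.of_apply, Matrix.cons_val_zero,
        Matrix.cons_val_one, map_ofNat, Matrix.cons_val', Matrix.cons_val_fin_one]
      rcases hε with rfl | rfl
      · simp only [map_one]; ring
      · simp only [map_neg, map_one]; ring
  rcases h with h | h
  · simpa using key 1 p q r s (Or.inl rfl) h
  · simpa using key (-1) (-p) (-q) (-r) (-s) (Or.inr rfl) (by linarith)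

lemma det_mul_eq_subst_of_actsTo {γ : Matrix (Fin 2) (Fin 2) ℤ} {f g : BinaryCubic}
    (h : ActsTo γ f g) :
    (γ.det * g.1, γ.det * g.2.1, γ.det * g.2.2.1, γ.det * g.2.2.2) =
      subst f (γ 0 0) (γ 1 0) (γ 0 1) (γ 1 1) := by
  have ev : ∀ x : Fin 2 → ℤ, _ := fun x => congrArg (MvPolynomial.eval x) h
  simp only [map_mul, MvPolynomial.eval_C, toPoly, map_add, map_pow,
    MvPolynomial.bind₁_X_right, MvPolynomial.eval_X, MvPolynomial.algHom_C,
    MvPolynomial.algebraMap_eq] at ev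
  have h1 := ev ![1, 0]
  have h2 := ev ![0, 1]
  have h3 := ev ![1, 1]
  have h4 := ev ![1, -1]
  obtain ⟨a, b, c, d⟩ := f
  obtain ⟨a', b', c', d'⟩ := g
  generalize γ.det = D at *
  generalize γ 0 0 = p at *
  generalize γ 1 0 = q at *
  generalize γ 0 1 = r at *
  generalize γ 1 1 = s at *
  simp only [Matrix.cons_val_zero, Matrix.cons_val_one] at h1 h2 h3 h4
  simp only [subst, Prod.mk.injEq]
  refine ⟨?_, ?_, ?_, ?_⟩
  · linear_combination h1
  · refine mul_left_cancel₀ (two_ne_zero (α := ℤ)) ?_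
    linear_combination h3 - h4 - 2 * h2
  · refine mul_left_cancel₀ (two_ne_zero (α := ℤ)) ?_
    linear_combination h3 + h4 - 2 * h1
  · linear_combination h2

/-- Every finite set of pairwise inequivalent forms satisfying `P` has at most `N` elements. -/
def ClassBound (P : BinaryCubic → Prop) (N : ℝ) : Prop :=
  ∀ s : Finset BinaryCubic, (∀ f ∈ s, P f) → (∀ f ∈ s, ∀ g ∈ s, Eqv f g → f = g) → (s.card : ℝ) ≤ N

lemma ClassBound.nonneg {P : BinaryCubic → Prop} {N : ℝ} (h : ClassBound P N) : 0 ≤ N := by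
  simpa using h ∅ (by simp) (by simp)

lemma ClassBound.mono {P Q : BinaryCubic → Prop} {M N : ℝ} (h : ClassBound Q M)
    (hPQ : ∀ f, P f → Q f) (hMN : M ≤ N) : ClassBound P N :=
  fun s hs hs' => (h s (fun f hf => hPQ f (hs f hf)) hs').trans hMN

lemma ClassBound.or {P Q : BinaryCubic → Prop} {M N : ℝ} (hP : ClassBound P M)
    (hQ : ClassBound Q N) : ClassBound (fun f => P f ∨ Q f) (M + N) := by
  classical
  intro s hs hs'
  have h1 := hP (s.filter P) (by simp) fun f hf g hg =>
    hs' f (Finset.mem_of_mem_filter f hf) g (Finset.mem_of_mem_filter g hg)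
  have h2 := hQ (s.filter fun f => ¬ P f)
    (fun f hf => (hs f (Finset.mem_of_mem_filter f hf)).resolve_left (Finset.mem_filter.1 hf).2)
    fun f hf g hg => hs' f (Finset.mem_of_mem_filter f hf) g (Finset.mem_of_mem_filter g hg)
  rw [← Finset.card_filter_add_card_filter_not P (s := s)]
  push_cast
  linarith

/-- A map to forms satisfying `Q` with at most `k` inequivalent forms over each class. -/
lemma ClassBound.of_map {P Q : BinaryCubic → Prop} {N : ℝ} (hQ : ClassBound Q N) (k : ℕ)
    (φ : BinaryCubic → BinaryCubic) (hφ : ∀ f, P f → Q (φ f))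
    (hk : ∀ s : Finset BinaryCubic, (∀ f ∈ s, P f) → (∀ f ∈ s, ∀ g ∈ s, Eqv f g → f = g) →
      (∀ f ∈ s, ∀ g ∈ s, Eqv (φ f) (φ g)) → s.card ≤ k) :
    ClassBound P (k * N) := by
  classical
  intro s hs hs'
  let c : BinaryCubic → Quotient eqvSetoid := Quotient.mk eqvSetoid
  have hc : ∀ f g, c f = c g ↔ Eqv f g := fun f g => Quotient.eq (r := eqvSetoid)
  have h1 : s.card ≤ k * (s.image fun f => c (φ f)).card := by
    refine Finset.card_le_mul_card_image s k fun x _ => hk _ ?_ ?_ ?_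
    · exact fun f hf => hs f (Finset.mem_of_mem_filter f hf)
    · exact fun f hf g hg => hs' f (Finset.mem_of_mem_filter f hf) g (Finset.mem_of_mem_filter g hg)
    · intro f hf g hg
      rw [← hc, (Finset.mem_filter.1 hf).2, (Finset.mem_filter.1 hg).2]
  obtain ⟨t, ht, htinj, him⟩ : ∃ t ⊆ s.image φ,
      Set.InjOn c t ∧ t.image c = (s.image φ).image c := by
    have := fun x (hx : x ∈ (s.image φ).image c) => Finset.mem_image.1 hx
    choose! r hr hr' using this
    refine ⟨((s.image φ).image c).image r, ?_, ?_, ?_⟩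
    · intro f hf
      obtain ⟨x, hx, rfl⟩ := Finset.mem_image.1 hf
      exact hr x hx
    · intro f hf g hg hfg
      obtain ⟨x, hx, rfl⟩ := Finset.mem_image.1 hf
      obtain ⟨y, hy, rfl⟩ := Finset.mem_image.1 hg
      rw [hr' x hx, hr' y hy] at hfg
      rw [hfg]
    · rw [Finset.image_image]
      conv_rhs => rw [← Finset.image_id (s := (s.image φ).image c)]
      exact Finset.image_congr fun x hx => hr' x hx
  have h2 : (t.card : ℝ) ≤ N := by
    refine hQ t (fun f hf => ?_) fun f hf g hg hfg => htinj hf hg ((hc f g).2 hfg)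
    obtain ⟨g, hg, rfl⟩ := Finset.mem_image.1 (ht hf)
    exact hφ g (hs g hg)
  have h3 : (s.image fun f => c (φ f)).card = t.card := by
    rw [← Finset.card_image_of_injOn htinj, him, Finset.image_image]; rfl
  calc (s.card : ℝ) ≤ k * (s.image fun f => c (φ f)).card := mod_cast h1
    _ ≤ k * N := by rw [h3]; gcongr

lemma ClassBound.of_map_inj {P Q : BinaryCubic → Prop} {N : ℝ} (hQ : ClassBound Q N)
    (φ : BinaryCubic → BinaryCubic) (hφ : ∀ f, P f → Q (φ f))
    (hk : ∀ f g, P f → P g → Eqv (φ f) (φ g) → Eqv f g) : ClassBound P N := by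
  have := hQ.of_map 1 φ hφ fun s hs hs' h => Finset.card_le_one.2 fun f hf g hg =>
    hs' f hf g hg (hk f g (hs f hf) (hs g hg) (h f hf g hg))
  simpa using this

/-- It suffices to count representatives of classes. -/
lemma ClassBound.of_reps {P Q : BinaryCubic → Prop} {N : ℝ} (hQ : ClassBound Q N)
    (h : ∀ f, P f → ∃ g, Eqv f g ∧ Q g) : ClassBound P N := by
  choose! φ h1 h2 using h
  exact hQ.of_map_inj φ h2 fun f g hf hg hfg => ((h1 f hf).trans hfg).trans (h1 g hg).symm

lemma ClassBound.of_card {P : BinaryCubic → Prop} {N : ℝ}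
    (h : ∀ s : Finset BinaryCubic, (∀ f ∈ s, P f) → (s.card : ℝ) ≤ N) : ClassBound P N :=
  fun s hs _ => h s hs

/-- Splitting according to a label. -/
lemma ClassBound.of_label {ι : Type*} [DecidableEq ι] {P : BinaryCubic → Prop}
    (ℓ : BinaryCubic → ι) (T : ι → Prop) (hT : ∀ f, P f → T (ℓ f)) (N : ι → ℝ) {M : ℝ}
    (hN : ∀ i, T i → ClassBound (fun f => P f ∧ ℓ f = i) (N i))
    (hM : ∀ t : Finset ι, (∀ i ∈ t, T i) → ∑ i ∈ t, N i ≤ M) : ClassBound P M := by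
  intro s hs hs'
  have hT' : ∀ i ∈ s.image ℓ, T i := by
    intro i hi
    obtain ⟨f, hf, rfl⟩ := Finset.mem_image.1 hi
    exact hT f (hs f hf)
  refine le_trans ?_ (hM (s.image ℓ) hT')
  rw [Finset.card_eq_sum_card_image ℓ s]
  push_cast
  refine Finset.sum_le_sum fun i hi => hN i (hT' i hi) _ ?_ ?_
  · exact fun f hf => ⟨hs f (Finset.mem_of_mem_filter f hf), (Finset.mem_filter.1 hf).2⟩
  · exact fun f hf g hg => hs' f (Finset.mem_of_mem_filter f hf) g (Finset.mem_of_mem_filter g hg)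

lemma ClassBound.countClasses_le {P : BinaryCubic → Prop} {N : ℝ} (h : ClassBound P N) :
    (countClasses P : ℝ) ≤ N := by
  classical
  unfold countClasses
  set Q := Quot fun f g : { f : BinaryCubic // P f } => FormEquiv f.1 g.1
  rcases finite_or_infinite Q with hQ | hQ
  · have := Fintype.ofFinite Q
    have hinj : Function.Injective fun x : Q => (Quot.out x).1 := by
      intro x y hxy
      rw [← Quot.out_eq x, ← Quot.out_eq y, Subtype.ext hxy]
    rw [Nat.card_eq_fintype_card, ← Finset.card_univ, ← Finset.card_image_of_injective _ hinj]
    refine h _ ?_ ?_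
    · intro f hf
      obtain ⟨x, -, rfl⟩ := Finset.mem_image.1 hf
      exact (Quot.out x).2
    · intro f hf g hg hfg
      obtain ⟨x, -, rfl⟩ := Finset.mem_image.1 hf
      obtain ⟨y, -, rfl⟩ := Finset.mem_image.1 hg
      have : x = y := by
        rw [← Quot.out_eq x, ← Quot.out_eq y]
        exact Quot.sound hfg.formEquiv
      rw [this]
  · rw [Nat.card_eq_zero_of_infinite]
    simpa using h.nonneg

lemma exists_reduced_quadratic {A B C : ℝ} (hA : 0 < A) (hD : 0 < 4 * A * C - B ^ 2) :
    ∃ p q r s : ℤ, p * s - q * r = 1 ∧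
      |2 * A * p * q + B * (p * s + q * r) + 2 * C * r * s| ≤ A * p ^ 2 + B * p * r + C * r ^ 2 ∧
      A * p ^ 2 + B * p * r + C * r ^ 2 ≤ A * q ^ 2 + B * q * s + C * s ^ 2 := by
  set e := √(4 * A * C - B ^ 2) with he
  have hepos : 0 < e := Real.sqrt_pos.2 hD
  have he2 : e ^ 2 = 4 * A * C - B ^ 2 := Real.sq_sqrt hD.le
  let z : UpperHalfPlane := ⟨⟨B / (2 * A), e / (2 * A)⟩, by positivity⟩
  obtain ⟨g, hg1, hg2⟩ := ModularGroup.exists_smul_mem_fd z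
  obtain ⟨x, y, hxy⟩ : ∃ x y : ℝ, (↑(g • z) : ℂ) = ⟨x, y⟩ := ⟨_, _, rfl⟩
  have hre : (g • z).re = x := by
    rw [← UpperHalfPlane.coe_re, hxy]
  rw [hre] at hg2
  rw [hxy, Complex.normSq_mk] at hg1
  have hdet := g.det_coe
  rw [Matrix.det_fin_two] at hdet
  rw [UpperHalfPlane.coe_specialLinearGroup_apply] at hxy
  have hne : ((algebraMap ℤ ℝ (g 1 0) : ℝ) : ℂ) * (z : ℂ) +
      ((algebraMap ℤ ℝ (g 1 1) : ℝ) : ℂ) ≠ 0 := by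
    have := UpperHalfPlane.denom_ne_zero (g : GL (Fin 2) ℝ) z
    simpa [UpperHalfPlane.denom] using this
  rw [div_eq_iff hne] at hxy
  have hz : (z : ℂ) = ⟨B / (2 * A), e / (2 * A)⟩ := rfl
  rw [hz] at hxy
  generalize g 0 0 = a at *
  generalize g 0 1 = b at *
  generalize g 1 0 = c at *
  generalize g 1 1 = d at *
  have h1 := congrArg Complex.re hxy
  have h2 := congrArg Complex.im hxy
  simp at h1 h2
  set β := B / (2 * A) with hβ
  set η := e / (2 * A) with hη
  have hB : B = 2 * A * β := by rw [hβ]; field_simp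
  have hC : C = A * (η ^ 2 + β ^ 2) := by
    have : e = 2 * A * η := by rw [hη]; field_simp
    rw [this, hB] at he2
    have h4 : 4 * A ≠ 0 := by positivity
    apply mul_left_cancel₀ h4
    linear_combination -he2
  have eA : A * d ^ 2 + B * d * c + C * c ^ 2 = A * ((c * β + d) ^ 2 + (c * η) ^ 2) := by
    rw [hB, hC]; ring
  have eC : A * b ^ 2 + B * b * a + C * a ^ 2 =
      (x * x + y * y) * (A * ((c * β + d) ^ 2 + (c * η) ^ 2)) := by
    have : A * b ^ 2 + B * b * a + C * a ^ 2 = A * ((a * β + b) ^ 2 + (a * η) ^ 2) := by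
      rw [hB, hC]; ring
    rw [this, h1, h2]; ring
  have eB : 2 * A * d * b + B * (d * a + b * c) + 2 * C * c * a =
      2 * x * (A * ((c * β + d) ^ 2 + (c * η) ^ 2)) := by
    have : 2 * A * d * b + B * (d * a + b * c) + 2 * C * c * a =
        2 * A * ((a * β + b) * (c * β + d) + (a * η) * (c * η)) := by
      rw [hB, hC]; ring
    rw [this, h1, h2]; ring
  have hpos : 0 ≤ A * ((c * β + d) ^ 2 + (c * η) ^ 2) := by positivity
  refine ⟨d, b, c, a, by linarith, ?_, ?_⟩
  · rw [eA, eB, abs_mul, abs_of_nonneg hpos, abs_mul, abs_two]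
    exact mul_le_of_le_one_left hpos (by linarith)
  · rw [eA, eC]
    exact le_mul_of_one_le_left hpos hg1

/-- The inequalities satisfied by the coefficients of a reduced form with nonzero discriminant. -/
def Bounded (M : ℝ) (f : BinaryCubic) : Prop :=
  ∃ A C ν : ℝ, 0 < A ∧ A ≤ C ∧ A * C ≤ M ∧ (ν = 1 ∨ ν = 9) ∧
    (f.1 : ℝ) ^ 2 * C ≤ A ^ 2 ∧ (f.2.1 : ℝ) ^ 2 ≤ 2 * A ∧ (f.2.2.1 : ℝ) ^ 2 ≤ 2 * C ∧
    (f.2.2.2 : ℝ) ^ 2 * A ≤ C ^ 2 ∧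
    |(f.2.1 : ℝ) * f.2.2.1 - ν * (f.1 * f.2.2.2)| ≤ 3 / 2 * A

/-- The coefficients of the Hessian of a form. -/
def hess (f : BinaryCubic) : ℤ × ℤ × ℤ :=
  (f.2.1 ^ 2 - 3 * f.1 * f.2.2.1, f.2.1 * f.2.2.1 - 9 * f.1 * f.2.2.2,
    f.2.2.1 ^ 2 - 3 * f.2.1 * f.2.2.2)

lemma hess_subst (f : BinaryCubic) (p q r s : ℤ) :
    hess (subst f p q r s) =
      ((p * s - q * r) ^ 2 * ((hess f).1 * p ^ 2 + (hess f).2.1 * p * r + (hess f).2.2 * r ^ 2),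
       (p * s - q * r) ^ 2 * (2 * (hess f).1 * p * q + (hess f).2.1 * (p * s + q * r) +
          2 * (hess f).2.2 * r * s),
       (p * s - q * r) ^ 2 * ((hess f).1 * q ^ 2 + (hess f).2.1 * q * s +
           (hess f).2.2 * s ^ 2)) := by
  obtain ⟨a, b, c, d⟩ := f
  simp only [subst, hess, Prod.mk.injEq]
  refine ⟨?_, ?_, ?_⟩ <;> ring

lemma four_mul_hess (f : BinaryCubic) :
    4 * (hess f).1 * (hess f).2.2 - (hess f).2.1 ^ 2 = 3 * discF f := by
  obtain ⟨a, b, c, d⟩ := f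
  simp only [hess, discF]
  ring

lemma reduced_quadratic_le {A B C : ℝ} (h0 : 0 < 4 * A * C - B ^ 2) (h1 : |B| ≤ A) (h2 : A ≤ C)
    (x y : ℝ) : 3 / 4 * A * x ^ 2 ≤ A * x ^ 2 - B * x * y + C * y ^ 2 ∧
      3 / 4 * C * y ^ 2 ≤ A * x ^ 2 - B * x * y + C * y ^ 2 := by
  have hA : 0 ≤ A := (abs_nonneg B).trans h1
  have hA' : 0 < A := by
    rcases hA.eq_or_lt with h | h
    · rw [← h] at h0; nlinarith [sq_nonneg B]
    · exact h
  have hBA : B ^ 2 ≤ A ^ 2 := sq_le_sq' (abs_le.1 h1).1 (abs_le.1 h1).2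
  constructor
  · have hC : 0 < C := hA'.trans_le h2
    have : 0 ≤ C * (A * x ^ 2 - B * x * y + C * y ^ 2 - 3 / 4 * A * x ^ 2) := by
      nlinarith [sq_nonneg (C * y - B * x / 2),
          mul_nonneg (sq_nonneg x) (mul_nonneg hA (sub_nonneg.2 h2)),
        mul_nonneg (sq_nonneg x) (sub_nonneg.2 hBA)]
    linarith [(mul_nonneg_iff_of_pos_left hC).1 this]
  · have : 0 ≤ A * (A * x ^ 2 - B * x * y + C * y ^ 2 - 3 / 4 * C * y ^ 2) := by
      nlinarith [sq_nonneg (A * x - B * y / 2),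
          mul_nonneg (sq_nonneg y) (mul_nonneg hA (sub_nonneg.2 h2)),
        mul_nonneg (sq_nonneg y) (sub_nonneg.2 hBA)]
    linarith [(mul_nonneg_iff_of_pos_left hA').1 this]

lemma hess_fst_pos {f : BinaryCubic} (hf : 0 < discF f) : 0 < (hess f).1 := by
  have hdisc := four_mul_hess f
  obtain ⟨a, b, c, d⟩ := f
  simp only [hess] at hdisc ⊢
  by_contra! h
  have h0 : b ^ 2 - 3 * a * c ≠ 0 := by
    intro h0
    rw [h0] at hdisc
    nlinarith [sq_nonneg (b * c - 9 * a * d)]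
  have h1 : b ^ 2 - 3 * a * c < 0 := lt_of_le_of_ne h h0
  have : 4 * (b ^ 2 - 3 * a * c) ^ 3 =
      (2 * (b ^ 2 - 3 * a * c) * b - 3 * (b * c - 9 * a * d) * a) ^ 2 +
        3 * discF (a, b, c, d) * (9 * a ^ 2) := by
    simp only [discF]; ring
  have h2 : (b ^ 2 - 3 * a * c) ^ 3 < 0 := Odd.pow_neg (by decide) h1
  nlinarith [mul_nonneg hf.le (sq_nonneg a),
    sq_nonneg (2 * (b ^ 2 - 3 * a * c) * b - 3 * (b * c - 9 * a * d) * a)]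

lemma exists_bounded_of_pos {f : BinaryCubic} (hf : 0 < discF f) :
    ∃ g, Eqv f g ∧ Bounded (discF f) g := by
  have hA := hess_fst_pos hf
  obtain ⟨p, q, r, s, hdet, h1, h2⟩ := exists_reduced_quadratic (A := (hess f).1)
    (B := (hess f).2.1) (C := (hess f).2.2) (by exact_mod_cast hA) (by
      have := four_mul_hess f
      have : (0 : ℤ) < 4 * (hess f).1 * (hess f).2.2 - (hess f).2.1 ^ 2 := by omega
      exact_mod_cast this)
  refine ⟨_, ⟨p, q, r, s, Or.inl hdet, rfl⟩, ?_⟩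
  have hg := hess_subst f p q r s
  have hD : 0 < discF (subst f p q r s) := by rwa [discF_subst, hdet, one_pow, one_mul]
  have hD' : discF f = discF (subst f p q r s) := by rw [discF_subst, hdet, one_pow, one_mul]
  rw [hD']
  generalize subst f p q r s = g at *
  rw [hdet] at hg
  simp only [one_pow, one_mul, Prod.ext_iff] at hg
  have hg1 := congrArg (Int.cast : ℤ → ℝ) hg.1
  have hg2 := congrArg (Int.cast : ℤ → ℝ) hg.2.1
  have hg3 := congrArg (Int.cast : ℤ → ℝ) hg.2.2
  push_cast at hg1 hg2 hg3
  rw [← hg1, ← hg2] at h1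
  rw [← hg1, ← hg3] at h2
  have hdisc' : 4 * ((hess g).1 : ℝ) * (hess g).2.2 - (hess g).2.1 ^ 2 = 3 * discF g := by
    exact_mod_cast four_mul_hess g
  have hDR : (0 : ℝ) < discF g := by exact_mod_cast hD
  have hA0 : (0 : ℝ) < (hess g).1 := by
    refine ((abs_nonneg _).trans h1).lt_of_ne fun h => ?_
    rw [← h] at hdisc'
    nlinarith [sq_nonneg ((hess g).2.1 : ℝ)]
  have K := reduced_quadratic_le
      (by linarith : 0 < 4 * ((hess g).1 : ℝ) * (hess g).2.2 - (hess g).2.1 ^ 2) h1 h2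
  have hB := sq_le_sq' (abs_le.1 h1).1 (abs_le.1 h1).2
  refine ⟨(hess g).1, (hess g).2.2, 9, hA0, h2, ?_, Or.inr rfl, ?_⟩
  · nlinarith [mul_le_mul_of_nonneg_left h2 hA0.le]
  obtain ⟨a, b, c, d⟩ := g
  have i1 := K b (3 * a)
  have i2 := K (3 * d) c
  have hC0 : 0 < ((hess (a, b, c, d)).2.2 : ℝ) := hA0.trans_le h2
  have e1 : ((hess (a, b, c, d)).1 : ℝ) * b ^ 2 - (hess (a, b, c, d)).2.1 * b * (3 * a) +
      (hess (a, b, c, d)).2.2 * (3 * a) ^ 2 = ((hess (a, b, c, d)).1 : ℝ) ^ 2 := by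
    simp only [hess]; push_cast; ring
  have e2 : ((hess (a, b, c, d)).1 : ℝ) * (3 * d) ^ 2 - (hess (a, b, c, d)).2.1 * (3 * d) * c +
      (hess (a, b, c, d)).2.2 * c ^ 2 = ((hess (a, b, c, d)).2.2 : ℝ) ^ 2 := by
    simp only [hess]; push_cast; ring
  have e3 : (b : ℝ) * c - 9 * (a * d) = (hess (a, b, c, d)).2.1 := by
    simp only [hess]; push_cast; ring
  rw [e1] at i1
  rw [e2] at i2
  simp only
  rw [e3]
  generalize ((hess (a, b, c, d)).1 : ℝ) = A at *
  generalize ((hess (a, b, c, d)).2.2 : ℝ) = C at *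
  refine ⟨?_, ?_, ?_, ?_, by linarith⟩
  · rw [show 3 / 4 * C * (3 * (a : ℝ)) ^ 2 = 27 / 4 * (a ^ 2 * C) by ring] at i1
    linarith [mul_nonneg (sq_nonneg (a : ℝ)) hC0.le]
  · have : A * b ^ 2 ≤ A * (2 * A) := by nlinarith [mul_pos hA0 hA0]
    exact le_of_mul_le_mul_left this hA0
  · have : C * c ^ 2 ≤ C * (2 * C) := by nlinarith [mul_pos hC0 hC0]
    exact le_of_mul_le_mul_left this hC0
  · rw [show 3 / 4 * A * (3 * (d : ℝ)) ^ 2 = 27 / 4 * (d ^ 2 * A) by ring] at i2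
    linarith [mul_nonneg (sq_nonneg (d : ℝ)) hA0.le]

lemma exists_root_cubic (b c d : ℝ) : ∃ r : ℝ, r ^ 3 + b * r ^ 2 + c * r + d = 0 := by
  have hcont : Continuous fun r : ℝ => r ^ 3 + b * r ^ 2 + c * r + d := by fun_prop
  set M := 1 + |b| + |c| + |d| with hM
  have hM1 : 1 ≤ M := by linarith [abs_nonneg b, abs_nonneg c, abs_nonneg d]
  have := abs_le.1 (le_refl |b|)
  have := abs_le.1 (le_refl |c|)
  have := abs_le.1 (le_refl |d|)
  have hM2 : M ≤ M ^ 2 := by nlinarith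
  refine mem_range_of_exists_le_of_exists_ge hcont ⟨-M, ?_⟩ ⟨M, ?_⟩
  · nlinarith [mul_nonneg (abs_nonneg c) (sub_nonneg.2 hM2)]
  · nlinarith

lemma exists_linear_mul_quadratic (f : BinaryCubic) : ∃ u v P Q R : ℝ,
    (f.1 : ℝ) = u * P ∧ (f.2.1 : ℝ) = u * Q + v * P ∧ (f.2.2.1 : ℝ) = u * R + v * Q ∧
      (f.2.2.2 : ℝ) = v * R := by
  obtain ⟨a, b, c, d⟩ := f
  by_cases ha : (a : ℝ) = 0
  · exact ⟨0, 1, b, c, d, by simp [ha]⟩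
  · obtain ⟨r, hr⟩ := exists_root_cubic (b / a) (c / a) (d / a)
    refine ⟨1, -r, a, b + a * r, c + b * r + a * r ^ 2, by simp, by ring, by ring, ?_⟩
    field_simp at hr
    linear_combination hr

set_option maxHeartbeats 600000 in
lemma bounded_of_factor {g : BinaryCubic} {u v P Q R : ℝ} (j1 : (g.1 : ℝ) = u * P)
    (j2 : (g.2.1 : ℝ) = u * Q + v * P) (j3 : (g.2.2.1 : ℝ) = u * R + v * Q)
    (j4 : (g.2.2.2 : ℝ) = v * R) (hq' : 0 < 4 * P * R - Q ^ 2) (i1 : |Q| ≤ P)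
    (i2 : P ≤ R) (hD0 : (discF g : ℝ) < 0) : Bounded (4 / 3 * |(discF g : ℝ)|) g := by
  have hD' : (discF g : ℝ) =
      -((4 * P * R - Q ^ 2) * (P * v ^ 2 - Q * u * v + R * u ^ 2) ^ 2) := by
    simp only [discF]; push_cast; rw [j1, j2, j3, j4]; ring
  have hQsq : Q ^ 2 ≤ P ^ 2 := sq_le_sq' (abs_le.1 i1).1 (abs_le.1 i1).2
  have hP0 : 0 < P := by
    refine ((abs_nonneg _).trans i1).lt_of_ne fun h => ?_
    rw [← h] at hq'
    nlinarith [sq_nonneg Q]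
  have hR0 : 0 < R := hP0.trans_le i2
  obtain ⟨S, hS⟩ : ∃ S, S = P * v ^ 2 + R * u ^ 2 := ⟨_, rfl⟩
  have hS0 : 0 ≤ S := by rw [hS]; positivity
  have huv : |u * v| * P ≤ S / 2 := by
    have : |u * v| ≤ (u ^ 2 + v ^ 2) / 2 := by
      rw [abs_mul]
      nlinarith [sq_nonneg (|u| - |v|), sq_abs u, sq_abs v]
    nlinarith [mul_le_mul_of_nonneg_right this hP0.le, mul_nonneg (sub_nonneg.2 i2) (sq_nonneg u)]
  have hQuv : |Q * (u * v)| ≤ S / 2 := by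
    rw [abs_mul]
    nlinarith [mul_le_mul_of_nonneg_right i1 (abs_nonneg (u * v))]
  have hT : S / 2 ≤ P * v ^ 2 - Q * u * v + R * u ^ 2 := by
    have := (abs_le.1 hQuv).2
    linarith
  have hSpos : 0 < S := by
    refine hS0.lt_of_ne fun h => ?_
    have hu : u = 0 := by
      have : R * u ^ 2 ≤ 0 := by nlinarith [mul_nonneg hP0.le (sq_nonneg v)]
      by_contra hne
      have : 0 < R * u ^ 2 := by positivity
      linarith
    have hv : v = 0 := by
      have : P * v ^ 2 ≤ 0 := by nlinarith [mul_nonneg hR0.le (sq_nonneg u)]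
      by_contra hne
      have : 0 < P * v ^ 2 := by positivity
      linarith
    rw [hD', hu, hv] at hD0
    simp at hD0
  have hAC : P * S * (R * S) ≤ 4 / 3 * |(discF g : ℝ)| := by
    rw [abs_of_neg hD0, hD', neg_neg]
    have k1 : 3 * (P * R) ≤ 4 * P * R - Q ^ 2 := by nlinarith
    have k2 : (S / 2) ^ 2 ≤ (P * v ^ 2 - Q * u * v + R * u ^ 2) ^ 2 :=
      pow_le_pow_left₀ (by positivity) hT 2
    have := mul_le_mul k1 k2 (by positivity) hq'.le
    linarith
  refine ⟨P * S, R * S, 1, by positivity, by gcongr, hAC, Or.inl rfl, ?_, ?_, ?_, ?_, ?_⟩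
  · rw [j1]
    have : u ^ 2 * R ≤ S := by rw [hS]; nlinarith [mul_nonneg hP0.le (sq_nonneg v)]
    have := mul_le_mul_of_nonneg_left this (by positivity : 0 ≤ P ^ 2 * S)
    linarith
  · rw [j2]
    have k := two_mul_le_add_sq (u * Q) (v * P)
    nlinarith [mul_le_mul_of_nonneg_right hQsq (sq_nonneg u),
      mul_le_mul_of_nonneg_right i2 (mul_nonneg hP0.le (sq_nonneg u))]
  · rw [j3]
    have k := two_mul_le_add_sq (u * R) (v * Q)
    nlinarith [mul_le_mul_of_nonneg_right hQsq (sq_nonneg v),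
      mul_le_mul_of_nonneg_right i2 (mul_nonneg hP0.le (sq_nonneg v))]
  · rw [j4]
    have : v ^ 2 * P ≤ S := by rw [hS]; nlinarith [mul_nonneg hR0.le (sq_nonneg u)]
    have := mul_le_mul_of_nonneg_left this (by positivity : 0 ≤ R ^ 2 * S)
    linarith
  · rw [j1, j2, j3, j4]
    have : (u * Q + v * P) * (u * R + v * Q) - 1 * (u * P * (v * R)) =
        Q * (S + Q * (u * v)) := by rw [hS]; ring
    rw [this, abs_mul]
    have : |S + Q * (u * v)| ≤ 3 / 2 * S := by
      refine (abs_add_le _ _).trans ?_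
      rw [abs_of_pos hSpos]; linarith
    calc |Q| * |S + Q * (u * v)| ≤ P * (3 / 2 * S) := by gcongr
      _ = 3 / 2 * (P * S) := by ring

lemma exists_bounded_of_neg {f : BinaryCubic} (hf : discF f < 0) :
    ∃ g, Eqv f g ∧ Bounded (4 / 3 * |(discF f : ℝ)|) g := by
  obtain ⟨u, v, P, Q, R, h1, h2, h3, h4, hP⟩ : ∃ u v P Q R : ℝ,
      (f.1 : ℝ) = u * P ∧ (f.2.1 : ℝ) = u * Q + v * P ∧ (f.2.2.1 : ℝ) = u * R + v * Q ∧
      (f.2.2.2 : ℝ) = v * R ∧ 0 ≤ P := by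
    obtain ⟨u, v, P, Q, R, h1, h2, h3, h4⟩ := exists_linear_mul_quadratic f
    rcases le_total 0 P with hP | hP
    · exact ⟨u, v, P, Q, R, h1, h2, h3, h4, hP⟩
    · exact ⟨-u, -v, -P, -Q, -R, by linarith, by linarith, by linarith, by linarith, by linarith⟩
  have hD : (discF f : ℝ) = (Q ^ 2 - 4 * P * R) * (P * v ^ 2 - Q * u * v + R * u ^ 2) ^ 2 := by
    simp only [discF]; push_cast; rw [h1, h2, h3, h4]; ring
  have hD0 : (discF f : ℝ) < 0 := by exact_mod_cast hf
  have hq : 0 < 4 * P * R - Q ^ 2 := by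
    by_contra! h
    have : 0 ≤ (Q ^ 2 - 4 * P * R) * (P * v ^ 2 - Q * u * v + R * u ^ 2) ^ 2 :=
      mul_nonneg (by linarith) (sq_nonneg _)
    linarith
  have hP0 : 0 < P := by
    refine hP.lt_of_ne fun h => ?_
    rw [← h] at hq
    nlinarith [sq_nonneg Q]
  obtain ⟨p, q, r, s, hdet, i1, i2⟩ := exists_reduced_quadratic hP0 hq
  refine ⟨_, ⟨p, q, r, s, Or.inl hdet, rfl⟩, ?_⟩
  have hDg : discF f = discF (subst f p q r s) := by rw [discF_subst, hdet, one_pow, one_mul]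
  obtain ⟨P', hP'⟩ : ∃ P', P' = P * p ^ 2 + Q * p * r + R * r ^ 2 := ⟨_, rfl⟩
  obtain ⟨Q', hQ'⟩ : ∃ Q', Q' = 2 * P * p * q + Q * (p * s + q * r) + 2 * R * r * s := ⟨_, rfl⟩
  obtain ⟨R', hR'⟩ : ∃ R', R' = P * q ^ 2 + Q * q * s + R * s ^ 2 := ⟨_, rfl⟩
  obtain ⟨u', hu'⟩ : ∃ u', u' = u * p + v * r := ⟨_, rfl⟩
  obtain ⟨v', hv'⟩ : ∃ v', v' = u * q + v * s := ⟨_, rfl⟩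
  have hdetR : (p : ℝ) * s - q * r = 1 := by exact_mod_cast hdet
  have hq' : 0 < 4 * P' * R' - Q' ^ 2 := by
    have : 4 * P' * R' - Q' ^ 2 = (p * s - q * r) ^ 2 * (4 * P * R - Q ^ 2) := by
      rw [hP', hQ', hR']; ring
    rw [this, hdetR]; linarith
  rw [← hP', ← hQ'] at i1
  rw [← hP', ← hR'] at i2
  have j1 : ((subst f p q r s).1 : ℝ) = u' * P' := by
    simp only [subst]; push_cast; rw [h1, h2, h3, h4, hu', hP']; ring
  have j2 : ((subst f p q r s).2.1 : ℝ) = u' * Q' + v' * P' := by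
    simp only [subst]; push_cast; rw [h1, h2, h3, h4, hu', hv', hP', hQ']; ring
  have j3 : ((subst f p q r s).2.2.1 : ℝ) = u' * R' + v' * Q' := by
    simp only [subst]; push_cast; rw [h1, h2, h3, h4, hu', hv', hR', hQ']; ring
  have j4 : ((subst f p q r s).2.2.2 : ℝ) = v' * R' := by
    simp only [subst]; push_cast; rw [h1, h2, h3, h4, hv', hR']; ring
  rw [hDg] at hD0 ⊢
  generalize subst f p q r s = g at *
  exact bounded_of_factor j1 j2 j3 j4 hq' i1 i2 hD0

lemma card_le_mul_of_fiber {α β : Type*} [DecidableEq β] (s : Finset α) (φ : α → β) {M N : ℝ}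
    (hN : 0 ≤ N) (hM : ((s.image φ).card : ℝ) ≤ M)
    (h : ∀ b, ((s.filter fun a => φ a = b).card : ℝ) ≤ N) : (s.card : ℝ) ≤ M * N := by
  rw [Finset.card_eq_sum_card_image φ s]
  push_cast
  calc _ ≤ ∑ b ∈ s.image φ, N := Finset.sum_le_sum fun b _ => h b
    _ = (s.image φ).card * N := by simp
    _ ≤ M * N := by gcongr

lemma card_int_le {s : Finset ℤ} {x L : ℝ} (hL : 0 ≤ L) (h : ∀ n ∈ s, |(n : ℝ) - x| ≤ L) :
    (s.card : ℝ) ≤ 2 * L + 1 := by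
  have hs : s ⊆ Finset.Icc ⌈x - L⌉ ⌊x + L⌋ := by
    intro n hn
    have := abs_le.1 (h n hn)
    rw [Finset.mem_Icc, Int.ceil_le, Int.le_floor]
    constructor <;> linarith
  have hc := Finset.card_le_card hs
  rw [Int.card_Icc] at hc
  have h1 : ((⌊x + L⌋ + 1 - ⌈x - L⌉ : ℤ) : ℝ) ≤ 2 * L + 1 := by
    push_cast
    linarith [Int.floor_le (x + L), Int.le_ceil (x - L)]
  have h2 : ((⌊x + L⌋ + 1 - ⌈x - L⌉).toNat : ℝ) ≤ 2 * L + 1 := by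
    rcases le_total 0 (⌊x + L⌋ + 1 - ⌈x - L⌉) with h0 | h0
    · rw [← Int.toNat_of_nonneg h0] at h1
      exact_mod_cast h1
    · rw [Int.toNat_of_nonpos h0]
      simp; linarith
  exact (Nat.cast_le.2 hc).trans h2

lemma card_int_ne_zero_le {s : Finset ℤ} {L : ℝ} (hL : 0 ≤ L) (h0 : ∀ n ∈ s, n ≠ 0)
    (h : ∀ n ∈ s, |(n : ℝ)| ≤ L) : (s.card : ℝ) ≤ 2 * L := by
  have hs : (insert 0 s).card = s.card + 1 := Finset.card_insert_of_notMem fun h => h0 0 h rfl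
  have := card_int_le (s := insert 0 s) (x := 0) hL (by
    intro n hn
    rcases Finset.mem_insert.1 hn with rfl | hn
    · simpa using hL
    · simpa using h n hn)
  rw [hs] at this
  push_cast at this
  linarith

lemma card_pairs_le {N w ν t : ℝ} (hw : 0 < w) (hw1 : w ≤ 1) (hN : 1 ≤ N * w ^ 3) (hν : 1 ≤ ν)
    (s : Finset (ℤ × ℤ))
    (h : ∀ f ∈ s, f.1 ≠ 0 ∧ |(f.1 : ℝ)| ≤ N * w ^ 3 ∧ |(f.2 : ℝ)| ≤ 8 * N / w ^ 3 ∧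
      |t - ν * (f.1 * f.2)| ≤ 3 / 2 * (N ^ 2 * w ^ 2)) :
    (s.card : ℝ) ≤ 42 * N ^ 2 * w := by
  have hN0 : 0 < N := by
    by_contra! h
    nlinarith [pow_pos hw 3]
  classical
  rw [← Finset.card_filter_add_card_filter_not (fun f : ℤ × ℤ => |(f.1 : ℝ)| ≤ N * w ^ 4)]
  push_cast
  have hN3 : 1 ≤ N / w ^ 3 := by
    rw [le_div_iff₀ (by positivity)]
    have : w ^ 3 ≤ 1 := pow_le_one₀ hw.le hw1
    nlinarith
  have hN2 : 1 ≤ N / w ^ 2 := by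
    rw [le_div_iff₀ (by positivity)]
    have : w ^ 3 ≤ 1 := pow_le_one₀ hw.le hw1
    have : w ^ 2 ≤ 1 := pow_le_one₀ hw.le hw1
    nlinarith
  have h1 : ((s.filter fun f : ℤ × ℤ => |(f.1 : ℝ)| ≤ N * w ^ 4).card : ℝ) ≤
      (2 * (N * w ^ 4)) * (17 * (N / w ^ 3)) := by
    refine card_le_mul_of_fiber _ Prod.fst (by positivity) ?_ fun a => ?_
    · refine card_int_ne_zero_le (by positivity) ?_ ?_
      · intro n hn
        obtain ⟨f, hf, rfl⟩ := Finset.mem_image.1 hn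
        exact (h f (Finset.mem_filter.1 hf).1).1
      · intro n hn
        obtain ⟨f, hf, rfl⟩ := Finset.mem_image.1 hn
        exact (Finset.mem_filter.1 hf).2
    · rw [← Finset.card_image_of_injOn (f := Prod.snd)]
      · refine (card_int_le (x := 0) (L := 8 * N / w ^ 3) (by positivity) ?_).trans ?_
        · intro n hn
          obtain ⟨f, hf, rfl⟩ := Finset.mem_image.1 hn
          rw [sub_zero]
          exact (h f (Finset.mem_filter.1 (Finset.mem_filter.1 hf).1).1).2.2.1
        · rw [mul_div_assoc]; linarith
      · intro f hf g hg hfg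
        exact Prod.ext ((Finset.mem_filter.1 hf).2.trans (Finset.mem_filter.1 hg).2.symm) hfg
  have h2 : ((s.filter fun f : ℤ × ℤ => ¬ |(f.1 : ℝ)| ≤ N * w ^ 4).card : ℝ) ≤
      (2 * (N * w ^ 3)) * (4 * (N / w ^ 2)) := by
    refine card_le_mul_of_fiber _ Prod.fst (by positivity) ?_ fun a => ?_
    · refine card_int_ne_zero_le (by positivity) ?_ ?_
      · intro n hn
        obtain ⟨f, hf, rfl⟩ := Finset.mem_image.1 hn
        exact (h f (Finset.mem_filter.1 hf).1).1
      · intro n hn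
        obtain ⟨f, hf, rfl⟩ := Finset.mem_image.1 hn
        exact (h f (Finset.mem_filter.1 hf).1).2.1
    · rw [← Finset.card_image_of_injOn (f := Prod.snd)]
      · refine (card_int_le (x := t / (ν * a)) (L := 3 / 2 * (N / w ^ 2)) (by positivity)
          ?_).trans ?_
        · intro n hn
          obtain ⟨f, hf, rfl⟩ := Finset.mem_image.1 hn
          obtain ⟨hf1, hfa⟩ := Finset.mem_filter.1 hf
          obtain ⟨hf2, hf3⟩ := Finset.mem_filter.1 hf1
          obtain ⟨k1, -, -, k2⟩ := h f hf2
          push Not at hf3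
          rw [← hfa]
          have hne : (f.1 : ℝ) ≠ 0 := by exact_mod_cast k1
          have hν0 : 0 < ν := by linarith
          have e : (f.2 : ℝ) - t / (ν * f.1) = -(t - ν * (f.1 * f.2)) / (ν * f.1) := by
            field_simp; ring
          rw [e, abs_div, abs_neg, abs_mul, abs_of_pos hν0]
          have hfpos : 0 < |(f.1 : ℝ)| := abs_pos.2 hne
          rw [div_le_iff₀ (by positivity)]
          refine k2.trans ?_
          have : N * w ^ 4 ≤ ν * |(f.1 : ℝ)| := by nlinarith
          calc 3 / 2 * (N ^ 2 * w ^ 2) = 3 / 2 * (N / w ^ 2) * (N * w ^ 4) := by field_simp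
            _ ≤ _ := by gcongr
        · linarith
      · intro f hf g hg hfg
        exact Prod.ext ((Finset.mem_filter.1 hf).2.trans (Finset.mem_filter.1 hg).2.symm) hfg
  have e1 : (2 * (N * w ^ 4)) * (17 * (N / w ^ 3)) = 34 * N ^ 2 * w := by field_simp; ring
  have e2 : (2 * (N * w ^ 3)) * (4 * (N / w ^ 2)) = 8 * N ^ 2 * w := by field_simp; ring
  rw [e1] at h1
  rw [e2] at h2
  linarith

/-- The forms with coefficients bounded on a dyadic scale. -/
def Dyadic (N w : ℝ) (f : BinaryCubic) : Prop :=
  f.1 ≠ 0 ∧ |(f.1 : ℝ)| ≤ N * w ^ 3 ∧ |(f.2.1 : ℝ)| ≤ 3 / 2 * (N * w) ∧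
    |(f.2.2.1 : ℝ)| ≤ 3 * N / w ∧ |(f.2.2.2 : ℝ)| ≤ 8 * N / w ^ 3 ∧ 
    (|(f.2.1 : ℝ) * f.2.2.1 - 1 * (f.1 * f.2.2.2)| ≤ 3 / 2 * (N ^ 2 * w ^ 2) ∨
     |(f.2.1 : ℝ) * f.2.2.1 - 9 * (f.1 * f.2.2.2)| ≤ 3 / 2 * (N ^ 2 * w ^ 2))

lemma card_dyadic_le {N w : ℝ} (hw : 0 < w) (hw1 : w ≤ 1) (hN : 0 ≤ N) (s : Finset BinaryCubic)
    (h : ∀ f ∈ s, Dyadic N w f) :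
    (s.card : ℝ) ≤ 2352 * N ^ 4 * w := by
  classical
  rcases s.eq_empty_or_nonempty with rfl | ⟨f₀, hf₀⟩
  · simp; positivity
  have hN1 : 1 ≤ N * w ^ 3 := by
    have h1 := h f₀ hf₀
    have : (1 : ℝ) ≤ |(f₀.1 : ℝ)| := by exact_mod_cast Int.one_le_abs h1.1
    linarith [h1.2.1]
  have hNw : 1 ≤ N * w := by
    have : w ^ 2 ≤ 1 := pow_le_one₀ hw.le hw1
    nlinarith [mul_nonneg hN hw.le]
  have hNw' : 1 ≤ N / w := by
    rw [le_div_iff₀ hw]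
    nlinarith
  have key : (s.card : ℝ) ≤ (4 * (N * w)) * ((7 * (N / w)) * (84 * N ^ 2 * w)) := by
    refine card_le_mul_of_fiber s (fun f => f.2.1) (by positivity) ?_ fun b => ?_
    · refine (card_int_le (x := 0) (L := 3 / 2 * (N * w)) (by positivity) ?_).trans (by linarith)
      intro n hn
      obtain ⟨f, hf, rfl⟩ := Finset.mem_image.1 hn
      rw [sub_zero]
      exact (h f hf).2.2.1
    refine card_le_mul_of_fiber _ (fun f => f.2.2.1) (by positivity) ?_ fun c => ?_
    · refine (card_int_le (x := 0) (L := 3 * N / w) (by positivity) ?_).trans ?_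
      · intro n hn
        obtain ⟨f, hf, rfl⟩ := Finset.mem_image.1 hn
        rw [sub_zero]
        exact (h f (Finset.mem_filter.1 hf).1).2.2.2.1
      · rw [mul_div_assoc]; linarith
    have inj : Set.InjOn (fun f : BinaryCubic => (f.1, f.2.2.2)) 
        {f : BinaryCubic | f.2.1 = b ∧ f.2.2.1 = c} := by
      rintro ⟨a, b, c, d⟩ ⟨rfl, rfl⟩ ⟨a', b', c', d'⟩ ⟨h1, h2⟩ h3
      simp_all
    set u := (s.filter fun f => f.2.1 = b).filter fun f => f.2.2.1 = c with hu
    have hu' : ∀ f ∈ u, Dyadic N w f ∧ f.2.1 = b ∧ f.2.2.1 = c := fun f hf => by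
      simp only [hu, Finset.mem_filter] at hf
      exact ⟨h f hf.1.1, hf.1.2, hf.2⟩
    have hv : ∀ ν : ℝ, 1 ≤ ν → ((u.filter fun f => 
        |(f.2.1 : ℝ) * f.2.2.1 - ν * (f.1 * f.2.2.2)| ≤ 3 / 2 * (N ^ 2 * w ^ 2)).card : ℝ) ≤ 
          42 * N ^ 2 * w := by
      intro ν hν
      rw [← Finset.card_image_of_injOn (f := fun f : BinaryCubic => (f.1, f.2.2.2))]
      · refine card_pairs_le (t := b * c) hw hw1 hN1 hν _ ?_
        intro x hx
        obtain ⟨f, hf, rfl⟩ := Finset.mem_image.1 hx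
        obtain ⟨hf, hf'⟩ := Finset.mem_filter.1 hf
        obtain ⟨⟨k1, k2, k3, k4, k5, -⟩, k6, k7⟩ := hu' f hf
        rw [k6, k7] at hf'
        exact ⟨k1, k2, k5, hf'⟩
      · exact inj.mono fun f hf => (hu' f (Finset.mem_filter.1 hf).1).2
    have hcov : u ⊆ (u.filter fun f => 
        |(f.2.1 : ℝ) * f.2.2.1 - 1 * (f.1 * f.2.2.2)| ≤ 3 / 2 * (N ^ 2 * w ^ 2)) ∪ 
        (u.filter fun f => 
        |(f.2.1 : ℝ) * f.2.2.1 - 9 * (f.1 * f.2.2.2)| ≤ 3 / 2 * (N ^ 2 * w ^ 2)) := by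
      intro f hf
      rcases (hu' f hf).1.2.2.2.2.2 with h | h
      · exact Finset.mem_union_left _ (Finset.mem_filter.2 ⟨hf, h⟩)
      · exact Finset.mem_union_right _ (Finset.mem_filter.2 ⟨hf, h⟩)
    have hc := (Nat.cast_le (α := ℝ)).2 ((Finset.card_le_card hcov).trans
        (Finset.card_union_le _ _))
    push_cast at hc
    have h1 := hv 1 le_rfl
    have h9 := hv 9 (by norm_num)
    linarith
  refine key.trans (le_of_eq ?_)
  field_simp
  ring

lemma Bounded.exists_dyadic {N : ℝ} (hN : 0 < N) {f : BinaryCubic} (hf : Bounded (N ^ 4) f)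
    (h0 : f.1 ≠ 0) : ∃ k : ℕ, Dyadic N ((1 / 2) ^ k) f := by
  obtain ⟨A, C, ν, hA, hAC, hM, hν, h1, h2, h3, h4, h5⟩ : ∃ A C ν : ℝ, 0 < A ∧ A ≤ C ∧
      A * C = N ^ 4 ∧ (ν = 1 ∨ ν = 9) ∧
      (f.1 : ℝ) ^ 2 * C ≤ A ^ 2 ∧ (f.2.1 : ℝ) ^ 2 ≤ 2 * A ∧ (f.2.2.1 : ℝ) ^ 2 ≤ 2 * C ∧
      (f.2.2.2 : ℝ) ^ 2 * A ≤ C ^ 2 ∧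
      |(f.2.1 : ℝ) * f.2.2.1 - ν * (f.1 * f.2.2.2)| ≤ 3 / 2 * A := by
    obtain ⟨A, C, ν, hA, hAC, hM, hν, h1, h2, h3, h4, h5⟩ := hf
    have hC : 0 < C := hA.trans_le hAC
    obtain ⟨T, hT⟩ : ∃ T, T = √(N ^ 4 / (A * C)) := ⟨_, rfl⟩
    have hT1 : 1 ≤ T := by
      rw [hT, Real.one_le_sqrt, one_le_div (by positivity)]
      exact hM
    have hT2 : T ^ 2 * (A * C) = N ^ 4 := by
      rw [hT, Real.sq_sqrt (by positivity)]
      field_simp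
    have hT0 : 0 < T := by linarith
    have hTT : T ≤ T ^ 2 := by nlinarith
    refine ⟨T * A, T * C, ν, by positivity, by gcongr, by linarith, hν, ?_, ?_, ?_, ?_, ?_⟩
    · calc (f.1 : ℝ) ^ 2 * (T * C) = T * ((f.1 : ℝ) ^ 2 * C) := by ring
        _ ≤ T ^ 2 * A ^ 2 := by gcongr
        _ = _ := by ring
    · exact h2.trans (by nlinarith)
    · exact h3.trans (by nlinarith)
    · calc (f.2.2.2 : ℝ) ^ 2 * (T * A) = T * ((f.2.2.2 : ℝ) ^ 2 * A) := by ring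
        _ ≤ T ^ 2 * C ^ 2 := by gcongr
        _ = _ := by ring
    · exact h5.trans (by nlinarith)
  have hC : 0 < C := hA.trans_le hAC
  have hAN : A ≤ N ^ 2 := by
    refine le_of_sq_le_sq ?_ (by positivity)
    nlinarith
  obtain ⟨k, hk1, hk2⟩ := exists_nat_pow_near_of_lt_one (x := A / N ^ 2) (y := (1 / 4 : ℝ))
    (by positivity) ((div_le_one (by positivity)).2 hAN) (by norm_num) (by norm_num)
  refine ⟨k, ?_⟩
  obtain ⟨w, hw⟩ : ∃ w : ℝ, w = (1 / 2) ^ k := ⟨_, rfl⟩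
  have hw0 : 0 < w := by rw [hw]; positivity
  have hw2 : (1 / 4 : ℝ) ^ k = w ^ 2 := by
    rw [hw, ← pow_mul, mul_comm, pow_mul]; norm_num
  rw [pow_succ, hw2, lt_div_iff₀ (by positivity)] at hk1
  rw [hw2, div_le_iff₀ (by positivity)] at hk2
  rw [← hw]
  have hY : 0 < w ^ 2 * N ^ 2 := by positivity
  refine ⟨h0, ?_, ?_, ?_, ?_, ?_⟩
  · refine abs_le_of_sq_le_sq ?_ (by positivity)
    have i1 : (f.1 : ℝ) ^ 2 * N ^ 4 ≤ A ^ 3 := by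
      rw [← hM]; nlinarith
    have i2 : A ^ 3 ≤ (w ^ 2 * N ^ 2) ^ 3 := pow_le_pow_left₀ hA.le hk2 3
    refine le_of_mul_le_mul_right (a := N ^ 4) ?_ (by positivity)
    calc _ ≤ _ := i1.trans i2
      _ = _ := by ring
  · refine abs_le_of_sq_le_sq ?_ (by positivity)
    nlinarith
  · rw [le_div_iff₀ hw0, ← abs_of_pos hw0, ← abs_mul]
    refine abs_le_of_sq_le_sq ?_ (by positivity)
    have i1 : (f.2.2.1 : ℝ) ^ 2 * A ≤ 2 * N ^ 4 := by nlinarith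
    have i2 : (f.2.2.1 : ℝ) ^ 2 * (w ^ 2 * (1 / 4) * N ^ 2) ≤ (f.2.2.1 : ℝ) ^ 2 * A := by gcongr
    refine le_of_mul_le_mul_right (a := N ^ 2) ?_ (by positivity)
    nlinarith [pow_pos hN 4]
  · rw [le_div_iff₀ (by positivity), ← abs_of_pos (pow_pos hw0 3), ← abs_mul]
    refine abs_le_of_sq_le_sq ?_ (by positivity)
    have i1 : (f.2.2.2 : ℝ) ^ 2 * A ^ 3 ≤ N ^ 8 := by
      calc (f.2.2.2 : ℝ) ^ 2 * A ^ 3 = (f.2.2.2 : ℝ) ^ 2 * A * A ^ 2 := by ring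
        _ ≤ C ^ 2 * A ^ 2 := by gcongr
        _ = (A * C) ^ 2 := by ring
        _ = _ := by rw [hM]; ring
    have i2 : (f.2.2.2 : ℝ) ^ 2 * (w ^ 2 * (1 / 4) * N ^ 2) ^ 3 ≤ (f.2.2.2 : ℝ) ^ 2 * A ^ 3 := by
      gcongr
    refine le_of_mul_le_mul_right (a := N ^ 6) ?_ (by positivity)
    calc _ = 64 * ((f.2.2.2 : ℝ) ^ 2 * (w ^ 2 * (1 / 4) * N ^ 2) ^ 3) := by ring
      _ ≤ 64 * N ^ 8 := by linarith
      _ = _ := by ring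
  · have : 3 / 2 * A ≤ 3 / 2 * (N ^ 2 * w ^ 2) := by linarith
    rcases hν with rfl | rfl
    · exact Or.inl (h5.trans this)
    · exact Or.inr (h5.trans this)

lemma classBound_bounded {M : ℝ} (hM : 0 < M) :
    ClassBound (fun f => Bounded M f ∧ f.1 ≠ 0) (4704 * M) := by
  obtain ⟨N, hN, rfl⟩ : ∃ N : ℝ, 0 < N ∧ N ^ 4 = M :=
    ⟨√√M, by positivity, by
      rw [show 4 = 2 * 2 from rfl, pow_mul, Real.sq_sqrt (by positivity), Real.sq_sqrt hM.le]⟩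
  have h : ∀ f, Bounded (N ^ 4) f ∧ f.1 ≠ 0 → ∃ k : ℕ, Dyadic N ((1 / 2) ^ k) f :=
    fun f hf => hf.1.exists_dyadic hN hf.2
  choose! ℓ hℓ using h
  refine ClassBound.of_label ℓ (fun _ => True) (fun _ _ => trivial)
    (fun k => 2352 * N ^ 4 * (1 / 2) ^ k) (fun k _ => ?_) fun t _ => ?_
  · refine .of_card fun s hs => card_dyadic_le (by positivity)
      (pow_le_one₀ (by norm_num) (by norm_num)) hN.le s fun f hf => ?_
    obtain ⟨h1, rfl⟩ := hs f hf
    exact hℓ f h1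
  · rw [← Finset.mul_sum]
    have : ∑ k ∈ t, (1 / 2 : ℝ) ^ k ≤ 2 := by
      exact (summable_geometric_two.sum_le_tsum t fun _ _ => by positivity).trans_eq
        tsum_geometric_two
    calc 2352 * N ^ 4 * ∑ k ∈ t, (1 / 2 : ℝ) ^ k ≤ 2352 * N ^ 4 * 2 := by gcongr
      _ = _ := by ring

/-- Forms of nonzero discriminant less than `X` in absolute value. -/
def DiscLT (X : ℝ) (f : BinaryCubic) : Prop := discF f ≠ 0 ∧ |(discF f : ℝ)| < X

lemma Eqv.discLT {X : ℝ} {f g : BinaryCubic} (h : Eqv f g) (hf : DiscLT X f) : DiscLT X g := by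
  unfold DiscLT
  rwa [h.discF_eq]

lemma DiscLT.exists_bounded {X : ℝ} {f : BinaryCubic} (hf : DiscLT X f) :
    ∃ g, Eqv f g ∧ DiscLT X g ∧ Bounded (4 / 3 * X) g := by
  obtain ⟨g, hfg, A, C, ν, hA, hAC, hM, h⟩ : ∃ g, Eqv f g ∧
      Bounded (4 / 3 * |(discF f : ℝ)|) g := by
    rcases lt_or_gt_of_ne hf.1 with h | h
    · exact exists_bounded_of_neg h
    · obtain ⟨g, hfg, A, C, ν, hA, hAC, hM, h'⟩ := exists_bounded_of_pos h
      exact ⟨g, hfg, A, C, ν, hA, hAC, 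
        by linarith [le_abs_self (discF f : ℝ), abs_nonneg (discF f : ℝ)], h'⟩
  exact ⟨g, hfg, hfg.discLT hf, A, C, ν, hA, hAC, by linarith [hf.2], h⟩

lemma classBound_fst_eq_zero : ∃ K : ℝ, ∀ X : ℝ, 0 < X →
    ClassBound (fun f => DiscLT X f ∧ f.1 = 0) (K * X) := by
  have hsum : Summable fun n : ℤ => 1 / (n : ℝ) ^ 2 :=
    Real.summable_one_div_int_pow.2 one_lt_two
  refine ⟨(∑' n : ℤ, 1 / (n : ℝ) ^ 2) + 4, fun X hX => ?_⟩
  suffices H : ClassBound (fun f => DiscLT X f ∧ f.1 = 0 ∧ 0 ≤ f.2.2.1 ∧ f.2.2.1 < 2 * |f.2.1|)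
      (((∑' n : ℤ, 1 / (n : ℝ) ^ 2) + 4) * X) by
    refine H.of_reps fun f hf => ?_
    obtain ⟨a, b, c, d⟩ := f
    obtain ⟨hD, rfl⟩ : DiscLT X (a, b, c, d) ∧ a = 0 := hf
    have hb : b ≠ 0 := by
      rintro rfl
      exact hD.1 (by simp [discF])
    have h : Eqv (0, b, c, d) (subst (0, b, c, d) 1 (-(c / (2 * b))) 0 1) :=
      ⟨1, _, 0, 1, Or.inl (by ring), rfl⟩
    refine ⟨_, h, h.discLT hD, by simp [subst], ?_⟩
    have e : (subst (0, b, c, d) 1 (-(c / (2 * b))) 0 1).2.2.1 = c % (2 * b) := by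
      have := Int.emod_add_mul_ediv c (2 * b)
      simp only [subst]
      linarith
    have e' : (subst (0, b, c, d) 1 (-(c / (2 * b))) 0 1).2.1 = b := by simp [subst]
    rw [e, e']
    refine ⟨Int.emod_nonneg _ (by omega), ?_⟩
    have := Int.emod_lt_abs c (show 2 * b ≠ 0 by omega)
    rwa [abs_mul, abs_two] at this
  refine ClassBound.of_label (fun f => f.2.1) (fun b => b ≠ 0 ∧ (b : ℝ) ^ 2 ≤ X) ?_
    (fun b => X * (1 / (b : ℝ) ^ 2) + 2 * |(b : ℝ)|) ?_ ?_
  · rintro ⟨a, b, c, d⟩ ⟨hD, rfl, -⟩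
    have e : discF (0, b, c, d) = b ^ 2 * (c ^ 2 - 4 * b * d) := by simp only [discF]; ring
    unfold DiscLT at hD
    rw [e] at hD
    refine ⟨by rintro rfl; simp at hD, ?_⟩
    have h1 : (1 : ℝ) ≤ |((c ^ 2 - 4 * b * d : ℤ) : ℝ)| := by
      exact_mod_cast Int.one_le_abs (right_ne_zero_of_mul hD.1)
    have h2 := hD.2
    push_cast at h1 h2
    rw [abs_mul, abs_of_nonneg (sq_nonneg _)] at h2
    nlinarith [sq_nonneg (b : ℝ)]
  · rintro b ⟨hb, -⟩
    refine .of_card fun s hs => ?_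
    have hb' : 0 < |(b : ℝ)| := by simpa using hb
    have e : X * (1 / (b : ℝ) ^ 2) + 2 * |(b : ℝ)| =
        (2 * |(b : ℝ)|) * (2 * (X / (4 * |(b : ℝ)| ^ 3)) + 1) := by
      rw [← sq_abs (b : ℝ)]; field_simp; ring
    rw [e]
    refine card_le_mul_of_fiber s (fun f => f.2.2.1) (by positivity) ?_ fun c => ?_
    · have : s.image (fun f => f.2.2.1) ⊆ Finset.Ico 0 (2 * |b|) := by
        intro n hn
        obtain ⟨f, hf, rfl⟩ := Finset.mem_image.1 hn
        obtain ⟨⟨-, -, h1, h2⟩, h3⟩ := hs f hf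
        rw [h3] at h2
        exact Finset.mem_Ico.2 ⟨h1, h2⟩
      have := Finset.card_le_card this
      rw [Int.card_Ico, sub_zero] at this
      have h2 : ((2 * |b|).toNat : ℝ) = 2 * |(b : ℝ)| := by
        have : ((2 * |b|).toNat : ℤ) = 2 * |b| := Int.toNat_of_nonneg (by positivity)
        exact_mod_cast congrArg (Int.cast : ℤ → ℝ) this
      rw [← h2]
      exact_mod_cast this
    · rw [← Finset.card_image_of_injOn (f := fun f : BinaryCubic => f.2.2.2)]
      · refine card_int_le (x := c ^ 2 / (4 * b)) (by positivity) ?_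
        intro n hn
        obtain ⟨f, hf, rfl⟩ := Finset.mem_image.1 hn
        obtain ⟨hf1, rfl⟩ := Finset.mem_filter.1 hf
        obtain ⟨⟨hD, ha, -, -⟩, rfl⟩ := hs f hf1
        obtain ⟨a, b, c, d⟩ := f
        obtain rfl : a = 0 := ha
        have e : discF (0, b, c, d) = b ^ 2 * (c ^ 2 - 4 * b * d) := by simp only [discF]; ring
        have h2 := hD.2
        rw [e] at h2
        push_cast at h2
        simp only at hb hb' ⊢
        have hbR : (b : ℝ) ≠ 0 := by exact_mod_cast hb
        have e2 : (d : ℝ) - c ^ 2 / (4 * b) = -((b ^ 2 * (c ^ 2 - 4 * b * d)) / (4 * b ^ 3)) := by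
          field_simp; ring
        rw [e2, abs_neg, abs_div, abs_mul (4 : ℝ), abs_pow (b : ℝ) 3,
            abs_of_pos (by norm_num : (0 : ℝ) < 4)]
        gcongr
      · rintro ⟨a, b, c, d⟩ hf ⟨a', b', c', d'⟩ hg hfg
        obtain ⟨hf1, hf2⟩ := Finset.mem_filter.1 hf
        obtain ⟨hg1, hg2⟩ := Finset.mem_filter.1 hg
        obtain ⟨⟨-, hf3, -⟩, hf4⟩ := hs _ hf1
        obtain ⟨⟨-, hg3, -⟩, hg4⟩ := hs _ hg1
        simp_all
  · intro t ht
    rw [Finset.sum_add_distrib, ← Finset.mul_sum, add_mul]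
    have h1 : ∑ b ∈ t, 1 / (b : ℝ) ^ 2 ≤ ∑' n : ℤ, 1 / (n : ℝ) ^ 2 :=
      hsum.sum_le_tsum t fun _ _ => by positivity
    have h2 : ∀ b ∈ t, |(b : ℝ)| ≤ √X := fun b hb => Real.abs_le_sqrt (ht b hb).2
    have h3 : (t.card : ℝ) ≤ 2 * √X :=
        card_int_ne_zero_le (by positivity) (fun b hb => (ht b hb).1) h2
    have h4 : ∑ b ∈ t, 2 * |(b : ℝ)| ≤ t.card * (2 * √X) := by
      rw [← nsmul_eq_mul]
      exact Finset.sum_le_card_nsmul _ _ _ fun b hb => by linarith [h2 b hb]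
    have h5 : (t.card : ℝ) * (2 * √X) ≤ 4 * X := by
      calc (t.card : ℝ) * (2 * √X) ≤ (2 * √X) * (2 * √X) := by gcongr
        _ = 4 * (√X * √X) := by ring
        _ = 4 * X := by rw [Real.mul_self_sqrt hX.le]
    nlinarith

/-- **Davenport's bound** for the number of classes of binary cubic forms. -/
lemma exists_classBound_discLT : ∃ K : ℝ, 0 ≤ K ∧
    ∀ X : ℝ, 0 < X → ClassBound (DiscLT X) (K * X) := by
  obtain ⟨K, hK⟩ := classBound_fst_eq_zero
  have hK0 : 0 ≤ K := by simpa using (hK 1 one_pos).nonneg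
  refine ⟨4704 * (4 / 3) + K, by positivity, fun X hX => ?_⟩
  refine (((classBound_bounded (M := 4 / 3 * X) (by positivity)).or (hK X hX)).mono (fun f h => h)
    (le_of_eq (by ring))).of_reps fun f hf => ?_
  obtain ⟨g, hfg, hg, hb⟩ := hf.exists_bounded
  refine ⟨g, hfg, ?_⟩
  by_cases h : g.1 = 0
  · exact Or.inr ⟨hg, h⟩
  · exact Or.inl ⟨hb, h⟩

lemma discF_ne_zero_of_irredForm {f : BinaryCubic} (hf : IrredForm f) : discF f ≠ 0 := by
  intro hD
  obtain ⟨u, v, P, Q, R, h1, h2, h3, h4⟩ : ∃ u v P Q R : ℚ,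
      (f.1 : ℚ) = u * P ∧ (f.2.1 : ℚ) = u * Q + v * P ∧ (f.2.2.1 : ℚ) = u * R + v * Q ∧
      (f.2.2.2 : ℚ) = v * R := by
    obtain ⟨a, b, c, d⟩ := f
    have hD' : (b ^ 2 * c ^ 2 - 4 * a * c ^ 3 - 4 * b ^ 3 * d - 27 * a ^ 2 * d ^ 2 +
        18 * a * b * c * d : ℚ) = 0 := by exact_mod_cast hD
    by_cases ha : (a : ℚ) = 0
    · exact ⟨0, 1, b, c, d, by simp [ha]⟩
    obtain ⟨r, hr⟩ : ∃ r : ℚ, a * r ^ 3 + b * r ^ 2 + c * r + d = 0 := by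
      by_cases hA : (b ^ 2 - 3 * a * c : ℚ) = 0
      · have hB : (b * c - 9 * a * d : ℚ) = 0 := by
          refine pow_eq_zero_iff two_ne_zero |>.1 ?_
          linear_combination 4 * (c ^ 2 - 3 * b * d) * hA - 3 * hD'
        refine ⟨-b / (3 * a), ?_⟩
        field_simp
        linear_combination 2 * b * hA - 3 * a * hB
      · obtain ⟨r, hr⟩ : ∃ r : ℚ, 2 * (b ^ 2 - 3 * a * c) * r = 9 * a * d - b * c :=
          ⟨(9 * a * d - b * c) / (2 * (b ^ 2 - 3 * a * c)),
            mul_div_cancel₀ _ (mul_ne_zero two_ne_zero hA)⟩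
        refine ⟨r, ?_⟩
        have h : (2 * (b ^ 2 - 3 * a * c) : ℚ) ^ 3 * (a * r ^ 3 + b * r ^ 2 + c * r + d) = 0 := by
          generalize hA' : (2 * (b ^ 2 - 3 * a * c) : ℚ) = A at *
          have : A ^ 3 * (a * r ^ 3 + b * r ^ 2 + c * r + d) =
              a * (A * r) ^ 3 + b * (A * r) ^ 2 * A + c * (A * r) * A ^ 2 + d * A ^ 3 := by ring
          rw [this, hr, ← hA']
          linear_combination -(27 * a ^ 2 * d - 9 * a * b * c + 2 * b ^ 3) * hD'
        exact (mul_eq_zero.1 h).resolve_left (pow_ne_zero 3 (mul_ne_zero two_ne_zero hA))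
    exact ⟨1, -r, a, b + a * r, c + b * r + a * r ^ 2, by simp, by ring, by ring,
      by linear_combination hr⟩
  have hfac : MvPolynomial.map (Int.castRingHom ℚ) (toPoly f) =
      (MvPolynomial.C u * MvPolynomial.X 0 + MvPolynomial.C v * MvPolynomial.X 1) *
      (MvPolynomial.C P * MvPolynomial.X 0 ^ 2 +
        MvPolynomial.C Q * MvPolynomial.X 0 * MvPolynomial.X 1 +
        MvPolynomial.C R * MvPolynomial.X 1 ^ 2) := by
    have h : MvPolynomial.map (Int.castRingHom ℚ) (toPoly f) =
        toPoly ((f.1 : ℚ), (f.2.1 : ℚ), (f.2.2.1 : ℚ), (f.2.2.2 : ℚ)) := by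
      simp [toPoly]
    rw [h, h1, h2, h3, h4]
    simp only [toPoly, map_add, map_mul]
    ring
  rcases hf.isUnit_or_isUnit hfac with h | h <;>
  · have := h.map (MvPolynomial.eval fun _ => (0 : ℚ))
    simp at this

/-- The form `n • f`. -/
def scale (n : ℤ) (f : BinaryCubic) : BinaryCubic := (n * f.1, n * f.2.1, n * f.2.2.1, n * f.2.2.2)

lemma subst_scale (n : ℤ) (f : BinaryCubic) (p q r s : ℤ) :
    subst (scale n f) p q r s = scale n (subst f p q r s) := by
  obtain ⟨a, b, c, d⟩ := f
  simp only [subst, scale, Prod.mk.injEq]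
  refine ⟨?_, ?_, ?_, ?_⟩ <;> ring

lemma scale_injective {n : ℤ} (hn : n ≠ 0) : Function.Injective (scale n) := by
  rintro ⟨a, b, c, d⟩ ⟨a', b', c', d'⟩ h
  simpa [scale, hn] using h

lemma eqv_scale_iff {n : ℤ} (hn : n ≠ 0) {f g : BinaryCubic} :
    Eqv (scale n f) (scale n g) ↔ Eqv f g := by
  constructor
  · rintro ⟨p, q, r, s, h, e⟩
    rw [subst_scale] at e
    exact ⟨p, q, r, s, h, scale_injective hn e⟩
  · rintro ⟨p, q, r, s, h, rfl⟩
    exact ⟨p, q, r, s, h, (subst_scale ..).symm⟩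

lemma discF_scale (n : ℤ) (f : BinaryCubic) : discF (scale n f) = n ^ 4 * discF f := by
  simp only [discF, scale]
  ring

/-- `n` divides all coefficients of the form. -/
def DvdForm (n : ℤ) (f : BinaryCubic) : Prop := ∃ g, f = scale n g

lemma dvdForm_iff {n : ℤ} {f : BinaryCubic} :
    DvdForm n f ↔ n ∣ f.1 ∧ n ∣ f.2.1 ∧ n ∣ f.2.2.1 ∧ n ∣ f.2.2.2 := by
  constructor
  · rintro ⟨g, rfl⟩
    simp [scale]
  · obtain ⟨a, b, c, d⟩ := f
    rintro ⟨⟨a, rfl⟩, ⟨b, rfl⟩, ⟨c, rfl⟩, ⟨d, rfl⟩⟩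
    exact ⟨(a, b, c, d), rfl⟩

lemma DvdForm.of_eqv {n : ℤ} {f g : BinaryCubic} (hf : DvdForm n f) (h : Eqv f g) :
    DvdForm n g := by
  obtain ⟨f, rfl⟩ := hf
  obtain ⟨p, q, r, s, -, rfl⟩ := h
  exact ⟨_, subst_scale ..⟩

lemma DiscLT.of_scale {n : ℤ} (hn : n ≠ 0) {X : ℝ} {f : BinaryCubic} (h : DiscLT X (scale n f)) :
    DiscLT (X / (n : ℝ) ^ 4) f := by
  obtain ⟨h1, h2⟩ := h
  rw [discF_scale] at h1 h2
  refine ⟨right_ne_zero_of_mul h1, ?_⟩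
  have : (0 : ℝ) < (n : ℝ) ^ 4 := by positivity
  rw [lt_div_iff₀ this]
  push_cast at h2
  rw [abs_mul, abs_of_pos this] at h2
  linarith

lemma classBound_dvdForm {N X : ℝ} {n : ℤ} (hn : n ≠ 0)
    (h : ClassBound (DiscLT (X / (n : ℝ) ^ 4)) N) :
    ClassBound (fun f => DiscLT X f ∧ DvdForm n f) N := by
  have H : ∀ f, DiscLT X f ∧ DvdForm n f → ∃ g, f = scale n g := fun f hf => hf.2
  choose! φ hφ using H
  refine h.of_map_inj φ (fun f hf => ?_) fun f g hf hg hfg => ?_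
  · have h1 := hf.1
    rw [hφ f hf] at h1
    exact h1.of_scale hn
  · rw [hφ f hf, hφ g hg]
    exact (eqv_scale_iff hn).2 hfg

/-- Forms `p²ax³ + pbx²y + cxy² + dy³`. -/
def NonMaxAt (p : ℤ) (f : BinaryCubic) : Prop := p ^ 2 ∣ f.1 ∧ p ∣ f.2.1

/-- The form `ax³ + bx²y + cxy² + pdy³` attached to `p²ax³ + pbx²y + cxy² + dy³`. -/
def overForm (p : ℤ) (f : BinaryCubic) : BinaryCubic :=
  (f.1 / p ^ 2, f.2.1 / p, f.2.2.1, p * f.2.2.2)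

lemma NonMaxAt.scale_eq {p : ℤ} {f : BinaryCubic} (hp : p ≠ 0) (hf : NonMaxAt p f) :
    scale p f = subst (overForm p f) p 0 0 1 := by
  obtain ⟨a, b, c, d⟩ := f
  obtain ⟨⟨a, rfl⟩, ⟨b, rfl⟩⟩ := hf
  simp only [scale, overForm, subst, Prod.mk.injEq]
  rw [Int.mul_ediv_cancel_left _ (pow_ne_zero 2 hp), Int.mul_ediv_cancel_left _ hp]
  refine ⟨?_, ?_, ?_, ?_⟩ <;> ring

lemma NonMaxAt.discF_eq {p : ℤ} {f : BinaryCubic} (hp : p ≠ 0) (hf : NonMaxAt p f) :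
    discF f = p ^ 2 * discF (overForm p f) := by
  have h := congrArg discF (hf.scale_eq hp)
  rw [discF_scale, discF_subst] at h
  refine mul_left_cancel₀ (pow_ne_zero 4 hp) ?_
  rw [h]; ring

lemma NonMaxAt.discLT {p : ℤ} {f : BinaryCubic} (hp : p ≠ 0) (hf : NonMaxAt p f) {X : ℝ}
    (h : DiscLT X f) : DiscLT (X / (p : ℝ) ^ 2) (overForm p f) := by
  obtain ⟨h1, h2⟩ := h
  rw [hf.discF_eq hp] at h1 h2
  refine ⟨right_ne_zero_of_mul h1, ?_⟩
  have : (0 : ℝ) < (p : ℝ) ^ 2 := by positivity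
  rw [lt_div_iff₀ this]
  push_cast at h2
  rw [abs_mul, abs_of_pos this] at h2
  linarith

/-- The value of the form at `(j, 1)` modulo `p`. -/
def evalMod (p : ℕ) (g : BinaryCubic) (j : ZMod p) : ZMod p :=
  g.1 * j ^ 3 + g.2.1 * j ^ 2 + g.2.2.1 * j + g.2.2.2

lemma NonMaxAt.exists_label {p : ℕ} [hp : Fact p.Prime] {f g : BinaryCubic} (hf : NonMaxAt p f)
    (h : Eqv g (overForm p f)) :
    Eqv (scale p f) (subst g 1 0 0 p) ∨
      ∃ j : ZMod p, evalMod p g j = 0 ∧ Eqv (scale p f) (subst g p j.val 0 1) := by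
  have hp0 : (p : ℤ) ≠ 0 := by exact_mod_cast hp.out.ne_zero
  obtain ⟨a, b, c, d, hdet, e⟩ := h
  have h1 := hf.scale_eq hp0
  rw [e, subst_subst] at h1
  simp only [mul_zero, add_zero, mul_one, zero_add] at h1
  by_cases hd : (p : ℤ) ∣ d
  · left
    obtain ⟨d, rfl⟩ := hd
    refine Eqv.symm ⟨a * p, b, c, d, ?_, ?_⟩
    · rwa [show a * p * d - b * c = a * (p * d) - b * c by ring]
    · rw [h1, subst_subst]
      congr 1 <;> ring
  · right
    have hdne : (d : ZMod p) ≠ 0 := by rwa [Ne, ZMod.intCast_zmod_eq_zero_iff_dvd]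
    set j : ZMod p := b / d with hj
    obtain ⟨k, hk⟩ : (p : ℤ) ∣ b - j.val * d := by
      rw [← ZMod.intCast_zmod_eq_zero_iff_dvd]
      push_cast
      rw [ZMod.natCast_zmod_val, hj]
      field_simp
      ring
    have hEqv : Eqv (scale p f) (subst g p j.val 0 1) := by
      refine Eqv.symm ⟨a - j.val * c, k, c * p, d, ?_, ?_⟩
      · have : (a - j.val * c) * d - k * (c * p) = a * d - c * (j.val * d + p * k) := by ring
        rw [this, ← hk]
        convert hdet using 2 <;> ring
      · rw [h1, subst_subst]
        congr 1
        · ring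
        · linarith
        · ring
        · ring
    refine ⟨j, ?_, hEqv⟩
    have h2 := (dvdForm_iff.1 (DvdForm.of_eqv ⟨f, rfl⟩ hEqv)).2.2.2
    rw [← ZMod.intCast_zmod_eq_zero_iff_dvd] at h2
    simpa [subst, evalMod] using h2

lemma card_le_of_eqv_overForm {p : ℕ} [hp : Fact p.Prime] {g : BinaryCubic} (J : Finset (ZMod p))
    (hJ : ∀ j, evalMod p g j = 0 → j ∈ J) (s : Finset BinaryCubic) (hs : ∀ f ∈ s, NonMaxAt p f)
    (hs' : ∀ f ∈ s, ∀ f' ∈ s, Eqv f f' → f = f') (hg : ∀ f ∈ s, Eqv g (overForm p f)) :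
    s.card ≤ J.card + 1 := by
  have hp0 : (p : ℤ) ≠ 0 := by exact_mod_cast hp.out.ne_zero
  let F : Option (ZMod p) → BinaryCubic := fun o =>
    o.elim (subst g 1 0 0 p) fun j => subst g p j.val 0 1
  have H : ∀ f ∈ s, ∃ o ∈ Finset.insertNone J, Eqv (scale p f) (F o) := by
    intro f hf
    rcases (hs f hf).exists_label (hg f hf) with h | ⟨j, hj, h⟩
    · exact ⟨none, Finset.none_mem_insertNone, h⟩
    · exact ⟨some j, Finset.some_mem_insertNone.2 (hJ j hj), h⟩
  choose! ℓ hℓ hF using H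
  rw [← Finset.card_insertNone]
  refine Finset.card_le_card_of_injOn ℓ hℓ fun f hf f' hf' h => hs' f hf f' hf' ?_
  have h1 := hF f' hf'
  rw [← h] at h1
  exact (eqv_scale_iff hp0).1 ((hF f hf).trans h1.symm)

lemma exists_roots_evalMod {p : ℕ} [Fact p.Prime] {g : BinaryCubic} (hg : ¬ DvdForm p g) :
    ∃ J : Finset (ZMod p), J.card ≤ 3 ∧ ∀ j, evalMod p g j = 0 → j ∈ J := by
  let P : Cubic (ZMod p) := ⟨g.1, g.2.1, g.2.2.1, g.2.2.2⟩
  have hP : P.toPoly ≠ 0 := by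
    rw [Ne, Cubic.toPoly_eq_zero_iff]
    intro h
    refine hg (dvdForm_iff.2 ?_)
    simp only [← ZMod.intCast_zmod_eq_zero_iff_dvd]
    exact ⟨congrArg Cubic.a h, congrArg Cubic.b h, congrArg Cubic.c h, congrArg Cubic.d h⟩
  refine ⟨P.roots.toFinset, Cubic.card_roots_le, fun j hj => ?_⟩
  rw [Multiset.mem_toFinset, Cubic.mem_roots_iff hP]
  exact hj

lemma classBound_nonMaxAt {K : ℝ} (hK0 : 0 ≤ K)
    (hK : ∀ X : ℝ, 0 < X → ClassBound (DiscLT X) (K * X))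
    {p : ℕ} [hp : Fact p.Prime] {X : ℝ} (hX : 0 < X) :
    ClassBound (fun f => DiscLT X f ∧ NonMaxAt p f) (6 * K * X / (p : ℝ) ^ 2) := by
  have hp0 : (p : ℤ) ≠ 0 := by exact_mod_cast hp.out.ne_zero
  have hp1 : (1 : ℝ) ≤ p := by exact_mod_cast hp.out.one_le
  have hpos : (0 : ℝ) < (p : ℝ) ^ 2 := by positivity
  have h1 : ClassBound (fun f => DiscLT X f ∧ NonMaxAt p f ∧ ¬ DvdForm p (overForm p f))
      ((4 : ℕ) * (K * (X / (p : ℝ) ^ 2))) := by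
    refine (hK _ (by positivity)).of_map 4 (overForm p)
      (fun f hf => by simpa using hf.2.1.discLT hp0 hf.1) fun s hs hs' h => ?_
    rcases s.eq_empty_or_nonempty with rfl | ⟨f, hf⟩
    · simp
    obtain ⟨J, hJ, hJ'⟩ := exists_roots_evalMod (hs f hf).2.2
    have := card_le_of_eqv_overForm J hJ' s (fun f hf => (hs f hf).2.1) hs' (h f hf)
    omega
  have h2 : ClassBound (fun f => DiscLT X f ∧ NonMaxAt p f ∧ DvdForm p (overForm p f))
      ((p + 1 : ℕ) * (K * (X / (p : ℝ) ^ 2 / (p : ℝ) ^ 4))) := by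
    have := classBound_dvdForm (X := X / (p : ℝ) ^ 2) hp0 (hK _ (by positivity))
    push_cast at this
    refine this.of_map (p + 1) (overForm p)
      (fun f hf => ⟨by simpa using hf.2.1.discLT hp0 hf.1, hf.2.2⟩) fun s hs hs' h => ?_
    rcases s.eq_empty_or_nonempty with rfl | ⟨f, hf⟩
    · simp
    have := card_le_of_eqv_overForm Finset.univ (fun j _ => Finset.mem_univ j) s
      (fun f hf => (hs f hf).2.1) hs' (h f hf)
    rwa [Finset.card_univ, ZMod.card] at this
  refine (h1.or h2).mono (fun f hf => ?_) ?_
  · by_cases h : DvdForm p (overForm p f)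
    · exact Or.inr ⟨hf.1, hf.2, h⟩
    · exact Or.inl ⟨hf.1, hf.2, h⟩
  · have h3 : ((p : ℝ) + 1) / (p : ℝ) ^ 4 ≤ 2 := by
      rw [div_le_iff₀ (by positivity)]
      have : (p : ℝ) ≤ p ^ 4 := le_self_pow₀ hp1 (by norm_num)
      linarith
    have h4 : 0 ≤ K * X / (p : ℝ) ^ 2 := by positivity
    push_cast
    calc _ = 4 * (K * X / (p : ℝ) ^ 2) + K * X / (p : ℝ) ^ 2 * (((p : ℝ) + 1) / (p : ℝ) ^ 4) := by
          field_simp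
      _ ≤ 4 * (K * X / (p : ℝ) ^ 2) + K * X / (p : ℝ) ^ 2 * 2 := by gcongr
      _ = _ := by ring

/-- Modulo `p`, the form is a nonzero multiple of `y³`. -/
def TripleAt (p : ℤ) (f : BinaryCubic) : Prop := p ∣ f.1 ∧ p ∣ f.2.1 ∧ p ∣ f.2.2.1 ∧ ¬ p ∣ f.2.2.2

/-- The algebra `ℚ[τ]` with `τ² = a + bτ`. -/
def Quad (a b : ℤ) : Type := QuadraticAlgebra ℚ (a : ℚ) (b : ℚ)

namespace Quad

variable {a b : ℤ}

instance : CommRing (Quad a b) := inferInstanceAs (CommRing (QuadraticAlgebra ℚ (a : ℚ) (b : ℚ)))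

/-- The element `u + vτ`. -/
def mk (u v : ℚ) : Quad a b := QuadraticAlgebra.mk u v

/-- The coordinate along `1`. -/
def re (x : Quad a b) : ℚ := QuadraticAlgebra.re x

/-- The coordinate along `τ`. -/
def im (x : Quad a b) : ℚ := QuadraticAlgebra.im x

@[ext] lemma ext {x y : Quad a b} (h1 : x.re = y.re) (h2 : x.im = y.im) : x = y :=
  QuadraticAlgebra.ext h1 h2

@[simp] lemma re_mk (u v : ℚ) : (mk u v : Quad a b).re = u := rfl
@[simp] lemma im_mk (u v : ℚ) : (mk u v : Quad a b).im = v := rfl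
@[simp] lemma re_add (x y : Quad a b) : (x + y).re = x.re + y.re := rfl
@[simp] lemma im_add (x y : Quad a b) : (x + y).im = x.im + y.im := rfl
@[simp] lemma re_sub (x y : Quad a b) : (x - y).re = x.re - y.re := rfl
@[simp] lemma im_sub (x y : Quad a b) : (x - y).im = x.im - y.im := rfl
@[simp] lemma re_neg (x : Quad a b) : (-x).re = -x.re := rfl
@[simp] lemma im_neg (x : Quad a b) : (-x).im = -x.im := rfl
@[simp] lemma re_zero : (0 : Quad a b).re = 0 := rfl
@[simp] lemma im_zero : (0 : Quad a b).im = 0 := rfl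
@[simp] lemma re_one : (1 : Quad a b).re = 1 := rfl
@[simp] lemma im_one : (1 : Quad a b).im = 0 := rfl
@[simp] lemma re_intCast (n : ℤ) : (n : Quad a b).re = n := rfl
@[simp] lemma im_intCast (n : ℤ) : (n : Quad a b).im = 0 := rfl
@[simp] lemma re_mul (x y : Quad a b) : (x * y).re = x.re * y.re + a * x.im * y.im := rfl
@[simp] lemma im_mul (x y : Quad a b) :
    (x * y).im = x.re * y.im + x.im * y.re + b * x.im * y.im := rfl

/-- The standard involution. -/
def conj : Quad a b →+* Quad a b where
  toFun x := mk (x.re + b * x.im) (-x.im)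
  map_one' := by ext <;> simp
  map_zero' := by ext <;> simp
  map_mul' x y := by ext <;> simp <;> ring
  map_add' x y := by ext <;> simp <;> ring

@[simp] lemma re_conj (x : Quad a b) : (conj x).re = x.re + b * x.im := rfl
@[simp] lemma im_conj (x : Quad a b) : (conj x).im = -x.im := rfl

/-- The norm to `ℚ`. -/
def norm (x : Quad a b) : ℚ := x.re ^ 2 + b * x.re * x.im - a * x.im ^ 2

lemma mul_conj (x : Quad a b) : x * conj x = mk x.norm 0 := by
  ext <;> simp [norm] <;> ring

lemma norm_mul (x y : Quad a b) : (x * y).norm = x.norm * y.norm := by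
  simp only [norm, re_mul, im_mul]
  ring

lemma norm_intCast (n : ℤ) : (n : Quad a b).norm = n ^ 2 := by simp [norm]

lemma isUnit_iff {x : Quad a b} (hx : x.norm ≠ 0) : IsUnit x := by
  refine IsUnit.of_mul_eq_one (conj x * mk x.norm⁻¹ 0) ?_
  rw [← mul_assoc, mul_conj]
  ext <;> simp [hx]

/-- The additive group generated by an element. -/
def pr (x : Quad a b) : Submodule ℤ (Quad a b) := Submodule.span ℤ {x}

lemma pr_mul (x y : Quad a b) : pr (x * y) = pr x * pr y := by
  rw [pr, pr, pr, Submodule.span_mul_span, Set.singleton_mul_singleton]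

lemma pr_one : pr (1 : Quad a b) = 1 := Submodule.one_eq_span.symm

lemma pr_pow (x : Quad a b) (n : ℕ) : pr (x ^ n) = pr x ^ n := by
  induction n with
  | zero => rw [pow_zero, pow_zero, pr_one]
  | succ n ih => rw [pow_succ, pow_succ, pr_mul, ih]

lemma mem_pr_mul {x y : Quad a b} {M : Submodule ℤ (Quad a b)} :
    y ∈ pr x * M ↔ ∃ z ∈ M, x * z = y := Submodule.mem_span_singleton_mul

lemma pr_mul_cancel {x : Quad a b} (hx : IsUnit x) {M N : Submodule ℤ (Quad a b)}
    (h : pr x * M = pr x * N) : M = N := by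
  obtain ⟨u, rfl⟩ := hx
  have := congrArg (pr ↑u⁻¹ * ·) h
  simpa [← mul_assoc, ← pr_mul, pr_one] using this

/-- The additive group generated by two elements. -/
def sp (x y : Quad a b) : Submodule ℤ (Quad a b) := Submodule.span ℤ {x, y}

lemma mem_sp {x y z : Quad a b} : z ∈ sp x y ↔ ∃ u v : ℤ, z = u * x + v * y := by
  simp only [sp, Submodule.mem_span_pair, zsmul_eq_mul, eq_comm]

lemma left_mem_sp (x y : Quad a b) : x ∈ sp x y := mem_sp.2 ⟨1, 0, by simp⟩

lemma right_mem_sp (x y : Quad a b) : y ∈ sp x y := mem_sp.2 ⟨0, 1, by simp⟩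

lemma sp_le {x y : Quad a b} {M : Submodule ℤ (Quad a b)} : sp x y ≤ M ↔ x ∈ M ∧ y ∈ M := by
  simp [sp, Submodule.span_le, Set.insert_subset_iff]

lemma pr_mul_sp (x y z : Quad a b) : pr x * sp y z = sp (x * y) (x * z) := by
  rw [pr, sp, sp, Submodule.span_mul_span, Set.singleton_mul, Set.image_pair]

lemma sp_mul_le {x y z w : Quad a b} {M : Submodule ℤ (Quad a b)} :
    sp x y * sp z w ≤ M ↔ x * z ∈ M ∧ x * w ∈ M ∧ y * z ∈ M ∧ y * w ∈ M := by
  rw [sp, sp, Submodule.span_mul_span, Submodule.span_le]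
  constructor
  · intro h
    refine ⟨h ?_, h ?_, h ?_, h ?_⟩ <;> exact Set.mul_mem_mul (by simp) (by simp)
  · rintro ⟨h1, h2, h3, h4⟩ _ ⟨x', hx, y', hy, rfl⟩
    rcases hx with rfl | rfl <;> rcases hy with rfl | rfl <;> assumption

/-- The image of a lattice under the involution. -/
def bar (M : Submodule ℤ (Quad a b)) : Submodule ℤ (Quad a b) :=
  M.map (conj.toIntAlgHom).toLinearMap

lemma bar_mul (M N : Submodule ℤ (Quad a b)) : bar (M * N) = bar M * bar N :=
  Submodule.map_mul ..

lemma bar_pow (M : Submodule ℤ (Quad a b)) (n : ℕ) : bar (M ^ n) = bar M ^ n :=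
  Submodule.map_pow ..

lemma conj_mem_bar {M : Submodule ℤ (Quad a b)} {x : Quad a b} (hx : x ∈ M) : conj x ∈ bar M :=
  ⟨x, hx, rfl⟩

lemma bar_sp (x y : Quad a b) : bar (sp x y) = sp (conj x) (conj y) := by
  rw [bar, sp, sp, Submodule.map_span, Set.image_pair]
  rfl

lemma bar_pr (x : Quad a b) : bar (pr x) = pr (conj x) := by
  rw [bar, pr, pr, Submodule.map_span, Set.image_singleton]
  rfl

@[simp] lemma conj_conj (x : Quad a b) : conj (conj x) = x := by ext <;> simp

lemma bar_bar (M : Submodule ℤ (Quad a b)) : bar (bar M) = M := by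
  ext x
  simp [bar, Submodule.mem_map]

/-- The order `ℤ[τ]`. -/
def ord : Submodule ℤ (Quad a b) := sp 1 (mk 0 1)

lemma mem_ord {x : Quad a b} : x ∈ ord ↔ ∃ u v : ℤ, x = mk u v := by
  rw [ord, mem_sp]
  refine exists_congr fun u => exists_congr fun v => ?_
  have : (u : Quad a b) * 1 + (v : Quad a b) * mk 0 1 = mk u v := by ext <;> simp
  rw [this]

lemma mk_mem_ord (u v : ℤ) : (mk u v : Quad a b) ∈ ord := mem_ord.2 ⟨u, v, rfl⟩

lemma ord_mul_ord : ord * ord = (ord : Submodule ℤ (Quad a b)) := by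
  refine le_antisymm ?_ ?_
  · rw [Submodule.mul_le]
    intro x hx y hy
    obtain ⟨u, v, rfl⟩ := mem_ord.1 hx
    obtain ⟨u', v', rfl⟩ := mem_ord.1 hy
    refine mem_ord.2 ⟨u * u' + a * v * v', u * v' + v * u' + b * v * v', ?_⟩
    ext <;> simp
  · intro x hx
    have h := Submodule.mul_mem_mul (left_mem_sp 1 (mk 0 1)) hx
    rwa [one_mul] at h

lemma bar_ord : bar (ord : Submodule ℤ (Quad a b)) = ord := by
  have h : bar (ord : Submodule ℤ (Quad a b)) ≤ ord := by
    rw [ord, bar_sp, sp_le]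
    refine ⟨mem_ord.2 ⟨1, 0, ?_⟩, mem_ord.2 ⟨b, -1, ?_⟩⟩ <;> ext <;> simp
  refine le_antisymm h ?_
  have := Submodule.map_mono (f := (conj (a := a) (b := b)).toIntAlgHom.toLinearMap) h
  rwa [← bar, ← bar, bar_bar] at this

/-- A lattice contained in `ℤ[τ]` has a triangular pair of generators. -/
lemma exists_eq_sp {M : Submodule ℤ (Quad a b)} (hM : M ≤ ord) :
    ∃ n u e : ℤ, M = sp (n : Quad a b) (mk u e) := by
  let V : Ideal ℤ :=
    { carrier := {v | ∃ u : ℤ, mk u v ∈ M}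
      add_mem' := by
        rintro v v' ⟨u, hu⟩ ⟨u', hu'⟩
        refine ⟨u + u', ?_⟩
        convert M.add_mem hu hu' using 1
        ext <;> simp
      zero_mem' := ⟨0, by convert M.zero_mem using 1; ext <;> simp⟩
      smul_mem' := by
        rintro c v ⟨u, hu⟩
        refine ⟨c * u, ?_⟩
        convert M.smul_mem c hu using 1
        rw [zsmul_eq_mul]
        ext <;> simp }
  let U : Ideal ℤ :=
    { carrier := {u | (u : Quad a b) ∈ M}
      add_mem' := by
        intro u u' hu hu'
        simpa using M.add_mem hu hu'
      zero_mem' := by simp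
      smul_mem' := by
        intro c u hu
        simpa [zsmul_eq_mul] using M.smul_mem c hu }
  obtain ⟨e, he⟩ := (IsPrincipalIdealRing.principal V).principal
  obtain ⟨n, hn⟩ := (IsPrincipalIdealRing.principal U).principal
  obtain ⟨u, hu⟩ : e ∈ V := by rw [he]; exact Submodule.mem_span_singleton_self e
  have hnM : (n : Quad a b) ∈ M := show n ∈ U by rw [hn]; exact Submodule.mem_span_singleton_self n
  refine ⟨n, u, e, le_antisymm (fun x hx => ?_) (sp_le.2 ⟨hnM, hu⟩)⟩
  obtain ⟨x, y, rfl⟩ := mem_ord.1 (hM hx)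
  obtain ⟨k, rfl⟩ : ∃ k, k * e = y := by
    have : y ∈ V := ⟨x, hx⟩
    rw [he] at this
    exact Submodule.mem_span_singleton.1 this
  obtain ⟨l, hl⟩ : ∃ l, l * n = x - k * u := by
    have : x - k * u ∈ U := by
      have := M.sub_mem hx (M.smul_mem k hu)
      change ((x - k * u : ℤ) : Quad a b) ∈ M
      convert this using 1
      rw [zsmul_eq_mul]
      ext <;> simp
    rw [hn] at this
    exact Submodule.mem_span_singleton.1 this
  refine mem_sp.2 ⟨l, k, ?_⟩
  have hl' : (l * n : ℚ) = x - k * u := by exact_mod_cast hl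
  ext <;> simp [hl']

lemma pr_mul_sp_cube_le {α x y : Quad a b} {M : Submodule ℤ (Quad a b)} (h1 : α * x ^ 3 ∈ M)
    (h2 : α * x ^ 2 * y ∈ M) (h3 : α * x * y ^ 2 ∈ M) (h4 : α * y ^ 3 ∈ M) :
    pr α * sp x y ^ 3 ≤ M := by
  rw [pow_three', pr, sp, Submodule.span_mul_span, Submodule.span_mul_span,
    Submodule.span_mul_span, Submodule.span_le]
  rintro _ ⟨α', hα, _, ⟨_, ⟨u, hu, v, hv, rfl⟩, w, hw, rfl⟩, rfl⟩
  rw [Set.mem_singleton_iff] at hα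
  subst hα
  change α' * (u * v * w) ∈ M
  rcases hu with rfl | rfl <;> rcases hv with rfl | rfl <;> rcases hw with rfl | rfl <;>
    [convert h1 using 1; convert h2 using 1; convert h2 using 1; convert h3 using 1;
      convert h2 using 1; convert h3 using 1; convert h3 using 1; convert h4 using 1] <;>
    ring

/-- The cubic form `F` is `im (γ (xX + yY)³)`. -/
structure Rep (γ x y : Quad a b) (F : BinaryCubic) : Prop where
  coeff₁ : F.1 = (γ * x ^ 3).im
  coeff₂ : F.2.1 = 3 * (γ * x ^ 2 * y).im
  coeff₃ : F.2.2.1 = 3 * (γ * x * y ^ 2).im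
  coeff₄ : F.2.2.2 = (γ * y ^ 3).im

/-- The cubic form `3f` is `im (α (xX + yY)³)` for an invertible ideal `⟨x, y⟩` of `ℤ[τ]`
of norm `h`
such that `α⟨x, y⟩³` has norm `m`. -/
structure Datum (f : BinaryCubic) (m h : ℤ) (α x y : Quad a b) : Prop where
  m_pos : 0 < m
  h_ne : h ≠ 0
  le_ord : sp x y ≤ ord
  ord_mul : ord * sp x y = sp x y
  mul_bar : sp x y * bar (sp x y) = pr (h : Quad a b) * ord
  im_ne : (x * conj y).im ≠ 0
  cube_le : pr α * sp x y ^ 3 ≤ ord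
  norm_eq : α.norm * h ^ 3 = m
  rep : Rep α x y (scale 3 f)

lemma exists_datum {f : BinaryCubic} {m h k h₂ : ℤ} (hm : 0 < m) (hh : h ≠ 0)
    (hf : hess f = (m * h, m * (2 * k + b), m * h₂)) (hk : k ^ 2 + b * k - a = h * h₂)
    (hprim : ∃ x y z : ℤ, x * h + y * (2 * k + b) + z * h₂ = 1) :
    ∃ α x y : Quad a b, Datum f m h α x y := by
  obtain ⟨A, B, C, D⟩ := f
  simp only [hess, Prod.mk.injEq] at hf
  obtain ⟨f1, f2, f3⟩ := hf
  have e1 : 3 * A * h₂ - B * (2 * k + b) + C * h = 0 := by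
    refine (mul_eq_zero.1 (?_ : m * _ = 0)).resolve_left hm.ne'
    linear_combination -3 * A * f3 + B * f2 - C * f1
  have e2 : B * h₂ - C * (2 * k + b) + 3 * D * h = 0 := by
    refine (mul_eq_zero.1 (?_ : m * _ = 0)).resolve_left hm.ne'
    linear_combination -B * f3 + C * f2 - 3 * D * f1
  have hq : (h : ℚ) ≠ 0 := by exact_mod_cast hh
  have kq : (k ^ 2 + b * k - a : ℚ) = h * h₂ := by exact_mod_cast hk
  have e1q : (3 * A * h₂ - B * (2 * k + b) + C * h : ℚ) = 0 := by exact_mod_cast e1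
  have e2q : (B * h₂ - C * (2 * k + b) + 3 * D * h : ℚ) = 0 := by exact_mod_cast e2
  have f1q : (B ^ 2 - 3 * A * C : ℚ) = m * h := by exact_mod_cast f1
  let α : Quad a b := mk ((h * B - 3 * A * (k + b)) / h ^ 3) (3 * A / h ^ 3)
  let x : Quad a b := (h : Quad a b)
  let y : Quad a b := mk k 1
  have c1 : α * x ^ 3 = mk (h * B - 3 * A * (k + b) : ℤ) (3 * A : ℤ) := by
    ext <;> simp [α, x, pow_succ] <;> field_simp
  have c2 : α * x ^ 2 * y = mk (h * C - B * (k + b) : ℤ) (B : ℤ) := by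
    ext
    · simp [α, x, y, pow_succ]
      field_simp
      linear_combination -3 * A * kq - h * e1q
    · simp [α, x, y, pow_succ]
      field_simp
      ring
  have c3 : α * x * y ^ 2 = mk (h * (3 * D) - C * (k + b) : ℤ) (C : ℤ) := by
    have : (h : ℚ) * (α * x * y ^ 2).re = h * (h * (3 * D) - C * (k + b)) ∧
        (h : ℚ) * (α * x * y ^ 2).im = h * C := by
      have h1 : (h : ℚ) * (α * x * y ^ 2).re = (α * x ^ 2 * y * y).re := by
        simp [x, y, pow_succ]; ring
      have h2 : (h : ℚ) * (α * x * y ^ 2).im = (α * x ^ 2 * y * y).im := by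
        simp [x, y, pow_succ]; ring
      rw [h1, h2, c2]
      simp [y]
      constructor
      · linear_combination -B * kq - h * e2q
      · ring
    obtain ⟨h1, h2⟩ := this
    ext
    · simpa using mul_left_cancel₀ hq h1
    · simpa using mul_left_cancel₀ hq h2
  have c4 : α * y ^ 3 = mk ((3 * D) * k - C * h₂ : ℤ) (3 * D : ℤ) := by
    have : (h : ℚ) * (α * y ^ 3).re = h * (3 * D * k - C * h₂) ∧
        (h : ℚ) * (α * y ^ 3).im = h * (3 * D) := by
      have h1 : (h : ℚ) * (α * y ^ 3).re = (α * x * y ^ 2 * y).re := by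
        simp [x, y, pow_succ]; ring
      have h2 : (h : ℚ) * (α * y ^ 3).im = (α * x * y ^ 2 * y).im := by
        simp [x, y, pow_succ]; ring
      rw [h1, h2, c3]
      simp [y]
      constructor
      · linear_combination -C * kq
      · ring
    obtain ⟨h1, h2⟩ := this
    ext
    · simpa using mul_left_cancel₀ hq h1
    · simpa using mul_left_cancel₀ hq h2
  refine ⟨α, x, y, hm, hh, ?_, ?_, ?_, ?_, ?_, ?_, ⟨?_, ?_, ?_, ?_⟩⟩
  · rw [sp_le]
    exact ⟨mem_ord.2 ⟨h, 0, by ext <;> simp [x]⟩, mem_ord.2 ⟨k, 1, by ext <;> simp [y]⟩⟩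
  · refine le_antisymm ?_ fun z hz => ?_
    · rw [ord, sp_mul_le, one_mul, one_mul]
      refine ⟨left_mem_sp _ _, right_mem_sp _ _, mem_sp.2 ⟨-k, h, ?_⟩, mem_sp.2 ⟨-h₂, k + b, ?_⟩⟩
      · ext <;> simp [x, y] ; ring
      · ext
        · simp [x, y]
          linear_combination -kq
        · simp [x, y]
    · have := Submodule.mul_mem_mul (left_mem_sp 1 (mk 0 1)) hz
      rwa [one_mul] at this
  · have hpr : pr (h : Quad a b) * ord = sp (h : Quad a b) (mk 0 h) := by
      rw [ord, pr_mul_sp]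
      congr 1 <;> ext <;> simp
    have g1 : x * conj x ∈ sp x y * bar (sp x y) :=
      Submodule.mul_mem_mul (left_mem_sp _ _) (conj_mem_bar (left_mem_sp _ _))
    have g2 : x * conj y ∈ sp x y * bar (sp x y) :=
      Submodule.mul_mem_mul (left_mem_sp _ _) (conj_mem_bar (right_mem_sp _ _))
    have g3 : y * conj x ∈ sp x y * bar (sp x y) :=
      Submodule.mul_mem_mul (right_mem_sp _ _) (conj_mem_bar (left_mem_sp _ _))
    have g4 : y * conj y ∈ sp x y * bar (sp x y) :=
      Submodule.mul_mem_mul (right_mem_sp _ _) (conj_mem_bar (right_mem_sp _ _))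
    rw [hpr]
    refine le_antisymm ?_ ?_
    · rw [bar_sp, sp_mul_le]
      refine ⟨mem_sp.2 ⟨h, 0, ?_⟩, mem_sp.2 ⟨k + b, -1, ?_⟩, mem_sp.2 ⟨k, 1, ?_⟩,
        mem_sp.2 ⟨h₂, 0, ?_⟩⟩
      · ext <;> simp [x]
      · ext <;> simp [x, y] ; ring
      · ext <;> simp [x, y]
      · ext
        · simp [y]
          linear_combination kq
        · simp [y]
    · obtain ⟨u, v, w, huvw⟩ := hprim
      have hu : (u * h + v * (2 * k + b) + w * h₂ : ℚ) = 1 := by exact_mod_cast huvw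
      have g5 : x ∈ sp x y * bar (sp x y) := by
        have := Submodule.add_mem _ (Submodule.add_mem _ (Submodule.smul_mem _ u g1)
          (Submodule.smul_mem _ v (Submodule.add_mem _ g2 g3))) (Submodule.smul_mem _ w g4)
        convert this using 1
        simp only [zsmul_eq_mul]
        ext
        · simp [x, y]
          linear_combination -(h : ℚ) * hu - w * kq
        · simp [x, y]
      rw [sp_le]
      refine ⟨g5, ?_⟩
      have := Submodule.sub_mem _ g3 (Submodule.smul_mem _ k g5)
      convert this using 1
      simp only [zsmul_eq_mul]
      ext <;> simp [x, y]
  · simpa [x, y] using hh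
  · exact pr_mul_sp_cube_le (c1 ▸ mk_mem_ord _ _) (c2 ▸ mk_mem_ord _ _) (c3 ▸ mk_mem_ord _ _)
      (c4 ▸ mk_mem_ord _ _)
  · simp only [norm, α, re_mk, im_mk]
    field_simp
    linear_combination 9 * A ^ 2 * kq + h * (3 * A) * e1q + h ^ 2 * f1q
  · rw [c1]; simp [scale]
  · rw [c2]; simp [scale]
  · rw [c3]; simp [scale]
  · rw [c4]; simp [scale]

lemma im_intCast_mul (n : ℤ) (x : Quad a b) : ((n : Quad a b) * x).im = n * x.im := by simp

lemma Rep.subst {γ x y : Quad a b} {F : BinaryCubic} (hF : Rep γ x y F) (p q r s : ℤ) :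
    Rep γ (p * x + r * y) (q * x + s * y) (F.subst p q r s) := by
  obtain ⟨h1, h2, h3, h4⟩ := hF
  have key : ∀ n1 n2 n3 n4 : ℤ, ((n1 : Quad a b) * (γ * x ^ 3) + n2 * (γ * x ^ 2 * y) +
      n3 * (γ * x * y ^ 2) + n4 * (γ * y ^ 3)).im =
      n1 * (γ * x ^ 3).im + n2 * (γ * x ^ 2 * y).im + n3 * (γ * x * y ^ 2).im +
        n4 * (γ * y ^ 3).im := by
    intro n1 n2 n3 n4
    rw [im_add, im_add, im_add, im_intCast_mul, im_intCast_mul, im_intCast_mul, im_intCast_mul]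
  constructor
  · rw [show γ * (p * x + r * y) ^ 3 = (p ^ 3 : ℤ) * (γ * x ^ 3) +
      (3 * p ^ 2 * r : ℤ) * (γ * x ^ 2 * y) + (3 * p * r ^ 2 : ℤ) * (γ * x * y ^ 2) +
      (r ^ 3 : ℤ) * (γ * y ^ 3) by push_cast; ring, key]
    simp only [BinaryCubic.subst]
    push_cast
    rw [h1, h2, h3, h4]
    ring
  · rw [show γ * (p * x + r * y) ^ 2 * (q * x + s * y) = (p ^ 2 * q : ℤ) * (γ * x ^ 3) +
      (p ^ 2 * s + 2 * p * q * r : ℤ) * (γ * x ^ 2 * y) +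
      (2 * p * r * s + q * r ^ 2 : ℤ) * (γ * x * y ^ 2) +
      (r ^ 2 * s : ℤ) * (γ * y ^ 3) by push_cast; ring, key]
    simp only [BinaryCubic.subst]
    push_cast
    rw [h1, h2, h3, h4]
    ring
  · rw [show γ * (p * x + r * y) * (q * x + s * y) ^ 2 = (p * q ^ 2 : ℤ) * (γ * x ^ 3) +
      (2 * p * q * s + q ^ 2 * r : ℤ) * (γ * x ^ 2 * y) +
      (p * s ^ 2 + 2 * q * r * s : ℤ) * (γ * x * y ^ 2) +
      (r * s ^ 2 : ℤ) * (γ * y ^ 3) by push_cast; ring, key]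
    simp only [BinaryCubic.subst]
    push_cast
    rw [h1, h2, h3, h4]
    ring
  · rw [show γ * (q * x + s * y) ^ 3 = (q ^ 3 : ℤ) * (γ * x ^ 3) +
      (3 * q ^ 2 * s : ℤ) * (γ * x ^ 2 * y) + (3 * q * s ^ 2 : ℤ) * (γ * x * y ^ 2) +
      (s ^ 3 : ℤ) * (γ * y ^ 3) by push_cast; ring, key]
    simp only [BinaryCubic.subst]
    push_cast
    rw [h1, h2, h3, h4]
    ring

lemma Rep.unique {γ x y : Quad a b} {F G : BinaryCubic} (hF : Rep γ x y F) (hG : Rep γ x y G) :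
    F = G := by
  obtain ⟨f1, f2, f3, f4⟩ := hF
  obtain ⟨g1, g2, g3, g4⟩ := hG
  obtain ⟨A, B, C, D⟩ := F
  obtain ⟨A', B', C', D'⟩ := G
  simp only [Prod.mk.injEq]
  exact ⟨by exact_mod_cast f1.trans g1.symm, by exact_mod_cast f2.trans g2.symm,
    by exact_mod_cast f3.trans g3.symm, by exact_mod_cast f4.trans g4.symm⟩

lemma Rep.of_mul {γ x y c : Quad a b} {F : BinaryCubic} (hF : Rep (γ * c ^ 3) x y F) :
    Rep γ (c * x) (c * y) F := by
  obtain ⟨h1, h2, h3, h4⟩ := hF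
  constructor
  · rw [h1]; congr 1; ring
  · rw [h2]; congr 2; ring
  · rw [h3]; congr 2; ring
  · rw [h4]; congr 1; ring

/-- The square root of the discriminant `b² + 4a`. -/
def sqrtDisc : Quad a b := mk (-b) 2

lemma sqrtDisc_sq : (sqrtDisc : Quad a b) ^ 2 = ((b ^ 2 + 4 * a : ℤ) : Quad a b) := by
  rw [sq]
  ext
  · rw [re_intCast]
    simp only [sqrtDisc, re_mul, re_mk, im_mk]
    push_cast
    ring
  · rw [im_intCast]
    simp only [sqrtDisc, im_mul, re_mk, im_mk]
    ring

lemma sqrtDisc_mul_im (x : Quad a b) : sqrtDisc * mk x.im 0 = x - conj x := by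
  ext <;> simp [sqrtDisc]; ring

lemma im_mul_conj_comb (x y : Quad a b) (p q r s : ℤ) :
    (((p : Quad a b) * x + (r : Quad a b) * y) *
        conj ((q : Quad a b) * x + (s : Quad a b) * y)).im =
      (p * s - q * r) * (x * conj y).im := by
  simp
  ring

/-- The embedding of the rational numbers. -/
def rat : ℚ →+* Quad a b where
  toFun q := mk q 0
  map_one' := rfl
  map_zero' := rfl
  map_mul' x y := by ext <;> simp
  map_add' x y := by ext <;> simp

@[simp] lemma re_rat (q : ℚ) : (rat q : Quad a b).re = q := rfl
@[simp] lemma im_rat (q : ℚ) : (rat q : Quad a b).im = 0 := rfl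

lemma sqrtDisc_mul_rat (x : Quad a b) : sqrtDisc * rat x.im = x - conj x := sqrtDisc_mul_im x

lemma rat_norm (x : Quad a b) : rat x.norm = x * conj x := (mul_conj x).symm

lemma rat_injective : Function.Injective (rat : ℚ → Quad a b) := fun _ _ h => congrArg re h

lemma rat_intCast (n : ℤ) : (rat (n : ℚ) : Quad a b) = n := map_intCast rat n

/-- The Hessian covariant of the form `im (γ (xX + yY)³)`. -/
lemma hess_coeff (hδ : b ^ 2 + 4 * a ≠ 0) (γ x y : Quad a b) :
    (γ * x ^ 2 * y).im ^ 2 - (γ * x ^ 3).im * (γ * x * y ^ 2).im =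
      γ.norm * (x * conj y).im ^ 2 * x.norm ∧
    (γ * x ^ 2 * y).im * (γ * x * y ^ 2).im - (γ * x ^ 3).im * (γ * y ^ 3).im =
      γ.norm * (x * conj y).im ^ 2 * (2 * (x * conj y).re + b * (x * conj y).im) := by
  have hs : IsUnit ((sqrtDisc : Quad a b) ^ 2) := by
    rw [sqrtDisc_sq]
    refine isUnit_iff ?_
    rw [norm_intCast]
    exact_mod_cast pow_ne_zero 2 hδ
  have tr : (rat (2 * (x * conj y).re + b * (x * conj y).im) : Quad a b) =
      x * conj y + conj x * y := by
    ext
    · rw [re_rat]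
      simp
      ring
    · rw [im_rat]
      simp
      ring
  have e0 := sqrtDisc_mul_rat (γ * x ^ 3)
  have e1 := sqrtDisc_mul_rat (γ * x ^ 2 * y)
  have e2 := sqrtDisc_mul_rat (γ * x * y ^ 2)
  have e3 := sqrtDisc_mul_rat (γ * y ^ 3)
  have e4 := sqrtDisc_mul_rat (x * conj y)
  simp only [map_mul, map_pow, conj_conj] at e0 e1 e2 e3 e4
  constructor <;> refine rat_injective (hs.mul_left_cancel ?_)
  · simp only [map_mul, map_pow, map_sub, rat_norm]
    generalize (rat (γ * x ^ 3).im : Quad a b) = f0 at *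
    generalize (rat (γ * x ^ 2 * y).im : Quad a b) = f1 at *
    generalize (rat (γ * x * y ^ 2).im : Quad a b) = f2 at *
    generalize (rat (x * conj y).im : Quad a b) = w at *
    generalize (sqrtDisc : Quad a b) = s at *
    have : s ^ 2 * (f1 ^ 2 - f0 * f2) = (s * f1) ^ 2 - (s * f0) * (s * f2) := by ring
    rw [this, e0, e1, e2]
    have : s ^ 2 * (γ * conj γ * w ^ 2 * (x * conj x)) =
      γ * conj γ * (s * w) ^ 2 * (x * conj x) := by ring
    rw [this, e4]
    ring
  · rw [map_mul rat (_ * _), tr]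
    simp only [map_mul, map_pow, map_sub, rat_norm]
    generalize (rat (γ * x ^ 3).im : Quad a b) = f0 at *
    generalize (rat (γ * x ^ 2 * y).im : Quad a b) = f1 at *
    generalize (rat (γ * x * y ^ 2).im : Quad a b) = f2 at *
    generalize (rat (γ * y ^ 3).im : Quad a b) = f3 at *
    generalize (rat (x * conj y).im : Quad a b) = w at *
    generalize (sqrtDisc : Quad a b) = s at *
    have : s ^ 2 * (f1 * f2 - f0 * f3) = (s * f1) * (s * f2) - (s * f0) * (s * f3) := by ring
    rw [this, e0, e1, e2, e3]
    have : s ^ 2 * (γ * conj γ * w ^ 2 * (x * conj y + conj x * y)) =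
      γ * conj γ * (s * w) ^ 2 * (x * conj y + conj x * y) := by ring
    rw [this, e4]
    ring

/-- The discriminant of the form `im (γ (xX + yY)³)`. -/
lemma Rep.discF_eq (hδ : b ^ 2 + 4 * a ≠ 0) {γ x y : Quad a b} {F : BinaryCubic}
    (hF : Rep γ x y F) :
    (discF F : ℚ) = -27 * γ.norm ^ 2 * (b ^ 2 + 4 * a : ℤ) * (x * conj y).im ^ 6 := by
  have hs : IsUnit ((sqrtDisc : Quad a b) ^ 4) := by
    rw [show (sqrtDisc : Quad a b) ^ 4 = (sqrtDisc ^ 2) ^ 2 by ring, sqrtDisc_sq]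
    refine IsUnit.pow 2 (isUnit_iff ?_)
    rw [norm_intCast]
    exact_mod_cast pow_ne_zero 2 hδ
  have e0 := sqrtDisc_mul_rat (γ * x ^ 3)
  have e1 := sqrtDisc_mul_rat (γ * x ^ 2 * y)
  have e2 := sqrtDisc_mul_rat (γ * x * y ^ 2)
  have e3 := sqrtDisc_mul_rat (γ * y ^ 3)
  have e4 := sqrtDisc_mul_rat (x * conj y)
  simp only [map_mul, map_pow, conj_conj] at e0 e1 e2 e3 e4
  have h1 := hF.coeff₁
  have h2 := hF.coeff₂
  have h3 := hF.coeff₃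
  have h4 := hF.coeff₄
  obtain ⟨A, B, C, D⟩ := F
  simp only [discF] at h1 h2 h3 h4 ⊢
  push_cast
  rw [h1, h2, h3, h4]
  refine rat_injective (hs.mul_left_cancel ?_)
  have hd : (rat (b ^ 2 + 4 * a : ℤ) : Quad a b) = sqrtDisc ^ 2 := by
    rw [sqrtDisc_sq, rat_intCast]
  push_cast at hd
  rw [map_mul, map_mul rat (_ * _), hd]
  simp only [map_mul, map_pow, map_sub, map_add, map_neg, map_ofNat, rat_norm]
  generalize (rat (γ * x ^ 3).im : Quad a b) = f0 at *
  generalize (rat (γ * x ^ 2 * y).im : Quad a b) = f1 at *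
  generalize (rat (γ * x * y ^ 2).im : Quad a b) = f2 at *
  generalize (rat (γ * y ^ 3).im : Quad a b) = f3 at *
  generalize (rat (x * conj y).im : Quad a b) = w at *
  generalize (sqrtDisc : Quad a b) = s at *
  generalize conj γ = γ' at *
  generalize conj x = x' at *
  generalize conj y = y' at *
  have : s ^ 4 * (-27 * (γ * γ') ^ 2 * s ^ 2 * w ^ 6) = -27 * (γ * γ') ^ 2 * (s * w) ^ 6 := by
    ring
  rw [this, e4]
  have : s ^ 4 * ((3 * f1) ^ 2 * (3 * f2) ^ 2 - 4 * f0 * (3 * f2) ^ 3 - 4 * (3 * f1) ^ 3 * f3 -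
      27 * f0 ^ 2 * f3 ^ 2 + 18 * f0 * (3 * f1) * (3 * f2) * f3) =
      27 * (3 * (s * f1) ^ 2 * (s * f2) ^ 2 - 4 * (s * f0) * (s * f2) ^ 3 -
        4 * (s * f1) ^ 3 * (s * f3) - (s * f0) ^ 2 * (s * f3) ^ 2 +
        6 * (s * f0) * (s * f1) * (s * f2) * (s * f3)) := by ring
  rw [this, e0, e1, e2, e3]
  ring

lemma im_mul_conj (x y : Quad a b) : (x * conj y).im = x.im * y.re - x.re * y.im := by
  simp
  ring

lemma norm_im_trace (x y : Quad a b) :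
    (2 * (x * conj y).re + b * (x * conj y).im) ^ 2 =
      4 * x.norm * y.norm + (b ^ 2 + 4 * a) * (x * conj y).im ^ 2 := by
  simp [norm]
  ring

lemma norm_add (x y : Quad a b) :
    (x + y).norm = x.norm + y.norm + (2 * (x * conj y).re + b * (x * conj y).im) := by
  simp [norm]
  ring

lemma sp_comb_le (x y : Quad a b) (p q r s : ℤ) :
    sp ((p : Quad a b) * x + (r : Quad a b) * y) ((q : Quad a b) * x + (s : Quad a b) * y) ≤
      sp x y :=
  sp_le.2 ⟨mem_sp.2 ⟨p, r, rfl⟩, mem_sp.2 ⟨q, s, rfl⟩⟩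

lemma sp_comb (x y : Quad a b) {p q r s : ℤ} (h : p * s - q * r = 1) :
    sp ((p : Quad a b) * x + (r : Quad a b) * y) ((q : Quad a b) * x + (s : Quad a b) * y) =
      sp x y := by
  refine le_antisymm (sp_comb_le ..) ?_
  have h' : (p * s - q * r : Quad a b) = 1 := by exact_mod_cast congrArg (Int.cast : ℤ → Quad a b) h
  refine sp_le.2 ⟨mem_sp.2 ⟨s, -r, ?_⟩, mem_sp.2 ⟨-q, p, ?_⟩⟩
  · push_cast
    linear_combination (-x) * h'
  · push_cast
    linear_combination (-y) * h'

lemma sp_neg_right (x y : Quad a b) : sp x (-y) = sp x y := by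
  refine le_antisymm (sp_le.2 ⟨left_mem_sp _ _, ?_⟩) (sp_le.2 ⟨left_mem_sp _ _, ?_⟩)
  · exact Submodule.neg_mem _ (right_mem_sp x y)
  · exact (Submodule.neg_mem_iff _).1 (right_mem_sp x (-y))

lemma exists_im_eq_of_mem_mul_bar {x y z : Quad a b} (hz : z ∈ sp x y * bar (sp x y)) :
    ∃ c : ℤ, z.im = c * (x * conj y).im := by
  let M : Submodule ℤ (Quad a b) :=
    { carrier := {z | ∃ c : ℤ, z.im = c * (x * conj y).im}
      add_mem' := by
        rintro z w ⟨c, hc⟩ ⟨d, hd⟩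
        refine ⟨c + d, ?_⟩
        rw [im_add, hc, hd]
        push_cast
        ring
      zero_mem' := ⟨0, by simp⟩
      smul_mem' := by
        rintro c z ⟨d, hd⟩
        refine ⟨c * d, ?_⟩
        rw [zsmul_eq_mul, im_intCast_mul, hd]
        push_cast
        ring }
  have : sp x y * bar (sp x y) ≤ M := by
    rw [bar_sp, sp_mul_le]
    refine ⟨⟨0, ?_⟩, ⟨1, ?_⟩, ⟨-1, ?_⟩, ⟨0, ?_⟩⟩ <;> simp <;> ring
  exact this hz

lemma im_eq_or_of_mul_bar {x y : Quad a b} {N : ℤ} (hN : N ≠ 0)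
    (h : sp x y * bar (sp x y) = pr (N : Quad a b) * ord) :
    (x * conj y).im = N ∨ (x * conj y).im = -N := by
  have hN' : (N : ℚ) ≠ 0 := by exact_mod_cast hN
  have h1 : ∃ c : ℤ, (N : ℚ) = c * (x * conj y).im := by
    have : (N : Quad a b) * mk 0 1 ∈ sp x y * bar (sp x y) := by
      rw [h, mem_pr_mul]
      exact ⟨_, right_mem_sp _ _, rfl⟩
    simpa using exists_im_eq_of_mem_mul_bar this
  have h2 : ∃ d : ℤ, (x * conj y).im = d * N := by
    have : x * conj y ∈ sp x y * bar (sp x y) :=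
      Submodule.mul_mem_mul (left_mem_sp _ _) (conj_mem_bar (right_mem_sp _ _))
    rw [h, mem_pr_mul] at this
    obtain ⟨z, hz, hz'⟩ := this
    obtain ⟨u, v, rfl⟩ := mem_ord.1 hz
    refine ⟨v, ?_⟩
    rw [← hz', im_intCast_mul]
    simp [mul_comm]
  obtain ⟨c, hc⟩ := h1
  obtain ⟨d, hd⟩ := h2
  have : c * d = 1 := by
    rw [hd, ← mul_assoc] at hc
    have : ((c * d : ℤ) : ℚ) = 1 := by
      push_cast
      exact mul_right_cancel₀ hN' (by rw [← hc, one_mul])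
    exact_mod_cast this
  rcases Int.eq_one_or_neg_one_of_mul_eq_one' this with ⟨-, rfl⟩ | ⟨-, rfl⟩
  · left; simpa using hd
  · right; simpa using hd

/-- The two generators of an invertible ideal of norm `N` can be chosen positively oriented, the
first of them being invertible. -/
lemma exists_sp_im_eq (hδ : b ^ 2 + 4 * a ≠ 0) {L : Submodule ℤ (Quad a b)} (hL : L ≤ ord) {N : ℤ}
    (hN : N ≠ 0) (h : L * bar L = pr (N : Quad a b) * ord) :
    ∃ x y : Quad a b, L = sp x y ∧ (x * conj y).im = N ∧ x.norm ≠ 0 := by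
  obtain ⟨n, u, e, rfl⟩ := exists_eq_sp hL
  generalize (n : Quad a b) = x at *
  generalize mk (u : ℚ) (e : ℚ) = y at *
  have hN' : (N : ℚ) ≠ 0 := by exact_mod_cast hN
  have h3 := im_eq_or_of_mul_bar hN h
  obtain ⟨y', hy', hw⟩ : ∃ y', sp x y' = sp x y ∧ (x * conj y').im = N := by
    rcases h3 with h3 | h3
    · exact ⟨y, rfl, h3⟩
    · refine ⟨-y, sp_neg_right _ _, ?_⟩
      rw [map_neg, mul_neg, im_neg, h3, neg_neg]
  rw [← hy']
  clear hy' h3 h hL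
  have comb : ∀ p q r s : ℤ, p * s - q * r = 1 →
      ((p : Quad a b) * x + (r : Quad a b) * y').norm ≠ 0 →
      ∃ x₁ y₁ : Quad a b, sp x y' = sp x₁ y₁ ∧ (x₁ * conj y₁).im = N ∧ x₁.norm ≠ 0 := by
    intro p q r s hd hne
    refine ⟨_, _, (sp_comb x y' hd).symm, ?_, hne⟩
    rw [im_mul_conj_comb, hw]
    have : (p * s - q * r : ℚ) = 1 := by exact_mod_cast hd
    rw [this, one_mul]
  by_cases hx : x.norm = 0
  · by_cases hy : y'.norm = 0
    · refine comb 1 0 1 1 (by norm_num) fun h0 => ?_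
      have h1 := norm_im_trace x y'
      have h2 := norm_add x y'
      simp only [Int.cast_one, one_mul] at h0
      rw [h0, hx, hy] at h2
      rw [hx, hy, hw, ← sub_eq_zero] at h1
      have : (b ^ 2 + 4 * a : ℚ) ≠ 0 := by exact_mod_cast hδ
      rw [hw, zero_add, zero_add] at h2
      rw [← h2] at h1
      simp [hN', this] at h1
    · exact comb 0 (-1) 1 0 (by norm_num) (by simpa using hy)
  · exact comb 1 0 0 1 (by norm_num) (by simpa using hx)

/-- The form `F` is `im (γ (κ₁X + κ₂Y)³)` for oriented generators of the quotient `J K⁻¹` of two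
ideals of norms `h` and `n`. -/
structure Comp (h n : ℤ) (α β : Quad a b) (J K : Submodule ℤ (Quad a b)) (γ κ₁ κ₂ : Quad a b)
    (F : BinaryCubic) : Prop where
  span_eq : J * bar K = sp κ₁ κ₂
  mul_eq : γ * (β * (n : Quad a b) ^ 3) = α
  im_eq : (κ₁ * conj κ₂).im = h * n
  norm_ne : κ₁.norm ≠ 0
  norm_eq : γ.norm * (h * n) ^ 3 = 1
  rep : Rep γ κ₁ κ₂ F

lemma exists_int_im {z : Quad a b} (hz : z ∈ ord) : ∃ n : ℤ, (n : ℚ) = z.im := by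
  obtain ⟨u, v, rfl⟩ := mem_ord.1 hz
  exact ⟨v, rfl⟩

lemma Datum.norm_ne {f : BinaryCubic} {m h : ℤ} {α x y : Quad a b} (D : Datum f m h α x y) :
    α.norm ≠ 0 := by
  intro h0
  have h1 := D.norm_eq
  have h2 := D.m_pos
  rw [h0, zero_mul] at h1
  have : m = 0 := by exact_mod_cast h1.symm
  omega

lemma Datum.exists_comp (hδ : b ^ 2 + 4 * a ≠ 0) {f g : BinaryCubic} {m h n : ℤ}
    {α β x y u v : Quad a b} (D : Datum f m h α x y) (D₀ : Datum g m n β u v)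
    (hA : pr α * sp x y ^ 3 = pr β * sp u v ^ 3) :
    ∃ γ κ₁ κ₂ F, Comp h n α β (sp x y) (sp u v) γ κ₁ κ₂ F := by
  have hn : (n : ℚ) ≠ 0 := by exact_mod_cast D₀.h_ne
  have hh : (h : ℚ) ≠ 0 := by exact_mod_cast D.h_ne
  have hm : (m : ℚ) ≠ 0 := by exact_mod_cast D.m_pos.ne'
  have hβ : IsUnit (β * (n : Quad a b) ^ 3) :=
    (isUnit_iff D₀.norm_ne).mul ((isUnit_iff (by rw [norm_intCast]; positivity)).pow 3)
  obtain ⟨γ, hγ⟩ : ∃ γ, γ * (β * (n : Quad a b) ^ 3) = α := by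
    obtain ⟨w, hw⟩ := hβ
    exact ⟨α * ↑w⁻¹, by rw [← hw, mul_assoc, Units.inv_mul, mul_one]⟩
  set L := sp x y * bar (sp u v) with hL
  have hLle : L ≤ ord := by
    rw [hL, ← ord_mul_ord]
    refine mul_le_mul' D.le_ord ?_
    rw [← bar_ord]
    exact Submodule.map_mono D₀.le_ord
  have hLL : L * bar L = pr ((h * n : ℤ) : Quad a b) * ord := by
    rw [hL, bar_mul, bar_bar]
    calc sp x y * bar (sp u v) * (bar (sp x y) * sp u v)
        = (sp x y * bar (sp x y)) * (sp u v * bar (sp u v)) := by ring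
      _ = _ := by
        rw [D.mul_bar, D₀.mul_bar, Int.cast_mul, pr_mul]
        rw [show pr (h : Quad a b) * ord * (pr (n : Quad a b) * ord) =
          pr (h : Quad a b) * pr (n : Quad a b) * (ord * ord) by ring, ord_mul_ord]
  have hord : (ord : Submodule ℤ (Quad a b)) ^ 3 = ord := by
    rw [pow_three, ord_mul_ord, ord_mul_ord]
  have hcube : pr γ * L ^ 3 = ord := by
    refine pr_mul_cancel hβ ?_
    rw [← mul_assoc, ← pr_mul, mul_comm _ γ, hγ, hL, mul_pow, ← mul_assoc, hA, mul_assoc,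
      ← mul_pow, D₀.mul_bar, mul_pow, hord, ← pr_pow, ← mul_assoc, ← pr_mul]
  obtain ⟨κ₁, κ₂, h1, h2, h3⟩ := exists_sp_im_eq hδ hLle (mul_ne_zero D.h_ne D₀.h_ne) hLL
  have mem : ∀ p q r, p ∈ L → q ∈ L → r ∈ L → ∃ n : ℤ, (n : ℚ) = (γ * (p * (q * r))).im := by
    intro p q r hp hq hr
    refine exists_int_im ?_
    rw [← hcube, mem_pr_mul, pow_three]
    exact ⟨_, Submodule.mul_mem_mul hp (Submodule.mul_mem_mul hq hr), rfl⟩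
  have m1 : κ₁ ∈ L := h1 ▸ left_mem_sp _ _
  have m2 : κ₂ ∈ L := h1 ▸ right_mem_sp _ _
  obtain ⟨A, hA'⟩ := mem _ _ _ m1 m1 m1
  obtain ⟨B, hB'⟩ := mem _ _ _ m1 m1 m2
  obtain ⟨C, hC'⟩ := mem _ _ _ m1 m2 m2
  obtain ⟨E, hE'⟩ := mem _ _ _ m2 m2 m2
  refine ⟨γ, κ₁, κ₂, (A, 3 * B, 3 * C, E), h1, hγ, by rw [h2]; push_cast; rfl, h3, ?_, ?_⟩
  · have e1 := D.norm_eq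
    have e2 := D₀.norm_eq
    rw [← hγ, norm_mul, norm_mul, ← Int.cast_pow, norm_intCast] at e1
    push_cast at e1
    refine mul_right_cancel₀ hm ?_
    rw [one_mul]
    nth_rewrite 2 [← e1]
    rw [← e2]
    ring
  · constructor
    · rw [hA']; congr 1; ring
    · push_cast; rw [hB']; congr 2; ring
    · push_cast; rw [hC']; congr 2; ring
    · rw [hE']; congr 1; ring

lemma Comp.discF_eq (hδ : b ^ 2 + 4 * a ≠ 0) {h n : ℤ} {α β : Quad a b}
    {J K : Submodule ℤ (Quad a b)} {γ κ₁ κ₂ : Quad a b} {F : BinaryCubic}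
    (H : Comp h n α β J K γ κ₁ κ₂ F) : discF F = -27 * (b ^ 2 + 4 * a) := by
  have h1 := H.rep.discF_eq hδ
  have h2 := H.norm_eq
  rw [H.im_eq] at h1
  have : (discF F : ℚ) = -27 * (b ^ 2 + 4 * a : ℤ) := by
    rw [h1]
    linear_combination (-27 * (b ^ 2 + 4 * a : ℤ) : ℚ) * (γ.norm * (h * n) ^ 3 + 1) * h2
  exact_mod_cast this

lemma eq_zero_of_im {x y z : Quad a b} (hxy : (x * conj y).im ≠ 0) (hx : (z * x).im = 0)
    (hy : (z * y).im = 0) : z = 0 := by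
  rw [im_mul_conj] at hxy
  rw [im_mul] at hx hy
  ext
  · rw [re_zero]
    refine (mul_eq_zero.1 ?_).resolve_right hxy
    linear_combination (y.re + b * y.im) * hx - (x.re + b * x.im) * hy
  · rw [im_zero]
    refine (mul_eq_zero.1 ?_).resolve_right hxy
    linear_combination - y.im * hx + x.im * hy

/-- Two representations of the same form differ by a scalar. -/
lemma Rep.exists_smul (hδ : b ^ 2 + 4 * a ≠ 0) {γ γ' x y x' y' : Quad a b} {F : BinaryCubic}
    (hF : Rep γ x y F) (hF' : Rep γ' x' y' F) (hγ : γ.norm * (x * conj y).im ^ 3 = 1)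
    (hγ' : γ'.norm * (x' * conj y').im ^ 3 = 1) (hx' : x'.norm ≠ 0) :
    ∃ c : Quad a b, x' = c * x ∧ y' = c * y ∧ γ = γ' * c ^ 3 := by
  have q1 : (γ * x ^ 3).im = (γ' * x' ^ 3).im := hF.coeff₁.symm.trans hF'.coeff₁
  have q2 : (γ * x ^ 2 * y).im = (γ' * x' ^ 2 * y').im :=
    mul_left_cancel₀ three_ne_zero (hF.coeff₂.symm.trans hF'.coeff₂)
  have q3 : (γ * x * y ^ 2).im = (γ' * x' * y' ^ 2).im :=
    mul_left_cancel₀ three_ne_zero (hF.coeff₃.symm.trans hF'.coeff₃)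
  have q4 : (γ * y ^ 3).im = (γ' * y' ^ 3).im := hF.coeff₄.symm.trans hF'.coeff₄
  obtain ⟨e1, e2⟩ := hess_coeff hδ γ x y
  obtain ⟨e1', e2'⟩ := hess_coeff hδ γ' x' y'
  rw [q1, q2, q3, e1'] at e1
  rw [q1, q2, q3, q4, e2'] at e2
  clear e1' e2'
  set w := (x * conj y).im with hw
  set w' := (x' * conj y').im with hw'
  have w0 : w ≠ 0 := by rintro h; rw [h] at hγ; norm_num at hγ
  have w0' : w' ≠ 0 := by rintro h; rw [h] at hγ'; norm_num at hγ'
  have t1 : x.norm * w' = x'.norm * w := by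
    linear_combination -(x.norm * w') * hγ + x'.norm * w * hγ' - (w * w') * e1
  have t2 : (2 * (x * conj y).re + b * w) * w' = (2 * (x' * conj y').re + b * w') * w := by
    linear_combination -((2 * (x * conj y).re + b * w) * w') * hγ +
      (2 * (x' * conj y').re + b * w') * w * hγ' - (w * w') * e2
  have t3 : x * conj y * rat w' = x' * conj y' * rat w := by
    ext
    · rw [re_mul, re_mul _ (rat w), re_rat, re_rat, im_rat, im_rat]
      linear_combination t2 / 2
    · rw [im_mul, im_mul _ (rat w), re_rat, re_rat, im_rat, im_rat, ← hw, ← hw']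
      ring
  have hx : x.norm ≠ 0 := by
    intro h
    rw [h, zero_mul] at t1
    exact mul_ne_zero hx' w0 t1.symm
  have ux := isUnit_iff hx
  obtain ⟨c, rfl⟩ : ∃ c, x' = c * x := by
    obtain ⟨v, hv⟩ := ux
    exact ⟨x' * ↑v⁻¹, by rw [← hv, mul_assoc, Units.inv_mul, mul_one]⟩
  rw [norm_mul] at t1 hx'
  have hc : c.norm * w = w' := mul_left_cancel₀ hx (by linear_combination - t1)
  have hy : y' = c * y := by
    have r0' : IsUnit (rat w' : Quad a b) := isUnit_iff (by simpa [norm] using w0')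
    have s1 : conj y * rat w' = c * conj y' * rat w := ux.mul_left_cancel (by
      linear_combination t3)
    have s2 := congrArg conj s1
    have cr : ∀ q : ℚ, (conj (rat q) : Quad a b) = rat q := fun q => by ext <;> simp
    simp only [map_mul, conj_conj, cr] at s2
    have s3 : rat w' = c * conj c * rat w := by
      rw [← rat_norm, ← hc, map_mul]
    refine r0'.mul_left_cancel ?_
    linear_combination y' * s3 - c * s2
  refine ⟨c, rfl, hy, ?_⟩
  subst hy
  have r := hF'
  rw [← sub_eq_zero]
  refine (ux.pow 2).mul_left_cancel ?_
  rw [mul_zero]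
  refine eq_zero_of_im w0 ?_ ?_
  · rw [show x ^ 2 * (γ - γ' * c ^ 3) * x = γ * x ^ 3 - γ' * (c * x) ^ 3 by ring, im_sub, q1,
      sub_self]
  · rw [show x ^ 2 * (γ - γ' * c ^ 3) * y = γ * x ^ 2 * y - γ' * (c * x) ^ 2 * (c * y) by ring,
      im_sub, q2, sub_self]

lemma Datum.eqv_of_smul {f f' : BinaryCubic} {m m' h h' : ℤ} {α α' x y x' y' c : Quad a b}
    (D : Datum f m h α x y) (D' : Datum f' m' h' α' x' y')
    (hJ : sp x' y' = pr c * sp x y) (hα : α = α' * c ^ 3) : Eqv f f' := by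
  rw [pr_mul_sp] at hJ
  obtain ⟨p, r, h1⟩ := mem_sp.1 (hJ ▸ left_mem_sp (c * x) (c * y))
  obtain ⟨q, s, h2⟩ := mem_sp.1 (hJ ▸ right_mem_sp (c * x) (c * y))
  obtain ⟨p', r', h1'⟩ := mem_sp.1 (hJ ▸ left_mem_sp x' y')
  obtain ⟨q', s', h2'⟩ := mem_sp.1 (hJ ▸ right_mem_sp x' y')
  have e1 := im_mul_conj_comb x' y' p q r s
  have e2 := im_mul_conj_comb (c * x) (c * y) p' q' r' s'
  rw [← h1, ← h2] at e1
  rw [← h1', ← h2', e1, ← mul_assoc] at e2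
  have hd : (p' * s' - q' * r') * (p * s - q * r) = 1 := by
    have : ((p' * s' - q' * r') * (p * s - q * r) : ℚ) = 1 :=
      mul_right_cancel₀ D'.im_ne (by rw [← e2, one_mul])
    exact_mod_cast this
  have hF : Rep α' (c * x) (c * y) (scale 3 f) := Rep.of_mul (hα ▸ D.rep)
  have hF' := D'.rep.subst p q r s
  rw [← h1, ← h2, subst_scale] at hF'
  have := scale_injective three_ne_zero (hF.unique hF')
  rw [mul_comm] at hd
  exact Eqv.symm ⟨p, q, r, s, Int.eq_one_or_neg_one_of_mul_eq_one hd, this⟩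

/-- Composition with a fixed form is injective on classes. -/
lemma Comp.eqv (hδ : b ^ 2 + 4 * a ≠ 0) {f f' g : BinaryCubic} {m m' h h' n : ℤ}
    {α α' β x y x' y' u v γ γ' κ₁ κ₂ κ₁' κ₂' : Quad a b} {F F' : BinaryCubic}
    (D : Datum f m h α x y) (D' : Datum f' m' h' α' x' y') (D₀ : Datum g m n β u v)
    (H : Comp h n α β (sp x y) (sp u v) γ κ₁ κ₂ F)
    (H' : Comp h' n α' β (sp x' y') (sp u v) γ' κ₁' κ₂' F')
    {p q r s : ℤ} (hd : p * s - q * r = 1) (hF : F' = F.subst p q r s) : Eqv f f' := by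
  have hd' : (p * s - q * r : ℚ) = 1 := by exact_mod_cast hd
  have hR := H.rep.subst p q r s
  rw [← hF] at hR
  have hn : IsUnit (n : Quad a b) := isUnit_iff (by
    rw [norm_intCast]
    exact pow_ne_zero 2 (by exact_mod_cast D₀.h_ne))
  obtain ⟨c, h1, h2, h3⟩ := hR.exists_smul hδ H'.rep
    (by rw [im_mul_conj_comb, hd', one_mul, H.im_eq, H.norm_eq])
    (by rw [H'.im_eq, H'.norm_eq]) H'.norm_ne
  refine D.eqv_of_smul (c := c) D' ?_ ?_
  · refine pr_mul_cancel hn ?_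
    have e1 : sp x' y' * bar (sp u v) = pr c * (sp x y * bar (sp u v)) := by
      rw [H'.span_eq, H.span_eq, h1, h2, ← pr_mul_sp, sp_comb _ _ hd]
    have key : ∀ x y : Quad a b, ord * sp x y = sp x y →
        sp x y * bar (sp u v) * sp u v = pr (n : Quad a b) * sp x y := by
      intro x y h
      rw [mul_assoc, mul_comm (bar _), D₀.mul_bar, mul_left_comm, mul_comm _ ord, h]
    rw [← key _ _ D'.ord_mul, e1, mul_left_comm (pr (n : Quad a b)), ← key _ _ D.ord_mul,
      mul_assoc]
  · rw [← H.mul_eq, ← H'.mul_eq, h3]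
    ring

end Quad

/-- A map defined up to proper equivalence and injective on proper classes is at most two to one. -/
lemma ClassBound.of_rel {P Q : BinaryCubic → Prop} {N : ℝ} (hQ : ClassBound Q N)
    (R : BinaryCubic → BinaryCubic → Prop) (h1 : ∀ f, P f → ∃ F, Q F ∧ R f F)
    (h2 : ∀ f g F p q r s, R f F → R g (subst F p q r s) → p * s - q * r = 1 → Eqv f g) :
    ClassBound P (2 * N) := by
  choose! φ hφ hR using h1
  have := hQ.of_map 2 φ hφ fun s hs hs' h => by
    by_contra! hcard
    obtain ⟨f, g, k, hf, hg, hk, hfg, hfk, hgk⟩ := Finset.two_lt_card_iff.1 hcard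
    have inj : ∀ f ∈ s, ∀ g ∈ s, f ≠ g → ∀ p q r t : ℤ, φ g = subst (φ f) p q r t →
        p * t - q * r ≠ 1 := fun f hf g hg hne p q r t e hd =>
      hne (hs' f hf g hg (h2 f g (φ f) p q r t (hR f (hs f hf)) (e ▸ hR g (hs g hg)) hd))
    obtain ⟨p, q, r, t, hd, e⟩ := h f hf g hg
    obtain ⟨p', q', r', t', hd', e'⟩ := h f hf k hk
    replace hd := hd.resolve_left (inj f hf g hg hfg _ _ _ _ e)
    replace hd' := hd'.resolve_left (inj f hf k hk hfk _ _ _ _ e')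
    have e'' : φ f = subst (φ g) (-t) q r (-p) := by
      rw [e, subst_subst]
      convert (subst_one _).symm using 2 <;> linarith
    rw [e'', subst_subst] at e'
    refine inj g hg k hk hgk _ _ _ _ e' ?_
    linear_combination (p' * t' - q' * r') * hd - hd'
  simpa using this

namespace Quad

lemma classBound_of_lattice {K : ℝ} (hK : ∀ X : ℝ, 0 < X → ClassBound (DiscLT X) (K * X)) {X : ℝ}
    (hX : 0 < X) (m : ℤ) (A : ∀ a b : ℤ, Submodule ℤ (Quad a b)) :
    ClassBound (fun f => DiscLT X f ∧ ∃ a b : ℤ, (b = 0 ∨ b = 1) ∧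
      3 * discF f = -(m ^ 2 * (b ^ 2 + 4 * a)) ∧
      ∃ (h : ℤ) (α x y : Quad a b), Datum f m h α x y ∧ pr α * sp x y ^ 3 = A a b)
      (162 * K * X / (m : ℝ) ^ 2) := by
  have base : ∀ a b : ℤ, ∃ (g : BinaryCubic) (n : ℤ) (β u v : Quad a b),
      (∃ (f : BinaryCubic) (h : ℤ) (α x y : Quad a b),
        Datum f m h α x y ∧ pr α * sp x y ^ 3 = A a b) →
      Datum g m n β u v ∧ pr β * sp u v ^ 3 = A a b := by
    intro a b
    by_cases H : ∃ (f : BinaryCubic) (h : ℤ) (α x y : Quad a b),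
        Datum f m h α x y ∧ pr α * sp x y ^ 3 = A a b
    · obtain ⟨f, h, α, x, y, H'⟩ := H
      exact ⟨f, h, α, x, y, fun _ => H'⟩
    · exact ⟨0, 0, 0, 0, 0, fun h => absurd h H⟩
  choose g n β u v hbase using base
  by_cases hm : m = 0
  · intro s hs _
    have : s = ∅ := by
      refine Finset.eq_empty_of_forall_notMem fun f hf => ?_
      obtain ⟨h0, a, b, -, h1, -⟩ := hs f hf
      refine h0.1 ?_
      rw [hm] at h1
      linarith
    simp [this, hm]
  have hm' : (0 : ℝ) < (m : ℝ) ^ 2 := by positivity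
  have hQ := hK (81 * X / (m : ℝ) ^ 2) (by positivity)
  convert hQ.of_rel (P := fun f => DiscLT X f ∧ ∃ a b : ℤ, (b = 0 ∨ b = 1) ∧
      3 * discF f = -(m ^ 2 * (b ^ 2 + 4 * a)) ∧
      ∃ (h : ℤ) (α x y : Quad a b), Datum f m h α x y ∧ pr α * sp x y ^ 3 = A a b)
      (fun f F => ∃ a b : ℤ, (b = 0 ∨ b = 1) ∧ b ^ 2 + 4 * a ≠ 0 ∧
        ∃ (h : ℤ) (α x y γ κ₁ κ₂ : Quad a b), Datum f m h α x y ∧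
          Datum (g a b) m (n a b) (β a b) (u a b) (v a b) ∧
          Comp h (n a b) α (β a b) (sp x y) (sp (u a b) (v a b)) γ κ₁ κ₂ F) ?_ ?_ using 1
  · ring
  · rintro f ⟨⟨h0, h0'⟩, a, b, hb, hf, h, α, x, y, D, hA⟩
    obtain ⟨D₀, hA₀⟩ := hbase a b ⟨f, h, α, x, y, D, hA⟩
    have hδ : b ^ 2 + 4 * a ≠ 0 := by
      intro h1
      rw [h1] at hf
      exact h0 (by linarith)
    obtain ⟨γ, κ₁, κ₂, F, H⟩ := D.exists_comp hδ D₀ (hA.trans hA₀.symm)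
    have hF := H.discF_eq hδ
    refine ⟨F, ⟨?_, ?_⟩, a, b, hb, hδ, h, α, x, y, γ, κ₁, κ₂, D, D₀, H⟩
    · rw [hF]
      exact mul_ne_zero (by norm_num) hδ
    · rw [lt_div_iff₀ hm']
      have e : discF F * m ^ 2 = 81 * discF f := by
        rw [hF]
        linear_combination (-27) * hf
      have e' : (discF F : ℝ) * (m : ℝ) ^ 2 = 81 * discF f := by exact_mod_cast e
      rw [← abs_of_pos hm', ← abs_mul, e', abs_mul, abs_of_pos (by norm_num : (0 : ℝ) < 81)]
      linarith
  · rintro f f' F p q r s ⟨a, b, hb, hδ, h, α, x, y, γ, κ₁, κ₂, D, D₀, H⟩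
      ⟨a', b', hb', hδ', h', α', x', y', γ', κ₁', κ₂', D', D₀', H'⟩ hd
    have e : discF (subst F p q r s) = discF F :=
      Eqv.discF_eq ⟨p, q, r, s, Or.inl hd, rfl⟩
    rw [H.discF_eq hδ, H'.discF_eq hδ'] at e
    have e1 : b' = b ∧ a' = a := by
      rcases hb with rfl | rfl <;> rcases hb' with rfl | rfl <;> constructor <;> omega
    obtain ⟨rfl, rfl⟩ := e1
    exact Comp.eqv hδ D D' D₀ H H' hd rfl

variable {a b : ℤ}

lemma pr_neg (x : Quad a b) : pr (-x) = pr x := by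
  rw [pr, pr, ← Set.neg_singleton, Submodule.span_neg]

lemma sp_neg_left (x y : Quad a b) : sp (-x) y = sp x y := by
  rw [sp, Set.pair_comm, ← sp, sp_neg_right, sp, Set.pair_comm, ← sp]

lemma sp_add_mul (x y : Quad a b) (k : ℤ) : sp x (y + (k : Quad a b) * x) = sp x y := by
  have := sp_comb x y (p := 1) (q := k) (r := 0) (s := 1) (by ring)
  simpa [add_comm] using this

lemma Datum.ord_mul_lattice {f : BinaryCubic} {m h : ℤ} {α x y : Quad a b}
    (D : Datum f m h α x y) : ord * (pr α * sp x y ^ 3) = pr α * sp x y ^ 3 := by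
  rw [mul_left_comm, pow_three, ← mul_assoc ord, D.ord_mul]

lemma Datum.lattice_mul_bar {f : BinaryCubic} {m h : ℤ} {α x y : Quad a b}
    (D : Datum f m h α x y) :
    pr α * sp x y ^ 3 * bar (pr α * sp x y ^ 3) = pr (m : Quad a b) * ord := by
  have hm : (m : Quad a b) = α * conj α * (h : Quad a b) ^ 3 := by
    rw [← rat_norm, ← rat_intCast, ← rat_intCast h, ← map_pow, ← map_mul, D.norm_eq]
  have hord : (ord : Submodule ℤ (Quad a b)) ^ 3 = ord := by
    rw [pow_three, ord_mul_ord, ord_mul_ord]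
  rw [bar_mul, bar_pr, bar_pow, mul_mul_mul_comm, ← mul_pow, D.mul_bar, mul_pow, hord, hm,
    pr_mul _ (_ ^ 3), pr_mul, pr_pow, mul_assoc, mul_assoc, mul_assoc]

/-- The lattice attached to a form of Hessian content `m` is determined by a factorization
`m = e²n` and a root modulo `n` of the minimal polynomial of `τ`. -/
lemma Datum.exists_factorization {f : BinaryCubic} {m h : ℤ} {α x y : Quad a b}
    (D : Datum f m h α x y) : ∃ e n u : ℤ, 0 < e ∧ 0 < n ∧ m = e ^ 2 * n ∧
      n ∣ u ^ 2 + b * u - a ∧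
      pr α * sp x y ^ 3 = pr (e : Quad a b) * sp (n : Quad a b) (Quad.mk u 1) := by
  have h1 := D.ord_mul_lattice
  have h2 := D.lattice_mul_bar
  have hm := D.m_pos
  obtain ⟨n', u', e, h3⟩ := exists_eq_sp D.cube_le
  rw [h3] at h1 h2 ⊢
  have key : ∀ c z w v : ℤ,
      (Quad.mk (c * u' + a * (z * e)) (c * e + z * u' + b * (z * e)) : Quad a b) =
      Quad.mk w v → ∃ k l : ℤ, w = k * n' + l * u' ∧ v = l * e := by
    intro c z w v hwv
    have : (Quad.mk c z : Quad a b) * Quad.mk u' e ∈ sp (n' : Quad a b) (Quad.mk u' e) := by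
      rw [← h1]
      exact Submodule.mul_mem_mul (mk_mem_ord _ _) (right_mem_sp _ _)
    obtain ⟨k, l, hkl⟩ := mem_sp.1 this
    have e1 := congrArg re hkl
    have e2 := congrArg im hkl
    have e3 := congrArg re hwv
    have e4 := congrArg im hwv
    simp at e1 e2 e3 e4
    refine ⟨k, l, ?_, ?_⟩
    · have : (w : ℚ) = k * n' + l * u' := by linarith
      exact_mod_cast this
    · have : (v : ℚ) = l * e := by linarith
      exact_mod_cast this
  have h4 : n' * e = m ∨ n' * e = -m := by
    have := im_eq_or_of_mul_bar hm.ne' h2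
    simp only [im_mul_conj, im_intCast, re_intCast, im_mk, re_mk, zero_mul, zero_sub] at this
    rcases this with h | h
    · right
      have : (n' * e : ℚ) = -m := by linarith
      exact_mod_cast this
    · left
      have : (n' * e : ℚ) = m := by linarith
      exact_mod_cast this
  have he : e ≠ 0 := by rintro rfl; simp at h4; omega
  obtain ⟨n, rfl⟩ : e ∣ n' := by
    have : (Quad.mk 0 1 : Quad a b) * (n' : Quad a b) ∈ sp (n' : Quad a b) (Quad.mk u' e) := by
      rw [← h1]
      exact Submodule.mul_mem_mul (right_mem_sp _ _) (left_mem_sp _ _)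
    obtain ⟨k, l, hkl⟩ := mem_sp.1 this
    have e2 := congrArg im hkl
    simp at e2
    exact ⟨l, by rw [mul_comm]; exact_mod_cast e2⟩
  obtain ⟨u, rfl⟩ : e ∣ u' := by
    obtain ⟨k, l, -, hl⟩ := key 0 1 (a * e) (u' + b * e) (by push_cast; congr 1 <;> ring)
    exact ⟨l - b, by linarith⟩
  have hn : n ∣ u ^ 2 + b * u - a := by
    obtain ⟨k, l, hk, hl⟩ := key (u + b) (-1) (e * (u ^ 2 + b * u - a)) 0
      (by push_cast; congr 1 <;> ring)
    have : l = 0 := by simpa [he] using hl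
    exact ⟨k, mul_left_cancel₀ he (by rw [hk, this]; ring)⟩
  have h5 : sp ((e * n : ℤ) : Quad a b) (Quad.mk (e * u : ℤ) e) =
      pr (e : Quad a b) * sp (n : Quad a b) (Quad.mk u 1) := by
    rw [pr_mul_sp]
    congr 1
    · push_cast
      rfl
    · ext <;> simp
  refine ⟨|e|, |n|, u, abs_pos.2 he, abs_pos.2 ?_, ?_, (abs_dvd _ _).2 hn, ?_⟩
  · rintro rfl
    simp at h4
    omega
  · have : |e * n * e| = m := by rcases h4 with h | h <;> rw [h] <;> simp [hm.le]
    rw [← this, abs_mul, abs_mul]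
    ring
  · rw [h5]
    have h6 : pr ((|e| : ℤ) : Quad a b) = pr (e : Quad a b) := by
      rcases abs_choice e with h | h <;> rw [h]
      rw [Int.cast_neg, pr_neg]
    have h7 : sp ((|n| : ℤ) : Quad a b) (Quad.mk u 1) = sp (n : Quad a b) (Quad.mk u 1) := by
      rcases abs_choice n with h | h <;> rw [h]
      rw [Int.cast_neg, sp_neg_left]
    rw [h6, h7]

end Quad

lemma exists_split {p n t : ℕ} (hp : p.Prime) (hpn : p ∣ n) (hpp : ¬p ^ 2 ∣ n) (ht : t < n) {w : ℤ}
    (h : (n : ℤ) ∣ t * (t + w)) : ∃ (g l₁ l₂ : ℕ) (c : Bool), 0 < l₁ ∧ 0 < l₂ ∧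
      n = p * g ^ 2 * l₁ * l₂ ∧ t / (p * g * l₁ * l₂) < g ∧
      ((cond c p 1) * l₁).Coprime ((cond c 1 p) * l₂) ∧
      g * ((cond c p 1) * l₁) ∣ t ∧ ((g * ((cond c 1 p) * l₂) : ℕ) : ℤ) ∣ t + w := by
  have hn : 0 < n := by omega
  obtain ⟨d₂, hd₂⟩ := Nat.gcd_dvd_right t n
  obtain ⟨t', ht'⟩ := Nat.gcd_dvd_left t n
  have hd₁ : 0 < Nat.gcd t n := Nat.gcd_pos_of_pos_right t hn
  have hcop : Nat.Coprime t' d₂ := by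
    have := Nat.coprime_div_gcd_div_gcd hd₁
    rwa [Nat.div_eq_of_eq_mul_right hd₁ ht', Nat.div_eq_of_eq_mul_right hd₁ hd₂] at this
  have h2 : (d₂ : ℤ) ∣ t + w := by
    have h3 : ((Nat.gcd t n : ℕ) : ℤ) * d₂ ∣ (Nat.gcd t n : ℕ) * (t' * (t + w)) := by
      have e1 : (t : ℤ) = (Nat.gcd t n : ℕ) * t' := by exact_mod_cast ht'
      have e2 : (n : ℤ) = (Nat.gcd t n : ℕ) * d₂ := by exact_mod_cast hd₂
      obtain ⟨q, hq⟩ := h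
      exact ⟨q, by linear_combination hq - (t + w) * e1 + q * e2⟩
    have h4 := Int.dvd_of_mul_dvd_mul_left (by exact_mod_cast hd₁.ne') h3
    exact (Nat.isCoprime_iff_coprime.2 hcop.symm).dvd_of_dvd_mul_left h4
  have h1 : Nat.gcd t n ∣ t := Nat.gcd_dvd_left t n
  generalize Nat.gcd t n = d₁ at *
  have hd₂' : 0 < d₂ := Nat.pos_of_ne_zero (by rintro rfl; omega)
  have hg : 0 < Nat.gcd d₁ d₂ := Nat.gcd_pos_of_pos_left _ hd₁
  obtain ⟨x₁, hx₁⟩ := Nat.gcd_dvd_left d₁ d₂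
  obtain ⟨x₂, hx₂⟩ := Nat.gcd_dvd_right d₁ d₂
  have hx : Nat.Coprime x₁ x₂ := by
    have := Nat.coprime_div_gcd_div_gcd hg
    rwa [Nat.div_eq_of_eq_mul_right hg hx₁, Nat.div_eq_of_eq_mul_right hg hx₂] at this
  generalize Nat.gcd d₁ d₂ = g at *
  subst hx₁ hx₂
  have hx₁ : 0 < x₁ := Nat.pos_of_mul_pos_left hd₁
  have hx₂ : 0 < x₂ := Nat.pos_of_mul_pos_left hd₂'
  have hn' : n = g * (g * (x₁ * x₂)) := by rw [hd₂]; ring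
  have hpg : ¬p ∣ g := by
    rintro ⟨k, rfl⟩
    exact hpp ⟨k ^ 2 * x₁ * x₂, by rw [hd₂]; ring⟩
  have hj : t / (g * (x₁ * x₂)) < g := Nat.div_lt_of_lt_mul (by rw [mul_comm, ← hn']; exact ht)
  have hpx : p ∣ x₁ ∨ p ∣ x₂ := by
    rw [hn'] at hpn
    exact (hp.dvd_mul.1 ((hp.dvd_mul.1 ((hp.dvd_mul.1 hpn).resolve_left hpg)).resolve_left hpg))
  rcases hpx with ⟨l, rfl⟩ | ⟨l, rfl⟩
  · refine ⟨g, l, x₂, true, Nat.pos_of_mul_pos_left hx₁, hx₂, by rw [hn']; ring, ?_, ?_, ?_, ?_⟩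
    · rwa [show p * g * l * x₂ = g * (p * l * x₂) by ring]
    · simpa using hx
    · simpa using h1
    · simpa using h2
  · refine ⟨g, x₁, l, false, hx₁, Nat.pos_of_mul_pos_left hx₂, by rw [hn']; ring, ?_, ?_, ?_, ?_⟩
    · rwa [show p * g * x₁ * l = g * (x₁ * (p * l)) by ring]
    · simpa using hx
    · simpa using h1
    · simpa using h2

namespace Quad

variable {a b : ℤ}

@[simp] lemma re_natCast (n : ℕ) : (n : Quad a b).re = n := rfl
@[simp] lemma im_natCast (n : ℕ) : (n : Quad a b).im = 0 := rfl

/-- A root of `u² + bu - a` modulo `n`, if there is one. -/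
noncomputable def rootMod (a b n : ℤ) : ℤ := Classical.epsilon fun u => n ∣ u ^ 2 + b * u - a

lemma dvd_rootMod {n u : ℤ} (h : n ∣ u ^ 2 + b * u - a) :
    n ∣ rootMod a b n ^ 2 + b * rootMod a b n - a :=
  Classical.epsilon_spec (p := fun u => n ∣ u ^ 2 + b * u - a) ⟨u, h⟩

/-- The labels `(e, g, l₁, l₂, j, c)`. -/
abbrev Label : Type := ℕ × ℕ × ℕ × ℕ × ℕ × Bool

/-- The content of the Hessian of a form with a given label. -/
def Label.content (p : ℕ) : Label → ℕ
  | (e, g, l₁, l₂, _, _) => e ^ 2 * (p * g ^ 2 * l₁ * l₂)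

/-- The label of a lattice in `ℤ[τ]`. -/
def HasLabel (p : ℕ) : Label → ∀ a b : ℤ, Submodule ℤ (Quad a b) → Prop
  | (e, g, l₁, l₂, j, c), a, b, A => ∃ t : ℕ,
    ((cond c p 1) * l₁).Coprime ((cond c 1 p) * l₂) ∧
    g * ((cond c p 1) * l₁) ∣ t ∧ ((g * ((cond c 1 p) * l₂) : ℕ) : ℤ) ∣
      t + (2 * rootMod a b ((p * g ^ 2 * l₁ * l₂ : ℕ) : ℤ) + b) ∧
    t / (p * g * l₁ * l₂) + 1 = j ∧
    A = pr ((e : ℤ) : Quad a b) * sp (((p * g ^ 2 * l₁ * l₂ : ℕ) : ℤ) : Quad a b)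
      (mk (rootMod a b ((p * g ^ 2 * l₁ * l₂ : ℕ) : ℤ) + (t : ℤ) : ℤ) 1)

lemma HasLabel.unique {p : ℕ} {i : Label} {A A' : Submodule ℤ (Quad a b)}
    (h : HasLabel p i a b A) (h' : HasLabel p i a b A') : A = A' := by
  obtain ⟨e, g, l₁, l₂, j, c⟩ := i
  obtain ⟨t, h1, h2, h3, h4, rfl⟩ := h
  obtain ⟨t', -, h2', h3', h4', rfl⟩ := h'
  suffices t = t' by rw [this]
  have e1 : ((g * ((cond c p 1) * l₁) : ℕ) : ℤ) ∣ (t : ℤ) - t' :=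
    dvd_sub (Int.natCast_dvd_natCast.2 h2) (Int.natCast_dvd_natCast.2 h2')
  have e2 : ((g * ((cond c 1 p) * l₂) : ℕ) : ℤ) ∣ (t : ℤ) - t' := by
    have := dvd_sub h3 h3'
    rwa [add_sub_add_right_eq_sub] at this
  have e3 : ((p * g * l₁ * l₂ : ℕ) : ℤ) ∣ (t : ℤ) - t' := by
    push_cast at e1 e2
    obtain ⟨k, hk⟩ := dvd_of_mul_right_dvd e1
    rw [hk] at e1 e2 ⊢
    rcases eq_or_ne (g : ℤ) 0 with hg | hg
    · simp [hg]
    have e1' := Int.dvd_of_mul_dvd_mul_left hg e1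
    have e2' := Int.dvd_of_mul_dvd_mul_left hg e2
    have h1' := Nat.isCoprime_iff_coprime.2 h1
    push_cast at h1'
    have e3 : ((p * g * l₁ * l₂ : ℕ) : ℤ) = g *
        (((cond c p 1 : ℕ) : ℤ) * l₁ * (((cond c 1 p : ℕ) : ℤ) * l₂)) := by
      cases c <;> push_cast [cond_true, cond_false] <;> ring
    rw [e3]
    exact mul_dvd_mul_left _ (h1'.mul_dvd e1' e2')
  rcases Nat.eq_zero_or_pos (p * g * l₁ * l₂) with h0 | h0
  · rw [h0] at e3
    simp at e3
    omega
  · have e5 : t % (p * g * l₁ * l₂) = t' % (p * g * l₁ * l₂) :=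
      (Nat.modEq_iff_dvd.2 e3).symm
    rw [← Nat.div_add_mod t (p * g * l₁ * l₂), ← Nat.div_add_mod t' (p * g * l₁ * l₂), e5]
    congr 2
    omega

lemma Datum.exists_label {p : ℕ} (hp : p.Prime) {f : BinaryCubic} {m h : ℤ}
    {α x y : Quad a b} (D : Datum f m h α x y) (hpm : (p : ℤ) ∣ m) (hpp : ¬(p : ℤ) ^ 2 ∣ m) :
    ∃ e g l₁ l₂ j : ℕ, ∃ c : Bool, 0 < e ∧ 0 < g ∧ 0 < l₁ ∧ 0 < l₂ ∧ 0 < j ∧ j ≤ g ∧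
      m = Label.content p (e, g, l₁, l₂, j, c) ∧
      HasLabel p (e, g, l₁, l₂, j, c) a b (pr α * sp x y ^ 3) := by
  obtain ⟨e, n, u, he, hn, rfl, hu, hA⟩ := D.exists_factorization
  lift e to ℕ using he.le
  lift n to ℕ using hn.le
  have he' : 0 < e := by exact_mod_cast he
  have hn' : 0 < n := by exact_mod_cast hn
  have hpe : ¬p ∣ e := fun h => hpp
      (Dvd.dvd.mul_right (pow_dvd_pow_of_dvd (by exact_mod_cast h) 2) _)
  have hpn : p ∣ n := by
    have : p ∣ e ^ 2 * n := by exact_mod_cast hpm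
    exact (hp.dvd_mul.1 this).resolve_left fun h => hpe (hp.dvd_of_dvd_pow h)
  have hppn : ¬p ^ 2 ∣ n := fun h => hpp (Dvd.dvd.mul_left (by exact_mod_cast h) _)
  have hr := dvd_rootMod hu
  set r := rootMod a b n with hr'
  obtain ⟨t, ht⟩ : ∃ t : ℕ, (t : ℤ) = (u - r) % n :=
    ⟨_, Int.toNat_of_nonneg (Int.emod_nonneg _ hn.ne')⟩
  have htn : t < n := by
    have := Int.emod_lt_of_pos (u - r) hn
    omega
  obtain ⟨k, hk⟩ : ∃ k, u = r + t + k * n :=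
    ⟨(u - r) / n, by have := Int.emod_add_mul_ediv (u - r) n; rw [← ht] at this; linarith⟩
  have hdvd : (n : ℤ) ∣ t * (t + (2 * r + b)) := by
    obtain ⟨c, hc⟩ := hu
    obtain ⟨c', hc'⟩ := hr
    refine ⟨c - c' - k * (u + (r + t) + b), ?_⟩
    rw [hk] at hc ⊢
    linear_combination hc - hc'
  obtain ⟨g, l₁, l₂, c, h1, h2, h3, h4, h5, h6, h7⟩ := exists_split hp hpn hppn htn hdvd
  refine ⟨e, g, l₁, l₂, t / (p * g * l₁ * l₂) + 1, c, he', h4.pos, h1, h2, Nat.succ_pos _, h4,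
    ?_, t, h5, h6, ?_, rfl, ?_⟩
  · rw [h3]
    simp only [Label.content]
    push_cast
    rfl
  · rwa [← h3, ← hr']
  · rw [← h3, ← hr', hA]
    congr 1
    rw [← sp_add_mul _ (Quad.mk _ _) (-k)]
    congr 1
    rw [hk]
    ext <;> simp

/-- The weight of a label. -/
noncomputable def Label.weight (i : Label) : ℝ :=
  1 / (i.1 : ℝ) ^ 2 * (1 / (i.2.1 : ℝ) ^ 2 * (1 / (i.2.2.1 : ℝ) ^ 2 *
    (1 / (i.2.2.2.1 : ℝ) ^ 2 * (1 / (i.2.2.2.2.1 : ℝ) ^ 2 *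
        (fun _ : Bool => (1 : ℝ)) i.2.2.2.2.2))))

lemma Label.summable_weight : Summable Label.weight := by
  have h : Summable fun n : ℕ => 1 / (n : ℝ) ^ 2 := Real.summable_one_div_nat_pow.2 (by norm_num)
  have h0 : (0 : ℕ → ℝ) ≤ fun n : ℕ => 1 / (n : ℝ) ^ 2 := fun n => by
      simp only [Pi.zero_apply]; positivity
  have hb : Summable fun _ : Bool => (1 : ℝ) := Summable.of_finite
  have hb0 : (0 : Bool → ℝ) ≤ fun _ : Bool => (1 : ℝ) := fun n => by simp
  have h1 := h.mul_of_nonneg hb h0 hb0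
  have h2 := h.mul_of_nonneg h1 h0 fun i => by simp only [Pi.zero_apply]; positivity
  have h3 := h.mul_of_nonneg h2 h0 fun i => by simp only [Pi.zero_apply]; positivity
  have h4 := h.mul_of_nonneg h3 h0 fun i => by simp only [Pi.zero_apply]; positivity
  exact h.mul_of_nonneg h4 h0 fun i => by simp only [Pi.zero_apply]; positivity

lemma Label.weight_nonneg (i : Label) : 0 ≤ i.weight := by
  unfold Label.weight
  positivity

lemma Label.inv_content_sq_le {p e g l₁ l₂ j : ℕ} {c : Bool} (hp : 0 < p) (he : 0 < e) (hg : 0 < g)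
    (h₁ : 0 < l₁) (h₂ : 0 < l₂) (hj : 0 < j) (hjg : j ≤ g) :
    1 / (Label.content p (e, g, l₁, l₂, j, c) : ℝ) ^ 2 ≤
      1 / (p : ℝ) ^ 2 * Label.weight (e, g, l₁, l₂, j, c) := by
  have e1 : 1 / (p : ℝ) ^ 2 * Label.weight (e, g, l₁, l₂, j, c) =
      1 / ((p ^ 2 * (e ^ 2 * 1) * (g ^ 2 * j ^ 2) * l₁ ^ 2 * l₂ ^ 2 : ℕ) : ℝ) := by
    simp only [Label.weight]
    push_cast
    field_simp
  have e2 : (Label.content p (e, g, l₁, l₂, j, c) : ℝ) ^ 2 =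
      ((p ^ 2 * (e ^ 2 * e ^ 2) * (g ^ 2 * g ^ 2) * l₁ ^ 2 * l₂ ^ 2 : ℕ) : ℝ) := by
    simp only [Label.content]
    push_cast
    ring
  rw [e1, e2]
  refine one_div_le_one_div_of_le (by positivity) ?_
  have : 1 ≤ e ^ 2 := Nat.one_le_pow _ _ he
  exact_mod_cast (by gcongr :
    p ^ 2 * (e ^ 2 * 1) * (g ^ 2 * j ^ 2) * l₁ ^ 2 * l₂ ^ 2 ≤
      p ^ 2 * (e ^ 2 * e ^ 2) * (g ^ 2 * g ^ 2) * l₁ ^ 2 * l₂ ^ 2)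

/-- The form `f` has a datum whose Hessian content is exactly divisible by `p`. -/
def HasDatum (p : ℕ) (f : BinaryCubic) : Prop :=
  ∃ a b m : ℤ, (b = 0 ∨ b = 1) ∧ 3 * discF f = -(m ^ 2 * (b ^ 2 + 4 * a)) ∧
    (p : ℤ) ∣ m ∧ ¬(p : ℤ) ^ 2 ∣ m ∧ ∃ (h : ℤ) (α x y : Quad a b), Datum f m h α x y

lemma classBound_hasDatum {K : ℝ} (hK0 : 0 ≤ K)
    (hK : ∀ X : ℝ, 0 < X → ClassBound (DiscLT X) (K * X)) {p : ℕ} (hp : p.Prime) {X : ℝ}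
    (hX : 0 < X) : ClassBound (fun f => DiscLT X f ∧ HasDatum p f)
      (162 * K * X / (p : ℝ) ^ 2 * ∑' i, Label.weight i) := by
  have hlab : ∀ f, DiscLT X f ∧ HasDatum p f → ∃ i : Label,
      1 / (i.content p : ℝ) ^ 2 ≤ 1 / (p : ℝ) ^ 2 * i.weight ∧
      ∃ a b : ℤ, (b = 0 ∨ b = 1) ∧ 3 * discF f = -((i.content p : ℤ) ^ 2 * (b ^ 2 + 4 * a)) ∧
      ∃ (h : ℤ) (α x y : Quad a b), Datum f (i.content p) h α x y ∧
        HasLabel p i a b (pr α * sp x y ^ 3) := by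
    rintro f ⟨-, a, b, m, hb, hf, hpm, hpp, h, α, x, y, D⟩
    obtain ⟨e, g, l₁, l₂, j, c, he, hg, h₁, h₂, hj, hjg, rfl, hi⟩ := D.exists_label hp hpm hpp
    exact ⟨_, Label.inv_content_sq_le hp.pos he hg h₁ h₂ hj hjg, a, b, hb, hf, h, α, x, y, D, hi⟩
  choose! ℓ hℓ using hlab
  refine ClassBound.of_label ℓ (fun i => 1 / (i.content p : ℝ) ^ 2 ≤ 1 / (p : ℝ) ^ 2 * i.weight)
    (fun f hf => (hℓ f hf).1) (fun i => 162 * K * X / (p : ℝ) ^ 2 * i.weight) ?_ ?_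
  · intro i hi
    refine (classBound_of_lattice hK hX (i.content p)
      fun a b => Classical.epsilon (HasLabel p i a b)).mono ?_ ?_
    · rintro f ⟨hf, rfl⟩
      obtain ⟨-, a, b, hb, hd, h, α, x, y, D, hA⟩ := hℓ f hf
      exact ⟨hf.1, a, b, hb, hd, h, α, x, y, D,
        hA.unique (Classical.epsilon_spec (p := HasLabel p (ℓ f) a b) ⟨_, hA⟩)⟩
    · have := mul_le_mul_of_nonneg_left hi (by positivity : 0 ≤ 162 * K * X)
      rw [Int.cast_natCast]
      calc 162 * K * X / (i.content p : ℝ) ^ 2 =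
          162 * K * X * (1 / (i.content p : ℝ) ^ 2) := by ring
        _ ≤ _ := this
        _ = _ := by ring
  · intro t _
    rw [← Finset.mul_sum]
    exact mul_le_mul_of_nonneg_left
      (Label.summable_weight.sum_le_tsum t fun i _ => i.weight_nonneg) (by positivity)

end Quad

/-- `n` divides all coefficients of the Hessian of the form. -/
def HessDvd (n : ℤ) (f : BinaryCubic) : Prop :=
  n ∣ (hess f).1 ∧ n ∣ (hess f).2.1 ∧ n ∣ (hess f).2.2

lemma HessDvd.of_eqv {n : ℤ} {f g : BinaryCubic} (hf : HessDvd n f) (h : Eqv f g) :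
    HessDvd n g := by
  obtain ⟨p, q, r, s, -, rfl⟩ := h
  obtain ⟨⟨u, hu⟩, ⟨v, hv⟩, ⟨w, hw⟩⟩ := hf
  unfold HessDvd
  rw [hess_subst, hu, hv, hw]
  exact ⟨Dvd.intro _
      (by ring : n * ((p * s - q * r) ^ 2 * (u * p ^ 2 + v * p * r + w * r ^ 2)) = _),
    Dvd.intro _ (by ring : n * ((p * s - q * r) ^ 2 *
      (2 * u * p * q + v * (p * s + q * r) + 2 * w * r * s)) = _),
    Dvd.intro _ (by ring : n * ((p * s - q * r) ^ 2 * (u * q ^ 2 + v * q * s + w * s ^ 2)) = _)⟩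

lemma exists_eqv_hess_fst_ne_zero {f : BinaryCubic} (hf : discF f ≠ 0) :
    ∃ g, Eqv f g ∧ (hess g).1 ≠ 0 := by
  by_cases h1 : (hess f).1 = 0
  · have h4 := four_mul_hess f
    have h2 : (hess f).2.1 ≠ 0 := by
      intro h2
      rw [h1, h2] at h4
      exact hf (by linarith)
    by_cases h3 : (hess f).2.2 = 0
    · refine ⟨subst f 1 0 1 1, ⟨1, 0, 1, 1, by norm_num, rfl⟩, ?_⟩
      rw [hess_subst]
      simpa [h1, h3] using h2
    · refine ⟨subst f 0 1 1 0, ⟨0, 1, 1, 0, by norm_num, rfl⟩, ?_⟩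
      rw [hess_subst]
      simpa [h1] using h3
  · exact ⟨f, Eqv.refl f, h1⟩

lemma exists_content_eq (u v w : ℤ) (hu : u ≠ 0) :
    ∃ m u' v' w' : ℤ, 0 < m ∧ u = m * u' ∧ v = m * v' ∧ w = m * w' ∧
      ∃ x y z : ℤ, x * u' + y * v' + z * w' = 1 := by
  have hg : 0 < ((u.gcd v : ℕ) : ℤ) := by exact_mod_cast Int.gcd_pos_of_ne_zero_left v hu
  have hm : 0 < (((u.gcd v : ℕ) : ℤ).gcd w : ℤ) := by
    exact_mod_cast Int.gcd_pos_of_ne_zero_left w hg.ne'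
  have e1 := Int.gcd_eq_gcd_ab u v
  have e2 := Int.gcd_eq_gcd_ab ((u.gcd v : ℕ) : ℤ) w
  have d1 : (((u.gcd v : ℕ) : ℤ).gcd w : ℤ) ∣ u.gcd v := Int.gcd_dvd_left ..
  obtain ⟨u', hu'⟩ := d1.trans (Int.gcd_dvd_left u v)
  obtain ⟨v', hv'⟩ := d1.trans (Int.gcd_dvd_right u v)
  obtain ⟨w', hw'⟩ : (((u.gcd v : ℕ) : ℤ).gcd w : ℤ) ∣ w := Int.gcd_dvd_right ..
  generalize (((u.gcd v : ℕ) : ℤ).gcd w : ℤ) = m at *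
  generalize ((u.gcd v : ℕ) : ℤ).gcdA w = s at *
  generalize ((u.gcd v : ℕ) : ℤ).gcdB w = z at *
  generalize ((u.gcd v : ℕ) : ℤ) = g at *
  refine ⟨m, u', v', w', hm, hu', hv', hw', s * u.gcdA v, s * u.gcdB v, z, ?_⟩
  refine mul_left_cancel₀ hm.ne' ?_
  linear_combination -e2 - s * e1 - s * u.gcdA v * hu' - s * u.gcdB v * hv' - z * hw'

lemma exists_eqv_hasDatum {p : ℕ} {f : BinaryCubic} (hf : discF f ≠ 0) (hp : HessDvd p f)
    (hpp : ¬HessDvd ((p : ℤ) ^ 2) f) : ∃ g, Eqv f g ∧ Quad.HasDatum p g := by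
  obtain ⟨g, hg, h1⟩ := exists_eqv_hess_fst_ne_zero hf
  refine ⟨g, hg, ?_⟩
  replace hp := hp.of_eqv hg
  replace hpp : ¬HessDvd ((p : ℤ) ^ 2) g := fun h => hpp (h.of_eqv hg.symm)
  obtain ⟨m, h, B, h₂, hm, e1, e2, e3, x, y, z, hxyz⟩ :=
      exists_content_eq _ (hess g).2.1 (hess g).2.2 h1
  have hdvd : ∀ n : ℤ, HessDvd n g ↔ n ∣ m := by
    intro n
    constructor
    · rintro ⟨i1, i2, i3⟩
      have : m = x * (hess g).1 + y * (hess g).2.1 + z * (hess g).2.2 := by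
        rw [e1, e2, e3]
        linear_combination -m * hxyz
      rw [this]
      exact dvd_add (dvd_add (i1.mul_left _) (i2.mul_left _)) (i3.mul_left _)
    · intro i
      unfold HessDvd
      rw [e1, e2, e3]
      exact ⟨i.mul_right _, i.mul_right _, i.mul_right _⟩
  rw [hdvd] at hp hpp
  obtain ⟨b, k, hb, rfl⟩ : ∃ b k : ℤ, (b = 0 ∨ b = 1) ∧ B = 2 * k + b :=
    ⟨B % 2, B / 2, by omega, by omega⟩
  refine ⟨k ^ 2 + b * k - h * h₂, b, m, hb, ?_, hp, hpp, h, ?_⟩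
  · rw [← four_mul_hess g, e1, e2, e3]
    ring
  · refine Quad.exists_datum (k := k) (h₂ := h₂) hm ?_ ?_ (by ring) ⟨x, y, z, hxyz⟩
    · rintro rfl
      exact h1 (by rw [e1, mul_zero])
    · rw [← e1, ← e2, ← e3]

lemma TripleAt.hessDvd {p : ℤ} {f : BinaryCubic} (hf : TripleAt p f) : HessDvd p f := by
  obtain ⟨a, b, c, d⟩ := f
  obtain ⟨⟨a, rfl⟩, ⟨b, rfl⟩, ⟨c, rfl⟩, -⟩ := hf
  simp only [HessDvd, hess]
  exact ⟨Dvd.intro _ (by ring : p * (p * b ^ 2 - 3 * a * (p * c)) = _),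
    Dvd.intro _ (by ring : p * (p * b * c - 9 * a * d) = _),
    Dvd.intro _ (by ring : p * (p * c ^ 2 - 3 * b * d) = _)⟩

lemma TripleAt.nonMaxAt {p : ℕ} (hp : p.Prime) (h3 : 3 < p) {f : BinaryCubic} (hf : TripleAt p f)
    (h : HessDvd ((p : ℤ) ^ 2) f) : NonMaxAt p f := by
  obtain ⟨a, b, c, d⟩ := f
  obtain ⟨h1, ⟨b, rfl⟩, ⟨c, rfl⟩, hd⟩ := hf
  obtain ⟨-, h2, -⟩ := h
  refine ⟨?_, dvd_mul_right ..⟩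
  simp only [hess] at h2 hd ⊢
  have h4 : (p : ℤ) ^ 2 ∣ 9 * d * a := by
    have := dvd_sub (Dvd.intro _ (by ring : (p : ℤ) ^ 2 * (b * c) = p * b * (p * c))) h2
    rwa [show p * b * (p * c) - (p * b * (p * c) - 9 * a * d) = 9 * d * a by ring] at this
  have hp' : Prime (p : ℤ) := Nat.prime_iff_prime_int.1 hp
  refine IsCoprime.dvd_of_dvd_mul_left (IsCoprime.pow_left ?_) h4
  rw [Prime.coprime_iff_not_dvd hp']
  intro h5
  rcases hp'.dvd_or_dvd h5 with h5 | h5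
  · have h6 : (p : ℤ) ∣ 3 := hp'.dvd_of_dvd_pow (n := 2) (by norm_num; exact h5)
    have := Int.le_of_dvd (by norm_num) h6
    omega
  · exact hd h5

lemma exists_tripleAt_of_hasTripleRoot {p : ℕ} [Fact p.Prime] {f : BinaryCubic}
    (h : HasTripleRoot p f) (h3 : 3 < p) : ∃ g, Eqv f g ∧ TripleAt p g := by
  obtain ⟨u, r, s, hu, hrs, e⟩ := h
  have ev : ∀ x : Fin 2 → ZMod p, _ := fun x => congrArg (MvPolynomial.eval x) e
  simp only [eval_toPoly, map_mul, map_pow, map_add, MvPolynomial.eval_C,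
    MvPolynomial.eval_X] at ev
  have e1 := ev ![1, 0]
  have e2 := ev ![0, 1]
  have e3 := ev ![1, 1]
  have e4 := ev ![1, -1]
  obtain ⟨a, b, c, d⟩ := f
  simp only [Matrix.cons_val_zero, Matrix.cons_val_one] at e1 e2 e3 e4
  have two : (2 : ZMod p) ≠ 0 := by
    intro h
    have h' : ((2 : ℕ) : ZMod p) = 0 := by exact_mod_cast h
    rw [ZMod.natCast_eq_zero_iff] at h'
    have := Nat.le_of_dvd (by norm_num) h'
    omega
  have ha : (a : ZMod p) = u * r ^ 3 := by linear_combination e1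
  have hd : (d : ZMod p) = u * s ^ 3 := by linear_combination e2
  have hb : (b : ZMod p) = 3 * u * r ^ 2 * s := by
    refine mul_left_cancel₀ two ?_
    linear_combination e3 - e4 - 2 * e2
  have hc : (c : ZMod p) = 3 * u * r * s ^ 2 := by
    refine mul_left_cancel₀ two ?_
    linear_combination e3 + e4 - 2 * e1
  have hu0 := hu.ne_zero
  by_cases hs : s = 0
  · subst hs
    have hr : r ≠ 0 := fun h => hrs (by rw [h])
    refine ⟨subst (a, b, c, d) 0 1 1 0, ⟨0, 1, 1, 0, by norm_num, rfl⟩, ?_⟩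
    simp only [TripleAt, subst, ← ZMod.intCast_zmod_eq_zero_iff_dvd]
    push_cast
    rw [ha, hb, hc, hd]
    refine ⟨by ring, by ring, by ring, ?_⟩
    simpa using ⟨hu0, hr⟩
  · refine ⟨subst (a, b, c, d) 1 0 (-((r / s).val : ℤ)) 1, ⟨_, _, _, _, by norm_num, rfl⟩, ?_⟩
    simp only [TripleAt, subst, ← ZMod.intCast_zmod_eq_zero_iff_dvd]
    push_cast
    rw [ZMod.natCast_zmod_val, ha, hb, hc, hd]
    refine ⟨by field_simp; ring, by field_simp; ring, by field_simp; ring, ?_⟩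
    simpa using ⟨hu0, hs⟩

lemma exists_nonMaxAt_of_actsTo {p : ℕ} {γ : Matrix (Fin 2) (Fin 2) ℤ} {f g : BinaryCubic}
    (hγ : IsUnit γ.det) (h : ActsTo γ f g) (h1 : (p : ℤ) ^ 2 ∣ g.1) (h2 : (p : ℤ) ∣ g.2.1) :
    ∃ g, Eqv f g ∧ NonMaxAt p g := by
  refine ⟨_, ⟨γ 0 0, γ 1 0, γ 0 1, γ 1 1, ?_, rfl⟩, ?_⟩
  · rw [Int.isUnit_iff, Matrix.det_fin_two] at hγ
    rwa [mul_comm (γ 1 0)]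
  · rw [← det_mul_eq_subst_of_actsTo h]
    exact ⟨h1.mul_left _, h2.mul_left _⟩

lemma classBound_inZp {K : ℝ} (hK0 : 0 ≤ K)
    (hK : ∀ X : ℝ, 0 < X → ClassBound (DiscLT X) (K * X)) {p : ℕ} (hp : p.Prime) {X : ℝ}
    (hX : 0 < X) : ClassBound (fun f => DiscLT X f ∧ InZp p f)
      ((9 * K + 162 * K * ∑' i, Quad.Label.weight i) * X / (p : ℝ) ^ 2) := by
  have : Fact p.Prime := ⟨hp⟩
  have hp1 : (1 : ℝ) ≤ p := by exact_mod_cast hp.one_le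
  have hS : 0 ≤ ∑' i, Quad.Label.weight i := tsum_nonneg fun i => i.weight_nonneg
  by_cases h3 : p ≤ 3
  · refine (hK X hX).mono (fun f hf => hf.1) ?_
    have hp3 : (p : ℝ) ^ 2 ≤ 9 := by
      have : (p : ℝ) ≤ 3 := by exact_mod_cast h3
      nlinarith
    rw [le_div_iff₀ (by positivity)]
    calc K * X * (p : ℝ) ^ 2 ≤ K * X * 9 := by gcongr
      _ = (9 * K + 0) * X := by ring
      _ ≤ _ := by gcongr; positivity
  · have b1 : ClassBound (fun f => DiscLT X f ∧ DvdForm p f) (K * X / (p : ℝ) ^ 2) := by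
      refine (classBound_dvdForm (by exact_mod_cast hp.ne_zero) (hK _ (by positivity))).mono
        (fun f hf => hf) ?_
      push_cast
      rw [← mul_div_assoc]
      exact div_le_div_of_nonneg_left (by positivity) (by positivity)
        (pow_le_pow_right₀ hp1 (by norm_num))
    have b2 := classBound_nonMaxAt hK0 hK (p := p) hX
    have b3 := Quad.classBound_hasDatum hK0 hK hp hX
    refine (((b1.or b2).or b3).of_reps fun f hf => ?_).mono (fun f hf => hf) ?_
    · obtain ⟨hf, hz⟩ := hf
      rcases hz with h | ⟨γ, g, hγ, hg, h1, h2⟩ | h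
      · exact ⟨f, Eqv.refl f, Or.inl (Or.inl ⟨hf, dvdForm_iff.2 h⟩)⟩
      · obtain ⟨g, hfg, hg⟩ := exists_nonMaxAt_of_actsTo hγ hg h1 h2
        exact ⟨g, hfg, Or.inl (Or.inr ⟨hfg.discLT hf, hg⟩)⟩
      · obtain ⟨g, hfg, hg⟩ := exists_tripleAt_of_hasTripleRoot h (by omega)
        by_cases hpp : HessDvd ((p : ℤ) ^ 2) g
        · exact ⟨g, hfg, Or.inl (Or.inr ⟨hfg.discLT hf, hg.nonMaxAt hp (by omega) hpp⟩)⟩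
        · obtain ⟨k, hgk, hk⟩ := exists_eqv_hasDatum (hfg.discLT hf).1 hg.hessDvd hpp
          have hfk := hfg.trans hgk
          exact ⟨k, hfk, Or.inr ⟨hfk.discLT hf, hk⟩⟩
    · calc _ = (7 * K + 162 * K * ∑' i, Quad.Label.weight i) * X / (p : ℝ) ^ 2 := by ring
        _ ≤ _ := by gcongr; norm_num

end BinaryCubic

theorem uniformity_estimate :
    ∃ C : ℝ, ∀ p : ℕ, p.Prime → ∀ X : ℝ, 1 ≤ X →
      ((countClasses fun f => IrredForm f ∧ |(discF f : ℝ)| < X ∧ InZp p f) : ℝ) ≤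
        C * X / (p : ℝ) ^ 2 := by
  obtain ⟨K, hK0, hK⟩ := BinaryCubic.exists_classBound_discLT
  refine ⟨9 * K + 162 * K * ∑' i, BinaryCubic.Quad.Label.weight i,
      fun p hp X hX => BinaryCubic.ClassBound.countClasses_le ?_⟩
  exact (BinaryCubic.classBound_inZp hK0 hK hp (by linarith : 0 < X)).mono
    (fun f hf => ⟨⟨BinaryCubic.discF_ne_zero_of_irredForm hf.1, hf.2.1⟩, hf.2.2⟩) le_rfl
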